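/- Let A_Γ be a 2-dimensional Artin group, let a1, a2 be vertices of Γ and let g1, g2 ∈ A_Γ. If the cosets g1·⟨a1⟩ and g2·⟨a2⟩ are at finite Hausdorff distance with respect to the word metric, then the conjugate cyclic subgroups coincide: g1·⟨a1⟩·g1^{-1} = g2·⟨a2⟩·g2^{-1}. In particular, the cyclic subgroup g1⟨a1⟩g1^{-1} stabilizes (by left multiplication) every coset of the form g⟨a⟩ (a a vertex of Γ) that is at finite Hausdorff distance from g1⟨a1⟩. -/

import Mathlib

/-- The alternating product `x y x y ⋯` with `n` factors. -/
def altProd {G : Type*} [Monoid G] : ℕ → G → G → G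
  | 0, _, _ => 1
  | n + 1, x, y => x * altProd n y x

/-- A simple graph with each edge labeled by an integer `≥ 2`. -/
structure LabeledGraph (V : Type*) where
  graph : SimpleGraph V
  label : V → V → ℕ
  label_symm : ∀ a b, label a b = label b a
  two_le_label : ∀ ⦃a b⦄, graph.Adj a b → 2 ≤ label a b

namespace LabeledGraph

variable {V : Type*} (Γ : LabeledGraph V)

/-- The Artin relations `prod(a,b;m) = prod(b,a;m)` associated to a labeled graph,
as elements of the free group on the vertices. -/
def artinRels : Set (FreeGroup V) :=
  { r | ∃ a b, Γ.graph.Adj a b ∧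
      r = altProd (Γ.label a b) (FreeGroup.of a) (FreeGroup.of b) *
          (altProd (Γ.label a b) (FreeGroup.of b) (FreeGroup.of a))⁻¹ }

end LabeledGraph

/-- The Artin group with defining labeled graph `Γ`. -/
abbrev ArtinGroup {V : Type*} (Γ : LabeledGraph V) :=
  PresentedGroup Γ.artinRels

/-- The standard generator of the Artin group corresponding to a vertex. -/
def artinGen {V : Type*} (Γ : LabeledGraph V) (v : V) : ArtinGroup Γ :=
  PresentedGroup.of v

/-- Word length of a group element with respect to a set `S` of generators
(words may use generators and their inverses). -/
noncomputable def wordLength {G : Type*} [Group G] (S : Set G) (g : G) : ℕ :=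
  sInf { n | ∃ l : List G, l.length = n ∧ (∀ x ∈ l, x ∈ S ∨ x⁻¹ ∈ S) ∧ l.prod = g }

/-- Word metric with respect to a generating set `S`. -/
noncomputable def wordDist {G : Type*} [Group G] (S : Set G) (g h : G) : ℝ :=
  (wordLength S (g⁻¹ * h) : ℝ)

/-- The word metric on an Artin group with respect to the standard generators. -/
noncomputable def artinDist {V : Type*} (Γ : LabeledGraph V) :
    ArtinGroup Γ → ArtinGroup Γ → ℝ :=
  wordDist (Set.range (artinGen Γ))

/-- `(L,A)`-quasi-isometric embedding between spaces with distance functions. -/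
def IsQIEmbedding {X Y : Type*} (L A : ℝ) (dX : X → X → ℝ) (dY : Y → Y → ℝ)
    (q : X → Y) : Prop :=
  ∀ x x', dX x x' / L - A ≤ dY (q x) (q x') ∧ dY (q x) (q x') ≤ L * dX x x' + A

/-- `(L,A)`-quasi-isometry: an `(L,A)`-quasi-isometric embedding with `A`-dense image. -/
def IsQuasiIsometry {X Y : Type*} (L A : ℝ) (dX : X → X → ℝ) (dY : Y → Y → ℝ)
    (q : X → Y) : Prop :=
  IsQIEmbedding L A dX dY q ∧ ∀ y : Y, ∃ x : X, dY (q x) y ≤ A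

/-- CLTTF: connected with at least three vertices, large type, triangle free. -/
def LabeledGraph.CLTTF {V : Type*} (Γ : LabeledGraph V) : Prop :=
  Γ.graph.Connected ∧ 3 ≤ Nat.card V ∧
    (∀ ⦃a b⦄, Γ.graph.Adj a b → 3 ≤ Γ.label a b) ∧ Γ.graph.CliqueFree 3

/-- A decomposition of `Γ` as a union of two full subgraphs (given by vertex sets
`S₁`, `S₂`, each different from `T`) intersecting along `T`. -/
def LabeledGraph.IsSepDecomp {V : Type*} (Γ : LabeledGraph V) (S₁ S₂ T : Set V) : Prop :=
  S₁ ∪ S₂ = Set.univ ∧ S₁ ∩ S₂ = T ∧ S₁ ≠ T ∧ S₂ ≠ T ∧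
    ∀ ⦃a b⦄, Γ.graph.Adj a b → (a ∈ S₁ ∧ b ∈ S₁) ∨ (a ∈ S₂ ∧ b ∈ S₂)

/-- `Γ` has a separating vertex or a separating edge. -/
def LabeledGraph.HasSeparatingVertexOrEdge {V : Type*} (Γ : LabeledGraph V) : Prop :=
  (∃ v : V, ∃ S₁ S₂ : Set V, Γ.IsSepDecomp S₁ S₂ {v}) ∨
    ∃ a b : V, Γ.graph.Adj a b ∧ ∃ S₁ S₂ : Set V, Γ.IsSepDecomp S₁ S₂ {a, b}

/-- An isomorphism of labeled graphs: a graph isomorphism preserving edge labels. -/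
structure LabeledGraphIso {V V' : Type*} (Γ : LabeledGraph V) (Γ' : LabeledGraph V') where
  toEquiv : V ≃ V'
  adj_iff : ∀ a b, Γ'.graph.Adj (toEquiv a) (toEquiv b) ↔ Γ.graph.Adj a b
  label_eq : ∀ ⦃a b⦄, Γ.graph.Adj a b → Γ'.label (toEquiv a) (toEquiv b) = Γ.label a b

/-- `f` is an isometry for the distance function `d`. -/
def IsIsometryOf {X : Type*} (d : X → X → ℝ) (f : X → X) : Prop :=
  ∀ x y, d (f x) (f y) = d x y

/-- The left coset `g•H` as a set. -/
def leftCosetSet {G : Type*} [Group G] (g : G) (H : Subgroup G) : Set G :=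
  (fun x => g * x) '' (H : Set G)

/-- The standard subgroup generated by the two endpoints of an edge. -/
def edgeSubgroup {V : Type*} (Γ : LabeledGraph V) (a b : V) : Subgroup (ArtinGroup Γ) :=
  Subgroup.closure {artinGen Γ a, artinGen Γ b}

/-- The standard subgroup generated by a set of vertices. -/
def standardSubgroup {V : Type*} (Γ : LabeledGraph V) (S : Set V) :
    Subgroup (ArtinGroup Γ) :=
  Subgroup.closure (artinGen Γ '' S)

/-- The element `Δ_e = prod(a,b;m)` associated to an edge `e = {a,b}` of label `m`. -/
def artinDelta {V : Type*} (Γ : LabeledGraph V) (a b : V) : ArtinGroup Γ :=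
  altProd (Γ.label a b) (artinGen Γ a) (artinGen Γ b)

/-- A leaf of a graph: a vertex with a unique neighbour. -/
def LabeledGraph.IsLeaf {V : Type*} (Γ : LabeledGraph V) (a : V) : Prop :=
  ∃! b, Γ.graph.Adj a b

/-- A stable vertex: not a leaf, or a leaf whose unique incident edge has odd label
and whose other endpoint is not a leaf. -/
def LabeledGraph.StableVertex {V : Type*} (Γ : LabeledGraph V) (a : V) : Prop :=
  ¬ Γ.IsLeaf a ∨
    (Γ.IsLeaf a ∧ ∃ b, Γ.graph.Adj a b ∧ Odd (Γ.label a b) ∧ ¬ Γ.IsLeaf b)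

/-- Stable cosets: left cosets of cyclic subgroups `⟨Δ_e⟩` for an edge `e`, or `⟨a⟩`
for a stable vertex `a`. -/
def StableCoset {V : Type*} (Γ : LabeledGraph V) (C : Set (ArtinGroup Γ)) : Prop :=
  (∃ (g : ArtinGroup Γ) (a b : V), Γ.graph.Adj a b ∧
      C = leftCosetSet g (Subgroup.zpowers (artinDelta Γ a b))) ∨
    ∃ (g : ArtinGroup Γ) (a : V), Γ.StableVertex a ∧
      C = leftCosetSet g (Subgroup.zpowers (artinGen Γ a))

/-- The Hausdorff distance between `A` and `B` (w.r.t. the distance function `d`)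
is less than `D`. -/
def HausdorffClose {X : Type*} (d : X → X → ℝ) (D : ℝ) (A B : Set X) : Prop :=
  (∀ a ∈ A, ∃ b ∈ B, d a b < D) ∧ ∀ b ∈ B, ∃ a ∈ A, d a b < D

/-- Two subsets are parallel if they are at finite Hausdorff distance. -/
def CoarseParallel {X : Type*} (d : X → X → ℝ) (A B : Set X) : Prop :=
  ∃ D : ℝ, HausdorffClose d D A B

/-- A `2`-dimensional Artin group: every triangle with labels `p, q, r` satisfies
`1/p + 1/q + 1/r ≤ 1`. -/
def LabeledGraph.TwoDimensional {V : Type*} (Γ : LabeledGraph V) : Prop :=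
  ∀ a b c : V, Γ.graph.Adj a b → Γ.graph.Adj b c → Γ.graph.Adj a c →
    (1 / (Γ.label a b : ℚ)) + 1 / (Γ.label b c : ℚ) + 1 / (Γ.label a c : ℚ) ≤ 1

namespace ArtinDiagram

open Equiv Equiv.Perm

section PermCounting

variable {α : Type*}

/-- The permutation `g` fixes every point outside `A`. -/
def SuppIn (A : Finset α) (g : Perm α) : Prop := ∀ x, x ∉ A → g x = x

lemma SuppIn.mem_iff {A : Finset α} {g : Perm α} (h : SuppIn A g) (x : α) : g x ∈ A ↔ x ∈ A := by
  constructor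
  · intro hx
    by_contra hn
    exact hn (by rwa [h x hn] at hx)
  · intro hx
    by_contra hn
    have := g.injective (h _ hn)
    rw [this] at hn
    exact hn hx

lemma SuppIn.mul {A : Finset α} {g h : Perm α} (hg : SuppIn A g) (hh : SuppIn A h) :
    SuppIn A (g * h) := by
  intro x hx
  rw [Perm.mul_apply, hh x hx, hg x hx]

lemma SuppIn.inv {A : Finset α} {g : Perm α} (hg : SuppIn A g) : SuppIn A g⁻¹ := by
  intro x hx
  rw [Perm.inv_eq_iff_eq, hg x hx]

lemma SuppIn.swap [DecidableEq α] {A : Finset α} {x y : α} (hx : x ∈ A) (hy : y ∈ A) :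
    SuppIn A (swap x y) := by
  intro z hz
  exact swap_apply_of_ne_of_ne (fun h => hz (h ▸ hx)) (fun h => hz (h ▸ hy))

lemma SuppIn.sameCycle_mem {A : Finset α} {g : Perm α} (hg : SuppIn A g) {x y : α}
    (h : SameCycle g x y) : x ∈ A ↔ y ∈ A := by
  obtain ⟨i, rfl⟩ := h
  constructor
  · intro hx
    by_contra hn
    have h1 : (g ^ (-i)) ((g ^ i) x) = (g ^ i) x := by
      have : SameCycle g ((g ^ i) x) ((g ^ (-i)) ((g ^ i) x)) := ⟨-i, rfl⟩
      exact zpow_apply_eq_self_of_apply_eq_self (hg _ hn) _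
    simp at h1
    rw [← h1] at hn
    exact hn hx
  · intro hx
    by_contra hn
    rw [zpow_apply_eq_self_of_apply_eq_self (hg _ hn)] at hx
    exact hn hx

lemma SuppIn.exists_pow {A : Finset α} {g : Perm α} (hg : SuppIn A g) (x : α) :
    ∃ n, 0 < n ∧ (g ^ n) x = x := by
  by_cases hx : x ∈ A
  · have hmem : ∀ n : ℕ, (g ^ n) x ∈ A := fun n =>
      (hg.sameCycle_mem ⟨(n : ℤ), by simp⟩).1 hx
    obtain ⟨i, j, hij, h⟩ := Finite.exists_ne_map_eq_of_infinite
      (fun n : ℕ => (⟨(g ^ n) x, hmem n⟩ : A))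
    simp only [Subtype.mk.injEq] at h
    wlog hlt : i < j generalizing i j
    · exact this j i hij.symm h.symm (by omega)
    refine ⟨j - i, by omega, ?_⟩
    apply (g ^ i).injective
    rw [← Perm.mul_apply, ← pow_add, Nat.add_sub_cancel' hlt.le, h]
  · exact ⟨1, one_pos, by simpa using hg x hx⟩

/-- Every orbit of `g` is finite. -/
def Periodic (g : Perm α) : Prop := ∀ x, ∃ n, 0 < n ∧ (g ^ n) x = x

lemma SuppIn.periodic {A : Finset α} {g : Perm α} (hg : SuppIn A g) : Periodic g :=
  hg.exists_pow

lemma exists_pow_lt_of_sameCycle {g : Perm α} {x y : α} {n : ℕ} (hn : 0 < n)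
    (hx : (g ^ n) x = x) (h : SameCycle g x y) : ∃ i < n, (g ^ i) x = y := by
  obtain ⟨k, rfl⟩ := h
  refine ⟨(k % n).toNat, ?_, ?_⟩
  · have := Int.emod_lt_of_pos k (by exact_mod_cast hn : (0 : ℤ) < n)
    have := Int.emod_nonneg k (by positivity : (n : ℤ) ≠ 0)
    omega
  · have h0 := Int.emod_nonneg k (by positivity : (n : ℤ) ≠ 0)
    rw [← zpow_natCast, Int.toNat_of_nonneg h0]
    have hk : k = k % n + n * (k / n) := (Int.emod_add_mul_ediv k n).symm
    conv_rhs => rw [hk, zpow_add, zpow_mul, Perm.mul_apply]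
    rw [zpow_apply_eq_self_of_apply_eq_self (x := x) (f := g ^ (n : ℤ)) (by rwa [zpow_natCast])]

lemma Periodic.exists_pow_of_sameCycle {g : Perm α} (hg : Periodic g) {x y : α}
    (h : SameCycle g x y) : ∃ i : ℕ, (g ^ i) x = y := by
  obtain ⟨n, hn, hx⟩ := hg x
  obtain ⟨i, -, hi⟩ := exists_pow_lt_of_sameCycle hn hx h
  exact ⟨i, hi⟩

/-- A relation reflexive, transitive and containing the graph of `g` contains `SameCycle g`. -/
lemma Periodic.rel_of_sameCycle {g : Perm α} (hg : Periodic g) {R : α → α → Prop}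
    (hrefl : ∀ x, R x x) (htrans : ∀ x y z, R x y → R y z → R x z) (hstep : ∀ x, R x (g x))
    {x y : α} (h : SameCycle g x y) : R x y := by
  obtain ⟨i, rfl⟩ := hg.exists_pow_of_sameCycle h
  induction i with
  | zero => exact hrefl x
  | succ i ih =>
    rw [pow_succ', Perm.mul_apply]
    exact htrans _ _ _ (ih ⟨i, by simp⟩) (hstep _)

section Swap
variable [DecidableEq α]

lemma sameCycle_swap_mul_of_not {g : Perm α} (hg : Periodic g) {x y : α}
    (hxy : ¬ SameCycle g x y) : SameCycle (swap x y * g) x y := by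
  have hne : ∃ n, 0 < n ∧ (g ^ n) x = x := hg x
  classical
  set n := Nat.find hne with hn
  obtain ⟨hn0, hnx⟩ := Nat.find_spec hne
  have key : ∀ i, i < n → ((swap x y * g) ^ i) x = (g ^ i) x := by
    intro i
    induction i with
    | zero => intro _; rfl
    | succ i ih =>
      intro hi
      rw [pow_succ', Perm.mul_apply, ih (by omega), Perm.mul_apply, pow_succ', Perm.mul_apply]
      apply swap_apply_of_ne_of_ne
      · intro h
        exact Nat.find_min hne hi ⟨by omega, by rw [pow_succ', Perm.mul_apply]; exact h⟩
      · intro h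
        exact hxy ⟨(i + 1 : ℕ), by rw [zpow_natCast, pow_succ', Perm.mul_apply]; exact h⟩
  refine ⟨(n : ℕ), ?_⟩
  obtain ⟨m, hm⟩ : ∃ m, n = m + 1 := ⟨n - 1, by omega⟩
  rw [zpow_natCast, hm, pow_succ', Perm.mul_apply, key m (by omega), Perm.mul_apply,
    ← Perm.mul_apply g, ← pow_succ', ← hm, hnx, swap_apply_left]

lemma sameCycle_swap_mul_iff_of_not {g : Perm α} (hg : Periodic g) {x y : α}
    (hxy : ¬ SameCycle g x y) (hg' : Periodic (swap x y * g)) (z w : α) :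
    SameCycle (swap x y * g) z w ↔ SameCycle g z w ∨
      ((SameCycle g z x ∨ SameCycle g z y) ∧ (SameCycle g w x ∨ SameCycle g w y)) := by
  have hxy' := sameCycle_swap_mul_of_not hg hxy
  have hsub : ∀ z w, SameCycle g z w → SameCycle (swap x y * g) z w := by
    intro z w h
    refine hg.rel_of_sameCycle (R := SameCycle (swap x y * g)) (fun x => .refl _ x)
      (fun _ _ _ h1 h2 => h1.trans h2) (fun u => ?_) h
    have h1 : SameCycle (swap x y * g) u ((swap x y * g) u) :=
      (sameCycle_apply_right).2 (.refl _ _)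
    rw [Perm.mul_apply] at h1
    by_cases hux : g u = x
    · rw [hux, swap_apply_left] at h1
      rw [hux]
      exact h1.trans hxy'.symm
    by_cases huy : g u = y
    · rw [huy, swap_apply_right] at h1
      rw [huy]
      exact h1.trans hxy'
    rwa [swap_apply_of_ne_of_ne hux huy] at h1
  constructor
  · intro h
    refine hg'.rel_of_sameCycle (R := fun z w => SameCycle g z w ∨
      ((SameCycle g z x ∨ SameCycle g z y) ∧ (SameCycle g w x ∨ SameCycle g w y)))
      (fun x => .inl (.refl _ x)) ?_ (fun u => ?_) h
    · rintro a b c (h1 | h1) (h2 | h2)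
      · exact .inl (h1.trans h2)
      · exact .inr ⟨h2.1.imp h1.trans h1.trans, h2.2⟩
      · exact .inr ⟨h1.1, h1.2.imp h2.symm.trans h2.symm.trans⟩
      · exact .inr ⟨h1.1, h2.2⟩
    · have h1 : SameCycle g u (g u) := (sameCycle_apply_right).2 (.refl _ _)
      rw [Perm.mul_apply]
      by_cases hux : g u = x
      · rw [hux] at h1 ⊢
        rw [swap_apply_left]
        exact .inr ⟨.inl h1, .inr (.refl _ _)⟩
      by_cases huy : g u = y
      · rw [huy] at h1 ⊢
        rw [swap_apply_right]
        exact .inr ⟨.inr h1, .inl (.refl _ _)⟩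
      rw [swap_apply_of_ne_of_ne hux huy]
      exact .inl h1
  · rintro (h | ⟨h1 | h1, h2 | h2⟩)
    · exact hsub _ _ h
    · exact hsub _ _ (h1.trans h2.symm)
    · exact (hsub _ _ h1).trans (hxy'.trans (hsub _ _ h2).symm)
    · exact (hsub _ _ h1).trans (hxy'.symm.trans (hsub _ _ h2).symm)
    · exact hsub _ _ (h1.trans h2.symm)

lemma not_sameCycle_swap_mul {g : Perm α} (hg : Periodic g) {x y : α}
    (hxy : SameCycle g x y) (hne : x ≠ y) : ¬ SameCycle (swap x y * g) x y := by
  classical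
  have hex : ∃ i : ℕ, (g ^ i) x = y := hg.exists_pow_of_sameCycle hxy
  set m := Nat.find hex with hm
  have hmy : (g ^ m) x = y := Nat.find_spec hex
  have hmin : ∀ i < m, (g ^ i) x ≠ y := fun i hi => Nat.find_min hex hi
  have hm0 : 0 < m := by
    rcases Nat.eq_zero_or_pos m with h | h
    · rw [h] at hmy; exact absurd hmy hne
    · exact h
  have hminx : ∀ i, 0 < i → i < m → (g ^ i) x ≠ x := by
    intro i h0 hi h
    refine hmin (m - i) (by omega) ?_
    have : (g ^ m) x = y := hmy
    rwa [show m = (m - i) + i by omega, pow_add, Perm.mul_apply, h] at this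
  have key : ∀ i, i < m → ((swap x y * g) ^ i) x = (g ^ i) x := by
    intro i
    induction i with
    | zero => intro _; rfl
    | succ i ih =>
      intro hi
      rw [pow_succ', Perm.mul_apply, ih (by omega), Perm.mul_apply, pow_succ', Perm.mul_apply]
      apply swap_apply_of_ne_of_ne
      · rw [← Perm.mul_apply, ← pow_succ']; exact hminx _ (by omega) hi
      · rw [← Perm.mul_apply, ← pow_succ']; exact hmin _ hi
  have hper : ((swap x y * g) ^ m) x = x := by
    obtain ⟨k, hk⟩ : ∃ k, m = k + 1 := ⟨m - 1, by omega⟩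
    rw [hk, pow_succ', Perm.mul_apply, key k (by omega), Perm.mul_apply, ← Perm.mul_apply g,
      ← pow_succ', ← hk, hmy, swap_apply_right]
  intro h
  obtain ⟨i, hi, hiy⟩ := exists_pow_lt_of_sameCycle hm0 hper h
  rw [key i hi] at hiy
  exact hmin i hi hiy

end Swap

/-- The number of distinct cycles of `g` meeting `A`. -/
noncomputable def cyc (A : Finset α) (g : Perm α) : ℕ :=
  letI := Classical.decEq (Quotient (SameCycle.setoid g))
  (A.image (Quotient.mk (SameCycle.setoid g))).card

/-- The number of values of `f` on `A`. -/
noncomputable def nval {β : Type*} (A : Finset α) (f : α → β) : ℕ :=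
  letI := Classical.decEq β
  (A.image f).card

lemma cyc_eq_nval (A : Finset α) (g : Perm α) :
    cyc A g = nval A (Quotient.mk (SameCycle.setoid g)) := rfl

lemma mk_eq_iff {g : Perm α} {x y : α} :
    (Quotient.mk (SameCycle.setoid g) x = Quotient.mk (SameCycle.setoid g) y) ↔
      SameCycle g x y :=
  Quotient.eq (r := SameCycle.setoid g)

lemma nval_le_of_ker {β γ : Type*} {A : Finset α} {f : α → β} {h : α → γ}
    (H : ∀ x ∈ A, ∀ y ∈ A, h x = h y → f x = f y) : nval A f ≤ nval A h := by
  classical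
  unfold nval
  rcases A.eq_empty_or_nonempty with rfl | ⟨x₀, -⟩
  · simp
  have : Nonempty α := ⟨x₀⟩
  have : ∀ b ∈ A.image f, ∃ x ∈ A, f x = b := fun b hb => by simpa using hb
  choose! s hs hfs using this
  refine Finset.card_le_card_of_injOn (fun b => h (s b)) ?_ ?_
  · intro b hb
    simp only [Finset.coe_image, Set.mem_image, Finset.mem_coe]
    exact ⟨s b, hs b (Finset.mem_coe.1 hb), rfl⟩
  · intro b hb b' hb' hbb
    have hb1 : b ∈ A.image f := Finset.mem_coe.1 hb
    have hb2 : b' ∈ A.image f := Finset.mem_coe.1 hb'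
    rw [← hfs b hb1, ← hfs b' hb2]
    exact H _ (hs b hb1) _ (hs b' hb2) hbb

lemma nval_congr {β γ : Type*} {A : Finset α} {f : α → β} {h : α → γ}
    (H : ∀ x ∈ A, ∀ y ∈ A, h x = h y ↔ f x = f y) : nval A f = nval A h :=
  le_antisymm (nval_le_of_ker fun x hx y hy => (H x hx y hy).1)
    (nval_le_of_ker fun x hx y hy => (H x hx y hy).2)

lemma nval_insert_of_exists [DecidableEq α] {β : Type*} {A : Finset α} {f : α → β} {y : α}
    (h : ∃ z ∈ A, f z = f y) : nval (insert y A) f = nval A f := by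
  classical
  unfold nval
  rw [Finset.image_insert, Finset.insert_eq_of_mem]
  obtain ⟨z, hz, hf⟩ := h
  exact Finset.mem_image.2 ⟨z, hz, hf⟩

lemma nval_insert_of_not_exists [DecidableEq α] {β : Type*} {A : Finset α} {f : α → β} {y : α}
    (h : ∀ z ∈ A, f z ≠ f y) : nval (insert y A) f = nval A f + 1 := by
  classical
  unfold nval
  rw [Finset.image_insert, Finset.card_insert_of_notMem]
  simpa using h

lemma nval_eq_nval_erase [DecidableEq α] {β γ : Type*} {A : Finset α} {f : α → β} {h : α → γ}
    {y : α} (hy : y ∈ A) (hex : ∃ z ∈ A.erase y, f z = f y)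
    (H : ∀ z ∈ A.erase y, ∀ w ∈ A.erase y, h z = h w ↔ f z = f w) :
    nval A f = nval (A.erase y) h := by
  rw [← nval_congr H, ← nval_insert_of_exists hex, Finset.insert_erase hy]

lemma nval_eq_nval_erase_add_one [DecidableEq α] {β γ : Type*} {A : Finset α} {f : α → β}
    {h : α → γ} {y : α} (hy : y ∈ A) (hex : ∀ z ∈ A.erase y, f z ≠ f y)
    (H : ∀ z ∈ A.erase y, ∀ w ∈ A.erase y, h z = h w ↔ f z = f w) :
    nval A f = nval (A.erase y) h + 1 := by
  rw [← nval_congr H, ← nval_insert_of_not_exists hex, Finset.insert_erase hy]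

/-- Identify the labels of `x` and `y`. -/
noncomputable def relabel {β : Type*} (f : α → β) (x y : α) : α → β :=
  open Classical in fun z => if f z = f y then f x else f z

lemma relabel_eq_self {β : Type*} {f : α → β} {x y : α} (h : f x = f y) : relabel f x y = f := by
  ext z
  unfold relabel
  split_ifs with h1
  · rw [h, h1]
  · rfl

lemma relabel_eq_iff {β : Type*} {f : α → β} {x y z w : α} :
    relabel f x y z = relabel f x y w ↔
      f z = f w ∨ ((f z = f x ∨ f z = f y) ∧ (f w = f x ∨ f w = f y)) := by
  unfold relabel
  split_ifs with h1 h2 h2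
  · simp [h1, h2]
  · simp only [h1, h2, or_true, true_and, or_false]
    constructor
    · intro h; exact .inr h.symm
    · rintro (h | h)
      · exact absurd h.symm h2
      · exact h.symm
  · simp only [h1, h2, or_true, and_true, or_false]
    tauto
  · simp only [h1, h2, or_false]
    constructor
    · exact .inl
    · rintro (h | h)
      · exact h
      · rw [h.1, h.2]

lemma nval_relabel_of_ne {β : Type*} {A : Finset α} {f : α → β} {x y : α} (hx : x ∈ A)
    (hy : y ∈ A) (hne : f x ≠ f y) : nval A (relabel f x y) + 1 = nval A f := by
  classical
  have : A.image (relabel f x y) = (A.image f).erase (f y) := by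
    ext b
    simp only [Finset.mem_image, Finset.mem_erase, relabel]
    constructor
    · rintro ⟨z, hz, rfl⟩
      split_ifs with h
      · exact ⟨hne, x, hx, rfl⟩
      · exact ⟨h, z, hz, rfl⟩
    · rintro ⟨hb, z, hz, rfl⟩
      exact ⟨z, hz, by rw [if_neg hb]⟩
  have h2 : f y ∈ A.image f := Finset.mem_image_of_mem f hy
  have h3 := Finset.card_erase_add_one h2
  rw [← this] at h3
  unfold nval
  convert h3

lemma nval_le_relabel_add_one {β : Type*} {A : Finset α} {f : α → β} {x y : α} (hx : x ∈ A)
    (hy : y ∈ A) : nval A f ≤ nval A (relabel f x y) + 1 := by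
  by_cases h : f x = f y
  · rw [relabel_eq_self h]; omega
  · rw [nval_relabel_of_ne hx hy h]

lemma sameCycle_fixed_iff {g : Perm α} {y z : α} (hy : g y = y) : SameCycle g z y ↔ z = y := by
  constructor
  · rintro ⟨i, hi⟩
    have : (g ^ i) y = y := zpow_apply_eq_self_of_apply_eq_self hy _
    exact (g ^ i).injective (hi.trans this.symm)
  · rintro rfl
    exact .refl _ _

lemma cyc_inv {A : Finset α} {g : Perm α} : cyc A g⁻¹ = cyc A g := by
  rw [cyc_eq_nval, cyc_eq_nval]
  apply nval_congr
  intro z _ w _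
  rw [mk_eq_iff, mk_eq_iff, sameCycle_inv]

section Cyc
variable [DecidableEq α] {A : Finset α} {g : Perm α} {x y : α}

lemma cyc_merge (hg : SuppIn A g) (hx : x ∈ A) (hy : y ∈ A) (hxy : ¬ SameCycle g x y) :
    cyc A (swap x y * g) + 1 = cyc A g := by
  have hne : (Quotient.mk (SameCycle.setoid g) x) ≠ Quotient.mk _ y := by rwa [Ne, mk_eq_iff]
  rw [cyc_eq_nval A g, ← nval_relabel_of_ne hx hy hne, cyc_eq_nval]
  congr 1
  apply nval_congr
  intro z _ w _
  simp only [relabel_eq_iff, mk_eq_iff]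
  exact (sameCycle_swap_mul_iff_of_not hg.periodic hxy ((SuppIn.swap hx hy).mul hg).periodic
    z w).symm

lemma cyc_split (hg : SuppIn A g) (hx : x ∈ A) (hy : y ∈ A) (hxy : SameCycle g x y)
    (hne : x ≠ y) : cyc A (swap x y * g) = cyc A g + 1 := by
  have h := cyc_merge ((SuppIn.swap hx hy).mul hg) hx hy (not_sameCycle_swap_mul hg.periodic hxy hne)
  rw [← mul_assoc, swap_mul_self, one_mul] at h
  exact h.symm

lemma sameCycle_iff_of_split (hg : SuppIn A g) (hx : x ∈ A) (hy : y ∈ A) (hxy : SameCycle g x y)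
    (hne : x ≠ y) (z w : α) : SameCycle g z w ↔ SameCycle (swap x y * g) z w ∨
      ((SameCycle (swap x y * g) z x ∨ SameCycle (swap x y * g) z y) ∧
        (SameCycle (swap x y * g) w x ∨ SameCycle (swap x y * g) w y)) := by
  have hg' := ((SuppIn.swap hx hy).mul hg).periodic
  have h := sameCycle_swap_mul_iff_of_not hg' (not_sameCycle_swap_mul hg.periodic hxy hne)
    (by rw [← mul_assoc, swap_mul_self, one_mul]; exact hg.periodic) z w
  rwa [← mul_assoc, swap_mul_self, one_mul] at h

/-- Skip the point `y` in the cycle of `g` through it. -/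
def iso (y : α) (g : Perm α) : Perm α := swap y (g y) * g

lemma iso_apply_self : iso y g y = y := by simp [iso]

lemma iso_of_fixed (h : g y = y) : iso y g = g := by
  rw [iso, h, swap_self]
  rfl

lemma iso_apply_of_ne {z : α} (hz : z ≠ y) : iso y g z = if g z = y then g y else g z := by
  unfold iso
  rw [Perm.mul_apply]
  split_ifs with h
  · rw [h, swap_apply_left]
  · exact swap_apply_of_ne_of_ne h (fun h' => hz (g.injective h'))

lemma iso_suppIn (hg : SuppIn A g) : SuppIn (A.erase y) (iso y g) := by
  intro z hz
  by_cases h : z = y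
  · rw [h, iso_apply_self]
  · have hzA : z ∉ A := fun h' => hz (Finset.mem_erase.2 ⟨h, h'⟩)
    rw [iso_apply_of_ne h, hg z hzA, if_neg h]

lemma sameCycle_iso_iff (hg : SuppIn A g) {z w : α} (hz : z ≠ y) (hw : w ≠ y) :
    SameCycle (iso y g) z w ↔ SameCycle g z w := by
  by_cases hy : g y = y
  · rw [iso_of_fixed hy]
  have hyA : y ∈ A := by
    by_contra h
    exact hy (hg y h)
  rw [sameCycle_iff_of_split hg hyA ((hg.mem_iff y).2 hyA)
    ((sameCycle_apply_right).2 (.refl _ _)) (Ne.symm hy)]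
  change _ ↔ SameCycle (iso y g) z w ∨ (SameCycle (iso y g) z y ∨ SameCycle (iso y g) z (g y)) ∧
    (SameCycle (iso y g) w y ∨ SameCycle (iso y g) w (g y))
  have hfix : ∀ u, SameCycle (iso y g) u y → u = y := by
    rintro u ⟨i, hi⟩
    have : (iso y g ^ i) y = y := zpow_apply_eq_self_of_apply_eq_self iso_apply_self _
    exact (iso y g ^ i).injective (hi.trans this.symm)
  constructor
  · exact .inl
  · rintro (h | ⟨h1 | h1, h2 | h2⟩)
    · exact h
    · exact absurd (hfix _ h1) hz
    · exact absurd (hfix _ h1) hz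
    · exact absurd (hfix _ h2) hw
    · exact h1.trans h2.symm

lemma cyc_iso (hg : SuppIn A g) (hy : y ∈ A) :
    cyc (A.erase y) (iso y g) + (if g y = y then 1 else 0) = cyc A g := by
  have h1 : cyc (A.erase y) (iso y g) = cyc (A.erase y) g := by
    rw [cyc_eq_nval, cyc_eq_nval]
    apply nval_congr
    intro z hz w hw
    rw [mk_eq_iff, mk_eq_iff, sameCycle_iso_iff hg (Finset.ne_of_mem_erase hz)
      (Finset.ne_of_mem_erase hw)]
  rw [h1]
  conv_rhs => rw [← Finset.insert_erase hy]
  rw [cyc_eq_nval, cyc_eq_nval]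
  split_ifs with h
  · rw [nval_insert_of_not_exists]
    intro z hz
    rw [Ne, mk_eq_iff, sameCycle_fixed_iff h]
    exact Finset.ne_of_mem_erase hz
  · rw [nval_insert_of_exists]
    · rfl
    · refine ⟨g y, Finset.mem_erase.2 ⟨h, (hg.mem_iff y).2 hy⟩, ?_⟩
      rw [mk_eq_iff]
      exact (sameCycle_apply_left).2 (.refl _ _)

lemma iso_inv : iso y g⁻¹ = (iso y g)⁻¹ := by
  have h := Equiv.swap_apply_apply g y (g⁻¹ y)
  have h2 : g (g⁻¹ y) = y := g.apply_symm_apply y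
  rw [h2] at h
  rw [iso, iso, mul_inv_rev, swap_inv, swap_comm y (g y), h]
  simp [mul_assoc]

lemma iso_mul_of_fixed_left {h : Perm α} (hy : g y = y) : g * iso y h = iso y (g * h) := by
  unfold iso
  rw [Perm.mul_apply, ← mul_assoc, ← mul_assoc]
  congr 1
  have := Equiv.swap_apply_apply g y (h y)
  rw [hy] at this
  rw [this]
  simp [mul_assoc]

end Cyc
end PermCounting

/-- A combinatorial cell structure on a finite set `A` of darts: `φ` permutes the darts around
faces, `π` around vertices; `F` and `P` label the face cells and vertex cells, each of which may
consist of several cycles. -/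
structure HMap where
  A : Finset ℕ
  φ : Perm ℕ
  π : Perm ℕ
  F : ℕ → ℕ
  P : ℕ → ℕ

namespace HMap

/-- Well-formedness: permutations are supported on darts and preserve cells. -/
structure Wf (M : HMap) : Prop where
  suppφ : SuppIn M.A M.φ
  suppπ : SuppIn M.A M.π
  face : ∀ x, M.F (M.φ x) = M.F x
  vert : ∀ x, M.P (M.π x) = M.P x

/-- The generalized Euler characteristic. -/
noncomputable def chi (M : HMap) : ℤ :=
  cyc M.A (M.φ * M.π) - cyc M.A M.φ - cyc M.A M.π + 2 * nval M.A M.F + 2 * nval M.A M.P - M.A.card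

/-- `l` is constant on cells. -/
def Compat (M : HMap) (l : ℕ → ℕ) : Prop :=
  ∀ z ∈ M.A, ∀ w ∈ M.A, (M.F z = M.F w ∨ M.P z = M.P w) → l z = l w

/-- The Euler characteristic is at least twice the number of components. -/
def Planar (M : HMap) : Prop := ∀ l, M.Compat l → 2 * (nval M.A l : ℤ) ≤ M.chi

/-- Exchange the roles of faces and vertices. -/
def dual (M : HMap) : HMap := ⟨M.A, M.π⁻¹, M.φ⁻¹, M.P, M.F⟩

variable {M : HMap}

lemma Wf.dual (h : M.Wf) : M.dual.Wf where
  suppφ := h.suppπ.inv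
  suppπ := h.suppφ.inv
  face x := by
    have := h.vert (M.π⁻¹ x)
    rw [show M.π (M.π⁻¹ x) = x from M.π.apply_symm_apply x] at this
    exact this.symm
  vert x := by
    have := h.face (M.φ⁻¹ x)
    rw [show M.φ (M.φ⁻¹ x) = x from M.φ.apply_symm_apply x] at this
    exact this.symm

lemma chi_dual : M.dual.chi = M.chi := by
  simp only [chi, dual]
  rw [← mul_inv_rev, cyc_inv, cyc_inv, cyc_inv]
  ring

lemma Planar.dual (h : M.Planar) : M.dual.Planar := by
  intro l hl
  rw [chi_dual]
  exact h l fun z hz w hw hzw => hl z hz w hw hzw.symm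

/-- Fuse the dart `y = φ x` into `x`, merging the vertices. -/
noncomputable def fuseP (M : HMap) (x y : ℕ) : HMap :=
  ⟨M.A.erase y, iso y M.φ, iso y (swap x y * M.π), M.F, relabel M.P x y⟩

/-- Fuse the dart `y = π⁻¹ x` into `x`, merging the faces. -/
noncomputable def fuseF (M : HMap) (x y : ℕ) : HMap :=
  ⟨M.A.erase y, iso y (M.φ * swap x y), iso y M.π, relabel M.F x y, M.P⟩

/-- Delete the dart `x`. -/
def drop (M : HMap) (x : ℕ) : HMap :=
  ⟨M.A.erase x, iso x M.φ, iso x M.π, M.F, M.P⟩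

lemma fuseF_eq_dual (x y : ℕ) : M.fuseF x y = (M.dual.fuseP x y).dual := by
  simp only [fuseF, fuseP, HMap.dual, mk.injEq, true_and]
  rw [← iso_inv, ← iso_inv, inv_inv, mul_inv_rev, inv_inv, swap_inv]
  exact ⟨rfl, rfl, trivial⟩

lemma drop_dual (x : ℕ) : M.drop x = (M.dual.drop x).dual := by
  simp only [drop, HMap.dual, mk.injEq, true_and]
  rw [← iso_inv, ← iso_inv, inv_inv, inv_inv]
  exact ⟨rfl, rfl, trivial⟩

lemma iso_invariant {f : ℕ → ℕ} {g : Perm ℕ} (y : ℕ) (h : ∀ x, f (g x) = f x) (x : ℕ) :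
    f (iso y g x) = f x := by
  by_cases hx : x = y
  · rw [hx, iso_apply_self]
  · rw [iso_apply_of_ne hx]
    split_ifs with h1
    · rw [h, ← h1, h]
    · exact h x

lemma Wf.drop (h : M.Wf) (x : ℕ) : (M.drop x).Wf where
  suppφ := iso_suppIn h.suppφ
  suppπ := iso_suppIn h.suppπ
  face := iso_invariant x h.face
  vert := iso_invariant x h.vert

lemma relabel_swap_invariant {f : ℕ → ℕ} {g : Perm ℕ} {x y : ℕ} (h : ∀ z, f (g z) = f z) (z : ℕ) :
    relabel f x y ((swap x y * g) z) = relabel f x y z := by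
  rw [Perm.mul_apply, relabel_eq_iff]
  by_cases h1 : g z = x
  · rw [h1, swap_apply_left]
    refine .inr ⟨.inr rfl, .inl ?_⟩
    rw [← h1, h]
  by_cases h2 : g z = y
  · rw [h2, swap_apply_right]
    refine .inr ⟨.inl rfl, .inr ?_⟩
    rw [← h2, h]
  rw [swap_apply_of_ne_of_ne h1 h2]
  exact .inl (h z)

lemma Wf.fuseP (h : M.Wf) {x y : ℕ} (hx : x ∈ M.A) (hy : M.φ x = y) : (M.fuseP x y).Wf where
  suppφ := iso_suppIn h.suppφ
  suppπ := iso_suppIn ((SuppIn.swap hx (hy ▸ (h.suppφ.mem_iff x).2 hx)).mul h.suppπ)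
  face := iso_invariant y h.face
  vert := iso_invariant y (relabel_swap_invariant h.vert)

lemma mul_swap_eq (g : Perm ℕ) (x y : ℕ) : g * swap x y = swap (g x) (g y) * g := by
  rw [Equiv.swap_apply_apply]
  simp [mul_assoc]

lemma Planar.fuseP (h : M.Wf) (hp : M.Planar) {x y : ℕ} (hx : x ∈ M.A) (hy : M.φ x = y)
    (hxy : x ≠ y) : (M.fuseP x y).Planar := by
  have hyA : y ∈ M.A := hy ▸ (h.suppφ.mem_iff x).2 hx
  have hxe : x ∈ M.A.erase y := Finset.mem_erase.2 ⟨hxy, hx⟩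
  have hins : insert y (M.A.erase y) = M.A := Finset.insert_erase hyA
  have hFy : M.F y = M.F x := by rw [← hy, h.face]
  have hφy : M.φ y ≠ y := by
    intro h'
    exact hxy (M.φ.injective (hy.trans h'.symm))
  have hs : SuppIn M.A (swap x y * M.π) := (SuppIn.swap hx hyA).mul h.suppπ
  have hν : iso y M.φ * iso y (swap x y * M.π) = iso y (M.φ * M.π) := by
    have e1 : iso y M.φ = M.φ * swap x y := by rw [mul_swap_eq, hy]; rfl
    rw [iso_mul_of_fixed_left iso_apply_self, e1, mul_assoc, ← mul_assoc (swap x y), swap_mul_self,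
      one_mul]
  have c1 := cyc_iso (h.suppφ.mul h.suppπ) hyA
  have c2 := cyc_iso h.suppφ hyA
  have c3 := cyc_iso hs hyA
  have hiff : (M.φ * M.π) y = y ↔ (swap x y * M.π) y = y := by
    rw [Perm.mul_apply, Perm.mul_apply]
    constructor
    · intro h1
      rw [M.φ.injective (h1.trans hy.symm), swap_apply_left]
    · intro h1
      rw [(swap x y).injective (h1.trans (swap_apply_left x y).symm), hy]
  rw [if_neg hφy] at c2
  simp only [hiff] at c1
  have cF : nval (M.A.erase y) M.F = nval M.A M.F := by
    rw [← nval_insert_of_exists (y := y) ⟨x, hxe, hFy.symm⟩, hins]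
  have hPxy : relabel M.P x y x = relabel M.P x y y :=
    relabel_eq_iff.2 (.inr ⟨.inl rfl, .inr rfl⟩)
  have cP : nval (M.A.erase y) (relabel M.P x y) = nval M.A (relabel M.P x y) := by
    rw [← nval_insert_of_exists (y := y) ⟨x, hxe, hPxy⟩, hins]
  have cA : (M.A.erase y).card + 1 = M.A.card := Finset.card_erase_add_one hyA
  have hchi : M.chi ≤ (M.fuseP x y).chi := by
    have main : cyc M.A (swap x y * M.π) + 2 * nval M.A M.P ≤
        cyc M.A M.π + 1 + 2 * nval M.A (relabel M.P x y) := by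
      by_cases hc : SameCycle M.π x y
      · have := cyc_split h.suppπ hx hyA hc hxy
        have hP : M.P x = M.P y := by
          refine h.suppπ.periodic.rel_of_sameCycle (R := fun a b => M.P a = M.P b) (fun _ => rfl)
            (fun _ _ _ => Eq.trans) (fun a => (h.vert a).symm) hc
        rw [relabel_eq_self hP]
        omega
      · have := cyc_merge h.suppπ hx hyA hc
        have := nval_le_relabel_add_one (f := M.P) hx hyA
        omega
    simp only [chi, HMap.fuseP]
    rw [hν, cF, cP]
    omega
  intro l hl
  refine le_trans ?_ hchi
  let l' : ℕ → ℕ := fun z => if z = y then l x else l z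
  have hcompat : M.Compat l' := by
    have hrep : ∀ z ∈ M.A, ∃ z' ∈ M.A.erase y, l' z = l z' ∧ M.F z = M.F z' ∧
        relabel M.P x y z = relabel M.P x y z' := by
      intro z hz
      by_cases hzy : z = y
      · exact ⟨x, hxe, by simp [l', hzy], by rw [hzy, hFy], by rw [hzy, hPxy]⟩
      · exact ⟨z, Finset.mem_erase.2 ⟨hzy, hz⟩, by simp [l', hzy], rfl, rfl⟩
    intro z hz w hw hzw
    obtain ⟨z', hz', e1, e2, e3⟩ := hrep z hz
    obtain ⟨w', hw', f1, f2, f3⟩ := hrep w hw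
    rw [e1, f1]
    refine hl z' hz' w' hw' (hzw.imp (fun h => ?_) (fun h => ?_))
    · exact e2.symm.trans (h.trans f2)
    · refine e3.symm.trans (Eq.trans ?_ f3)
      exact relabel_eq_iff.2 (.inl h)
  have : nval M.A l' = nval (M.A.erase y) l := by
    refine nval_eq_nval_erase hyA ⟨x, hxe, by simp [l']⟩ ?_
    intro a ha b hb
    simp [l', Finset.ne_of_mem_erase ha, Finset.ne_of_mem_erase hb]
  have h2 := hp l' hcompat
  rw [this] at h2
  exact h2

lemma Wf.fuseF (h : M.Wf) {x y : ℕ} (hy : y ∈ M.A) (hx : M.π y = x) : (M.fuseF x y).Wf := by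
  rw [fuseF_eq_dual]
  have hxA : x ∈ M.A := hx ▸ (h.suppπ.mem_iff y).2 hy
  exact (h.dual.fuseP hxA (show M.π⁻¹ x = y by rw [Perm.inv_eq_iff_eq, hx])).dual

lemma Planar.fuseF (h : M.Wf) (hp : M.Planar) {x y : ℕ} (hy : y ∈ M.A) (hx : M.π y = x)
    (hxy : x ≠ y) : (M.fuseF x y).Planar := by
  rw [fuseF_eq_dual]
  have hxA : x ∈ M.A := hx ▸ (h.suppπ.mem_iff y).2 hy
  exact (Planar.fuseP h.dual hp.dual hxA (show M.π⁻¹ x = y by rw [Perm.inv_eq_iff_eq, hx]) hxy).dual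

lemma drop_prod (x : ℕ) :
    iso x M.φ * iso x M.π = iso x (swap x (M.φ x) * (M.φ * M.π)) := by
  rw [iso_mul_of_fixed_left iso_apply_self, iso, iso, mul_assoc]
  rfl

lemma Planar.drop_of_ne (h : M.Wf) (hp : M.Planar) {x : ℕ} (hx : x ∈ M.A) (hφ : M.φ x ≠ x) :
    (M.drop x).Planar := by
  set y := M.φ x with hy
  have hyA : y ∈ M.A := (h.suppφ.mem_iff x).2 hx
  have hye : y ∈ M.A.erase x := Finset.mem_erase.2 ⟨hφ, hyA⟩
  have hins : insert x (M.A.erase x) = M.A := Finset.insert_erase hx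
  have hFy : M.F y = M.F x := h.face x
  have hν : SuppIn M.A (M.φ * M.π) := h.suppφ.mul h.suppπ
  have c1 := cyc_iso ((SuppIn.swap hx hyA).mul hν) hx
  have c2 := cyc_iso h.suppφ hx
  have c3 := cyc_iso h.suppπ hx
  rw [if_neg hφ] at c2
  have hiff : (swap x y * (M.φ * M.π)) x = x ↔ M.π x = x := by
    rw [Perm.mul_apply, Perm.mul_apply]
    constructor
    · intro h1
      exact M.φ.injective ((swap x y).injective (h1.trans (swap_apply_right x y).symm))
    · intro h1
      rw [h1, ← hy, swap_apply_right]
  simp only [hiff] at c1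
  have cF : nval (M.A.erase x) M.F = nval M.A M.F := by
    rw [← nval_insert_of_exists (y := x) ⟨y, hye, hFy⟩, hins]
  have cA : (M.A.erase x).card + 1 = M.A.card := Finset.card_erase_add_one hx
  have hchi : (M.drop x).chi = M.chi + (cyc M.A (swap x y * (M.φ * M.π)) - cyc M.A (M.φ * M.π)) + 1
      + 2 * (nval (M.A.erase x) M.P - nval M.A M.P) := by
    simp only [chi, HMap.drop]
    rw [drop_prod, cF, ← hy]
    omega
  intro l hl
  let l' : ℕ → ℕ := fun z => if z = x then l y else l z
  have hnl' : nval M.A l' = nval (M.A.erase x) l := by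
    refine nval_eq_nval_erase hx ⟨y, hye, by simp [l']⟩ ?_
    intro a ha b hb
    simp [l', Finset.ne_of_mem_erase ha, Finset.ne_of_mem_erase hb]
  have hl'x : l' x = l y := by simp [l']
  have hl'ne : ∀ z, z ≠ x → l' z = l z := fun z hz => by simp [l', hz]
  have hFcomp : ∀ z ∈ M.A, ∀ w ∈ M.A, M.F z = M.F w → l' z = l' w := by
    have hrep : ∀ z ∈ M.A, ∃ z' ∈ M.A.erase x, l' z = l z' ∧ M.F z = M.F z' := by
      intro z hz
      by_cases hzx : z = x
      · exact ⟨y, hye, by rw [hzx, hl'x], by rw [hzx, hFy]⟩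
      · exact ⟨z, Finset.mem_erase.2 ⟨hzx, hz⟩, hl'ne z hzx, rfl⟩
    intro z hz w hw hzw
    obtain ⟨z', hz', e1, e2⟩ := hrep z hz
    obtain ⟨w', hw', f1, f2⟩ := hrep w hw
    rw [e1, f1]
    exact hl z' hz' w' hw' (.inl (e2.symm.trans (hzw.trans f2)))
  have hPcomp : ∀ z ∈ M.A, ∀ w ∈ M.A, z ≠ x → w ≠ x → M.P z = M.P w → l' z = l' w := by
    intro z hz w hw hzx hwx hzw
    rw [hl'ne z hzx, hl'ne w hwx]
    exact hl z (Finset.mem_erase.2 ⟨hzx, hz⟩) w (Finset.mem_erase.2 ⟨hwx, hw⟩) (.inr hzw)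
  by_cases hsing : ∃ w ∈ M.A, w ≠ x ∧ M.P w = M.P x
  · have cP : nval (M.A.erase x) M.P = nval M.A M.P := by
      obtain ⟨w, hw, hwx, hP⟩ := hsing
      rw [← nval_insert_of_exists (y := x) ⟨w, Finset.mem_erase.2 ⟨hwx, hw⟩, hP⟩, hins]
    rw [cP] at hchi
    by_cases hsc : SameCycle (M.φ * M.π) x y
    · have hs := cyc_split hν hx hyA hsc (Ne.symm hφ)
      obtain ⟨w, hw, hwx, hP⟩ := hsing
      have hcompat : M.Compat (relabel l' x w) := by
        rintro z hz u hu (hzu | hzu)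
        · exact relabel_eq_iff.2 (.inl (hFcomp z hz u hu hzu))
        · rw [relabel_eq_iff]
          by_cases hzx : z = x
          · refine .inr ⟨.inl (by rw [hzx]), ?_⟩
            by_cases hux : u = x
            · exact .inl (by rw [hux])
            · exact .inr (hPcomp u hu w hw hux hwx (by rw [← hzu, hzx, hP]))
          · by_cases hux : u = x
            · exact .inr ⟨.inr (hPcomp z hz w hw hzx hwx (by rw [hzu, hux, hP])),
                .inl (by rw [hux])⟩
            · exact .inl (hPcomp z hz u hu hzx hux hzu)
      have h1 := hp _ hcompat
      have h2 := nval_le_relabel_add_one (f := l') hx hw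
      rw [hnl'] at h2
      rw [hchi]
      change 2 * (nval (M.A.erase x) l : ℤ) ≤ _
      omega
    · have hs := cyc_merge hν hx hyA hsc
      have hπ : M.π x ≠ x := by
        intro h1
        apply hsc
        have : (M.φ * M.π) x = y := by rw [Perm.mul_apply, h1]
        rw [← this]
        exact (sameCycle_apply_right).2 (.refl _ _)
      have hπ' : M.π⁻¹ x ≠ x := by
        intro h1
        rw [Perm.inv_eq_iff_eq] at h1
        exact hπ h1.symm
      have hππ : M.π (M.π⁻¹ x) = x := M.π.apply_symm_apply x
      have hwalk : ∀ i : ℕ, l (((M.φ * M.π) ^ i) y) = l y ∧ ((M.φ * M.π) ^ i) y ∈ M.A.erase x := by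
        intro i
        induction i with
        | zero => exact ⟨rfl, hye⟩
        | succ i ih =>
          have hne : ((M.φ * M.π) ^ (i + 1)) y ≠ x := by
            intro h1
            exact hsc (SameCycle.symm ⟨(i + 1 : ℕ), by rw [zpow_natCast]; exact h1⟩)
          rw [pow_succ', Perm.mul_apply] at hne ⊢
          set u := ((M.φ * M.π) ^ i) y
          have hmem : (M.φ * M.π) u ∈ M.A.erase x :=
            Finset.mem_erase.2 ⟨hne, (hν.mem_iff u).2 (Finset.mem_of_mem_erase ih.2)⟩
          refine ⟨?_, hmem⟩
          by_cases hu : M.π u = x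
          · rw [Perm.mul_apply, hu]
          · have hm2 : M.π u ∈ M.A.erase x :=
              Finset.mem_erase.2 ⟨hu, (h.suppπ.mem_iff u).2 (Finset.mem_of_mem_erase ih.2)⟩
            rw [← ih.1, hl _ hmem _ hm2 (.inl (h.face _))]
            exact hl _ hm2 _ ih.2 (.inr (h.vert _))
      have hback : SameCycle (M.φ * M.π) y (M.π⁻¹ x) := by
        have : (M.φ * M.π) (M.π⁻¹ x) = y := by rw [Perm.mul_apply, hππ]
        rw [← this]
        exact (sameCycle_apply_left).2 (.refl _ _)
      obtain ⟨i, hi⟩ := hν.periodic.exists_pow_of_sameCycle hback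
      have hly : l' x = l' (M.π⁻¹ x) := by
        rw [hl'x, hl'ne _ hπ', ← hi, (hwalk i).1]
      have hmem : M.π⁻¹ x ∈ M.A := (h.suppπ.inv.mem_iff x).2 hx
      have hPback : M.P (M.π⁻¹ x) = M.P x := by
        have := h.vert (M.π⁻¹ x)
        rw [hππ] at this
        exact this.symm
      have hcompat : M.Compat l' := by
        rintro z hz u hu (hzu | hzu)
        · exact hFcomp z hz u hu hzu
        · by_cases hzx : z = x
          · by_cases hux : u = x
            · rw [hzx, hux]
            · rw [hzx, hly]
              exact hPcomp _ hmem u hu hπ' hux (by rw [hPback, ← hzu, hzx])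
          · by_cases hux : u = x
            · rw [hux, hly]
              exact hPcomp z hz _ hmem hzx hπ' (by rw [hPback, hzu, hux])
            · exact hPcomp z hz u hu hzx hux hzu
      have h1 := hp _ hcompat
      rw [hnl'] at h1
      rw [hchi]
      change 2 * (nval (M.A.erase x) l : ℤ) ≤ _
      omega
  · push Not at hsing
    have cP : nval (M.A.erase x) M.P + 1 = nval M.A M.P := by
      rw [← nval_insert_of_not_exists (y := x), hins]
      intro z hz
      exact hsing z (Finset.mem_of_mem_erase hz) (Finset.ne_of_mem_erase hz)
    have hπ : M.π x = x := by
      by_contra h1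
      exact hsing _ ((h.suppπ.mem_iff x).2 hx) h1 (h.vert x)
    have hsc : SameCycle (M.φ * M.π) x y := by
      have : (M.φ * M.π) x = y := by rw [Perm.mul_apply, hπ]
      rw [← this]
      exact (sameCycle_apply_right).2 (.refl _ _)
    have hs := cyc_split hν hx hyA hsc (Ne.symm hφ)
    have hcompat : M.Compat l' := by
      rintro z hz u hu (hzu | hzu)
      · exact hFcomp z hz u hu hzu
      · by_cases hzx : z = x
        · by_cases hux : u = x
          · rw [hzx, hux]
          · exact absurd (by rw [← hzu, hzx]) (hsing u hu hux)
        · by_cases hux : u = x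
          · exact absurd (by rw [hzu, hux]) (hsing z hz hzx)
          · exact hPcomp z hz u hu hzx hux hzu
    have h1 := hp _ hcompat
    rw [hnl'] at h1
    rw [hchi]
    change 2 * (nval (M.A.erase x) l : ℤ) ≤ _
    omega

lemma Planar.drop_of_face_eq (h : M.Wf) (hp : M.Planar) {x : ℕ} (hx : x ∈ M.A)
    (hF : ∀ z ∈ M.A, M.F z = M.F x → z = x) : (M.drop x).Planar := by
  have hφ : M.φ x = x := hF _ ((h.suppφ.mem_iff x).2 hx) (h.face x)
  have hins : insert x (M.A.erase x) = M.A := Finset.insert_erase hx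
  have hν : SuppIn M.A (M.φ * M.π) := h.suppφ.mul h.suppπ
  have c1 := cyc_iso hν hx
  have c2 := cyc_iso h.suppφ hx
  have c3 := cyc_iso h.suppπ hx
  rw [if_pos hφ] at c2
  have hiff : (M.φ * M.π) x = x ↔ M.π x = x := by
    rw [Perm.mul_apply]
    constructor
    · intro h1
      exact M.φ.injective (h1.trans hφ.symm)
    · intro h1
      rw [h1, hφ]
  simp only [hiff] at c1
  have cF : nval (M.A.erase x) M.F + 1 = nval M.A M.F := by
    rw [← nval_insert_of_not_exists (y := x), hins]
    intro z hz h1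
    exact Finset.ne_of_mem_erase hz (hF z (Finset.mem_of_mem_erase hz) h1)
  have cA : (M.A.erase x).card + 1 = M.A.card := Finset.card_erase_add_one hx
  have hchi : (M.drop x).chi = M.chi + 2 * (nval (M.A.erase x) M.P - nval M.A M.P) := by
    simp only [chi, HMap.drop]
    rw [drop_prod, hφ, swap_self, show (Equiv.refl ℕ : Perm ℕ) = 1 from rfl, one_mul]
    omega
  intro l hl
  rw [hchi]
  change 2 * (nval (M.A.erase x) l : ℤ) ≤ _
  by_cases hsing : ∃ w ∈ M.A, w ≠ x ∧ M.P w = M.P x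
  · obtain ⟨w, hw, hwx, hP⟩ := hsing
    have hwe : w ∈ M.A.erase x := Finset.mem_erase.2 ⟨hwx, hw⟩
    have cP : nval (M.A.erase x) M.P = nval M.A M.P := by
      rw [← nval_insert_of_exists (y := x) ⟨w, hwe, hP⟩, hins]
    let l' : ℕ → ℕ := fun z => if z = x then l w else l z
    have hnl' : nval M.A l' = nval (M.A.erase x) l := by
      refine nval_eq_nval_erase hx ⟨w, hwe, by simp [l']⟩ ?_
      intro a ha b hb
      simp [l', Finset.ne_of_mem_erase ha, Finset.ne_of_mem_erase hb]
    have hcompat : M.Compat l' := by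
      rintro z hz u hu hzu
      have hrep : ∀ z ∈ M.A, ∃ z' ∈ M.A.erase x, l' z = l z' ∧ M.P z = M.P z' ∧
          (z ≠ x → z = z') := by
        intro z hz
        by_cases hzx : z = x
        · exact ⟨w, hwe, by simp [l', hzx], by rw [hzx, hP], fun h => absurd hzx h⟩
        · exact ⟨z, Finset.mem_erase.2 ⟨hzx, hz⟩, by simp [l', hzx], rfl, fun _ => rfl⟩
      obtain ⟨z', hz', e1, e2, e3⟩ := hrep z hz
      obtain ⟨u', hu', f1, f2, f3⟩ := hrep u hu
      by_cases hzx : z = x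
      · by_cases hux : u = x
        · rw [hzx, hux]
        rw [e1, f1]
        rcases hzu with hzu | hzu
        · exact absurd (hF u hu (by rw [← hzu, hzx])) hux
        · exact hl z' hz' u' hu' (.inr (e2.symm.trans (hzu.trans f2)))
      · by_cases hux : u = x
        · rcases hzu with hzu | hzu
          · exact absurd (hF z hz (by rw [hzu, hux])) hzx
          · rw [e1, f1]
            exact hl z' hz' u' hu' (.inr (e2.symm.trans (hzu.trans f2)))
        · rw [e1, f1]
          exact hl z' hz' u' hu' (by rwa [← e3 hzx, ← f3 hux])
    have h1 := hp _ hcompat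
    omega
  · push Not at hsing
    have cP : nval (M.A.erase x) M.P + 1 = nval M.A M.P := by
      rw [← nval_insert_of_not_exists (y := x), hins]
      intro z hz
      exact hsing z (Finset.mem_of_mem_erase hz) (Finset.ne_of_mem_erase hz)
    let l' : ℕ → ℕ := fun z => if z = x then 0 else l z + 1
    have hnl' : nval M.A l' = nval (M.A.erase x) l + 1 := by
      refine nval_eq_nval_erase_add_one hx (fun z hz => ?_) fun a ha b hb => ?_
      · simp [l', Finset.ne_of_mem_erase hz]
      · simp [l', Finset.ne_of_mem_erase ha, Finset.ne_of_mem_erase hb]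
    have hcompat : M.Compat l' := by
      rintro z hz u hu hzu
      by_cases hzx : z = x
      · by_cases hux : u = x
        · rw [hzx, hux]
        · rcases hzu with hzu | hzu
          · exact absurd (hF u hu (by rw [← hzu, hzx])) hux
          · exact absurd (by rw [← hzu, hzx]) (hsing u hu hux)
      · by_cases hux : u = x
        · rcases hzu with hzu | hzu
          · exact absurd (hF z hz (by rw [hzu, hux])) hzx
          · exact absurd (by rw [hzu, hux]) (hsing z hz hzx)
        · simp only [l', hzx, hux, if_false]
          rw [hl z (Finset.mem_erase.2 ⟨hzx, hz⟩) u (Finset.mem_erase.2 ⟨hux, hu⟩) hzu]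
    have h1 := hp _ hcompat
    omega

lemma Planar.drop_of_vert_eq (h : M.Wf) (hp : M.Planar) {x : ℕ} (hx : x ∈ M.A)
    (hP : ∀ z ∈ M.A, M.P z = M.P x → z = x) : (M.drop x).Planar := by
  rw [drop_dual]
  exact (Planar.drop_of_face_eq h.dual hp.dual hx hP).dual

end HMap

lemma SuppIn.mono {α : Type*} {A B : Finset α} {g : Perm α} (h : SuppIn A g) (hAB : A ⊆ B) :
    SuppIn B g := fun x hx => h x fun hxA => hx (hAB hxA)

lemma cyc_insert {A : Finset ℕ} {g : Perm ℕ} {x : ℕ} (hg : SuppIn A g) (hx : x ∉ A) :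
    cyc (insert x A) g = cyc A g + 1 := by
  rw [cyc_eq_nval, cyc_eq_nval]
  apply nval_insert_of_not_exists
  intro z hz
  rw [Ne, mk_eq_iff, sameCycle_fixed_iff (hg x hx)]
  rintro rfl
  exact hx hz

lemma cyc_insert_swap_mul {A : Finset ℕ} {g : Perm ℕ} {x z : ℕ} (hg : SuppIn A g) (hx : x ∉ A)
    (hz : z ∈ A) : cyc (insert x A) (swap z x * g) = cyc A g := by
  have h := cyc_merge (hg.mono (Finset.subset_insert x A)) (Finset.mem_insert_of_mem hz)
    (Finset.mem_insert_self x A) (by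
      rw [sameCycle_fixed_iff (hg x hx)]
      rintro rfl
      exact hx hz)
  rw [cyc_insert hg hx] at h
  omega

namespace HMap

variable {M : HMap}

/-- Insert a new dart `x` after `y` in its face cycle, with its own vertex cell `p`. -/
def insLoop (M : HMap) (y x p : ℕ) : HMap :=
  ⟨insert x M.A, M.φ * swap y x, M.π, Function.update M.F x (M.F y), Function.update M.P x p⟩

lemma Wf.insLoop (h : M.Wf) {x y p : ℕ} (hy : y ∈ M.A) (hx : x ∉ M.A) : (M.insLoop y x p).Wf where
  suppφ := (h.suppφ.mono (Finset.subset_insert x M.A)).mul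
    (SuppIn.swap (Finset.mem_insert_of_mem hy) (Finset.mem_insert_self x M.A))
  suppπ := h.suppπ.mono (Finset.subset_insert x M.A)
  face z := by
    have hxy : y ≠ x := fun e => hx (e ▸ hy)
    have hne : ∀ u, u ≠ x → M.φ u ≠ x := by
      intro u hu h1
      exact hu (M.φ.injective (h1.trans (h.suppφ x hx).symm))
    change Function.update M.F x (M.F y) ((M.φ * swap y x) z) = Function.update M.F x (M.F y) z
    rw [Perm.mul_apply]
    by_cases hzx : z = x
    · rw [hzx, swap_apply_right, Function.update_of_ne (hne y hxy), Function.update_self, h.face]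
    by_cases hzy : z = y
    · rw [hzy, swap_apply_left, h.suppφ x hx, Function.update_self, Function.update_of_ne hxy]
    · rw [swap_apply_of_ne_of_ne hzy hzx, Function.update_of_ne (hne z hzx),
        Function.update_of_ne hzx, h.face]
  vert z := by
    change Function.update M.P x p (M.π z) = Function.update M.P x p z
    by_cases hzx : z = x
    · rw [hzx, h.suppπ x hx]
    · rw [Function.update_of_ne hzx, Function.update_of_ne, h.vert]
      intro h1
      exact hzx (M.π.injective (h1.trans (h.suppπ x hx).symm))

lemma Planar.insLoop (h : M.Wf) (hp : M.Planar) {x y p : ℕ} (hy : y ∈ M.A) (hx : x ∉ M.A)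
    (hfresh : ∀ z ∈ M.A, M.P z ≠ p) : (M.insLoop y x p).Planar := by
  have hne : ∀ z ∈ M.A, z ≠ x := fun z hz e => hx (e ▸ hz)
  have hz : M.φ y ∈ M.A := (h.suppφ.mem_iff y).2 hy
  have e1 : M.φ * swap y x = swap (M.φ y) x * M.φ := by rw [mul_swap_eq, h.suppφ x hx]
  have c1 := cyc_insert_swap_mul h.suppφ hx hz
  have c2 := cyc_insert_swap_mul (h.suppφ.mul h.suppπ) hx hz
  have c3 := cyc_insert h.suppπ hx
  have cF : nval (insert x M.A) (Function.update M.F x (M.F y)) = nval M.A M.F := by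
    rw [nval_insert_of_exists ⟨y, hy, by rw [Function.update_self, Function.update_of_ne (hne y hy)]⟩]
    apply nval_congr
    intro a ha b hb
    rw [Function.update_of_ne (hne a ha), Function.update_of_ne (hne b hb)]
  have cP : nval (insert x M.A) (Function.update M.P x p) = nval M.A M.P + 1 := by
    rw [nval_insert_of_not_exists]
    · congr 1
      apply nval_congr
      intro a ha b hb
      rw [Function.update_of_ne (hne a ha), Function.update_of_ne (hne b hb)]
    · intro z hz
      rw [Function.update_self, Function.update_of_ne (hne z hz)]
      exact hfresh z hz
  have cA : (insert x M.A).card = M.A.card + 1 := Finset.card_insert_of_notMem hx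
  have hchi : (M.insLoop y x p).chi = M.chi := by
    simp only [chi, HMap.insLoop]
    rw [e1, mul_assoc, c1, c2, c3, cF, cP, cA]
    push_cast
    ring
  intro l hl
  rw [hchi]
  have hl1 : l y = l x := hl y (Finset.mem_insert_of_mem hy) x (Finset.mem_insert_self x _)
    (.inl (by
      change Function.update M.F x (M.F y) y = Function.update M.F x (M.F y) x
      rw [Function.update_self, Function.update_of_ne (hne y hy)]))
  change 2 * (nval (insert x M.A) l : ℤ) ≤ _
  rw [nval_insert_of_exists ⟨y, hy, hl1⟩]
  apply hp
  intro z hz w hw hzw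
  refine hl z (Finset.mem_insert_of_mem hz) w (Finset.mem_insert_of_mem hw) (hzw.imp ?_ ?_)
  · intro h1
    change Function.update M.F x (M.F y) z = Function.update M.F x (M.F y) w
    rwa [Function.update_of_ne (hne z hz), Function.update_of_ne (hne w hw)]
  · intro h1
    change Function.update M.P x p z = Function.update M.P x p w
    rwa [Function.update_of_ne (hne z hz), Function.update_of_ne (hne w hw)]

/-- Join the vertices of `x` and `x'`. -/
noncomputable def joinP (M : HMap) (x x' : ℕ) : HMap :=
  ⟨M.A, M.φ, M.π * swap x x', M.F, relabel M.P x x'⟩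

lemma Wf.joinP (h : M.Wf) {x x' : ℕ} (hx : x ∈ M.A) (hx' : x' ∈ M.A) : (M.joinP x x').Wf where
  suppφ := h.suppφ
  suppπ := h.suppπ.mul (SuppIn.swap hx hx')
  face := h.face
  vert z := by
    have key : relabel M.P x x' = relabel M.P (M.π x) (M.π x') := by
      unfold relabel
      rw [h.vert, h.vert]
    change relabel M.P x x' ((M.π * swap x x') z) = relabel M.P x x' z
    rw [key, mul_swap_eq]
    exact relabel_swap_invariant h.vert z

lemma Planar.joinP (h : M.Wf) (hp : M.Planar) {x x' : ℕ} (hx : x ∈ M.A) (hx' : x' ∈ M.A)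
    (hπ : M.π x = x) (hφ : M.φ x = x') (hne : x ≠ x') : (M.joinP x x').Planar := by
  have hν := h.suppφ.mul h.suppπ
  have hνx : (M.φ * M.π) x = x' := by rw [Perm.mul_apply, hπ, hφ]
  have hsc : ¬ SameCycle M.π x x' := by
    rw [sameCycle_comm, sameCycle_fixed_iff hπ]
    exact hne.symm
  have hsc2 : ¬ SameCycle M.π (M.π x) (M.π x') := by
    rwa [sameCycle_apply_left, sameCycle_apply_right]
  have hscν : SameCycle (M.φ * M.π) ((M.φ * M.π) x) ((M.φ * M.π) x') := by
    rw [sameCycle_apply_left, sameCycle_apply_right, ← hνx, sameCycle_apply_right]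
  have c1 := cyc_split hν ((hν.mem_iff x).2 hx) ((hν.mem_iff x').2 hx') hscν
    (fun e => hne ((M.φ * M.π).injective e))
  have c2 := cyc_merge h.suppπ ((h.suppπ.mem_iff x).2 hx) ((h.suppπ.mem_iff x').2 hx') hsc2
  have cP := nval_le_relabel_add_one (f := M.P) hx hx'
  have hchi : M.chi ≤ (M.joinP x x').chi := by
    simp only [chi, HMap.joinP]
    rw [← mul_assoc, mul_swap_eq (M.φ * M.π), mul_swap_eq M.π, c1]
    omega
  intro l hl
  refine le_trans (hp l fun z hz w hw hzw => hl z hz w hw (hzw.imp id fun h1 => ?_)) hchi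
  exact relabel_eq_iff.2 (.inl h1)

/-- Split off a new face with label function `F'`. -/
def pinch (M : HMap) (y w : ℕ) (F' : ℕ → ℕ) : HMap :=
  ⟨M.A, M.φ * swap y w, M.π, F', M.P⟩

lemma Planar.pinch (h : M.Wf) (hp : M.Planar) {y w : ℕ} {F' : ℕ → ℕ} {R : Set ℕ} {f : ℕ}
    (hy : y ∈ M.A) (hw : w ∈ M.A) (hyw : y ≠ w) (hsc : SameCycle M.φ y w)
    (hyR : y ∉ R) (hwR : w ∈ R)
    (hF : ∀ z ∉ R, F' z = M.F z) (hFR : ∀ z ∈ R, F' z = f) (hR : ∀ z ∈ R, M.F z = M.F y)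
    (hf : ∀ z ∈ M.A, M.F z ≠ f)
    (hmate : ∃ u ∈ M.A, ∃ v ∈ M.A, u ∈ R ∧ v ∉ R ∧ M.F v = M.F y ∧ M.P u = M.P v) :
    (M.pinch y w F').Planar := by
  have hν := h.suppφ.mul h.suppπ
  have hscφ : SameCycle M.φ (M.φ y) (M.φ w) := by
    rwa [sameCycle_apply_left, sameCycle_apply_right]
  have c1 := cyc_split h.suppφ ((h.suppφ.mem_iff y).2 hy) ((h.suppφ.mem_iff w).2 hw) hscφ
    (fun e => hyw (M.φ.injective e))
  have e1 : M.φ * swap y w * M.π = swap (M.φ y) (M.φ w) * (M.φ * M.π) := by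
    rw [mul_swap_eq, mul_assoc]
  have c2 : cyc M.A (M.φ * M.π) ≤ cyc M.A (swap (M.φ y) (M.φ w) * (M.φ * M.π)) + 1 := by
    by_cases hc : SameCycle (M.φ * M.π) (M.φ y) (M.φ w)
    · have := cyc_split hν ((h.suppφ.mem_iff y).2 hy) ((h.suppφ.mem_iff w).2 hw) hc
        (fun e => hyw (M.φ.injective e))
      omega
    · have := cyc_merge hν ((h.suppφ.mem_iff y).2 hy) ((h.suppφ.mem_iff w).2 hw) hc
      omega
  have cF : nval M.A F' = nval M.A M.F + 1 := by
    classical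
    have : M.A.image F' = insert f (M.A.image M.F) := by
      ext b
      simp only [Finset.mem_image, Finset.mem_insert]
      constructor
      · rintro ⟨z, hz, rfl⟩
        by_cases hzR : z ∈ R
        · exact .inl (hFR z hzR)
        · exact .inr ⟨z, hz, (hF z hzR).symm⟩
      · rintro (rfl | ⟨z, hz, rfl⟩)
        · exact ⟨w, hw, hFR w hwR⟩
        · by_cases hzR : z ∈ R
          · exact ⟨y, hy, by rw [hF y hyR, hR z hzR]⟩
          · exact ⟨z, hz, hF z hzR⟩
    have h2 : (M.A.image F').card = (M.A.image M.F).card + 1 := by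
      rw [this, Finset.card_insert_of_notMem]
      simpa using hf
    unfold nval
    convert h2
  have hchi : M.chi ≤ (M.pinch y w F').chi := by
    simp only [chi, HMap.pinch]
    rw [e1, mul_swap_eq M.φ, c1, cF]
    omega
  intro l hl
  refine le_trans (hp l ?_) hchi
  obtain ⟨u, hu, v, hv, huR, hvR, hFv, hP⟩ := hmate
  have huv : l u = l v := hl u hu v hv (.inr hP)
  have hrep : ∀ z ∈ M.A, M.F z = M.F y → l z = l v := by
    intro z hz hzF
    by_cases hzR : z ∈ R
    · rw [← huv]
      exact hl z hz u hu (.inl ((hFR z hzR).trans (hFR u huR).symm))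
    · exact hl z hz v hv (.inl ((hF z hzR).trans (hzF.trans (hFv.symm.trans (hF v hvR).symm))))
  rintro z hz t ht (hzt | hzt)
  · by_cases hzF : M.F z = M.F y
    · rw [hrep z hz hzF, hrep t ht (hzt ▸ hzF)]
    · have hzR : z ∉ R := fun hh => hzF (hR z hh)
      have htR : t ∉ R := fun hh => hzF (hzt.trans (hR t hh))
      exact hl z hz t ht (.inl ((hF z hzR).trans (hzt.trans (hF t htR).symm)))
  · exact hl z hz t ht (.inr hzt)

end HMap

section Chebyshev

/-- The ratio `sin (n π / m) / sin (π / m)`. -/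
noncomputable def sinRatio (m : ℕ) (n : ℤ) : ℝ :=
  Real.sin (n * (Real.pi / m)) / Real.sin (Real.pi / m)

/-- The number `2 cos (π / m)`. -/
noncomputable def twoCos (m : ℕ) : ℝ := 2 * Real.cos (Real.pi / m)

variable {m : ℕ}

lemma pi_div_pos (hm : 2 ≤ m) : 0 < Real.pi / m := by
  have : (0 : ℝ) < m := by exact_mod_cast (by omega : 0 < m)
  have := Real.pi_pos
  positivity

lemma sin_mul_pos (hm : 2 ≤ m) {n : ℤ} (h0 : 0 < n) (h1 : n < m) :
    0 < Real.sin (n * (Real.pi / m)) := by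
  have hm' : (0 : ℝ) < m := by exact_mod_cast (by omega : 0 < m)
  have hn : (0 : ℝ) < n := by exact_mod_cast h0
  have hnm : (n : ℝ) < m := by exact_mod_cast h1
  apply Real.sin_pos_of_pos_of_lt_pi
  · have := pi_div_pos hm
    positivity
  · rw [mul_div_assoc', div_lt_iff₀ hm', mul_comm]
    exact mul_lt_mul_of_pos_left hnm Real.pi_pos

lemma sin_pi_div_pos (hm : 2 ≤ m) : 0 < Real.sin (Real.pi / m) := by
  have := sin_mul_pos hm (n := 1) one_pos (by exact_mod_cast (by omega : 1 < m))
  simpa using this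

lemma sinRatio_zero : sinRatio m 0 = 0 := by simp [sinRatio]

lemma sinRatio_one (hm : 2 ≤ m) : sinRatio m 1 = 1 := by
  rw [sinRatio, Int.cast_one, one_mul, div_self (sin_pi_div_pos hm).ne']

lemma sinRatio_neg (n : ℤ) : sinRatio m (-n) = - sinRatio m n := by
  simp [sinRatio, Real.sin_neg, neg_div]

lemma sinRatio_add_one (n : ℤ) :
    sinRatio m (n + 1) = twoCos m * sinRatio m n - sinRatio m (n - 1) := by
  unfold sinRatio twoCos
  push_cast
  rw [add_mul, sub_mul, one_mul, Real.sin_add, Real.sin_sub]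
  ring

lemma sinRatio_pos (hm : 2 ≤ m) {n : ℤ} (h0 : 0 < n) (h1 : n < m) : 0 < sinRatio m n :=
  div_pos (sin_mul_pos hm h0 h1) (sin_pi_div_pos hm)

lemma sinRatio_self (hm : 2 ≤ m) : sinRatio m m = 0 := by
  have hm' : (m : ℝ) ≠ 0 := by exact_mod_cast (by omega : m ≠ 0)
  rw [sinRatio, Int.cast_natCast, mul_div_cancel₀ _ hm', Real.sin_pi, zero_div]

lemma sinRatio_add_self (hm : 2 ≤ m) (n : ℤ) : sinRatio m (n + m) = - sinRatio m n := by
  have hm' : (m : ℝ) ≠ 0 := by exact_mod_cast (by omega : m ≠ 0)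
  unfold sinRatio
  push_cast
  rw [add_mul, mul_div_cancel₀ _ hm', Real.sin_add_pi, neg_div]

lemma sinRatio_nonneg (hm : 2 ≤ m) {n : ℤ} (h0 : 0 ≤ n) (h1 : n ≤ m) : 0 ≤ sinRatio m n := by
  rcases h0.eq_or_lt with rfl | h0
  · rw [sinRatio_zero]
  rcases h1.eq_or_lt with rfl | h1
  · rw [sinRatio_self hm]
  · exact (sinRatio_pos hm h0 h1).le

lemma twoCos_pos (hm : 3 ≤ m) : 0 < twoCos m := by
  unfold twoCos
  have hm' : (0 : ℝ) < m := by exact_mod_cast (by omega : 0 < m)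
  have h3 : (3 : ℝ) ≤ m := by exact_mod_cast hm
  have := Real.cos_pos_of_mem_Ioo (x := Real.pi / m) ⟨by
    have := pi_div_pos (by omega : 2 ≤ m)
    have := Real.pi_pos
    linarith, by
    rw [div_lt_div_iff_of_pos_left Real.pi_pos hm' two_pos]
    linarith⟩
  linarith

lemma twoCos_two : twoCos 2 = 0 := by simp [twoCos]

lemma twoCos_eq (hm : 2 ≤ m) : twoCos m = sinRatio m 2 := by
  have := sinRatio_add_one (m := m) 1
  rw [sinRatio_one hm, sub_self, sinRatio_zero] at this
  rw [show (2 : ℤ) = 1 + 1 by norm_num, this]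
  ring

end Chebyshev

section Dihedral

open Matrix

lemma map_altProd {M N F : Type*} [Monoid M] [Monoid N] [FunLike F M N] [MonoidHomClass F M N]
    (f : F) (n : ℕ) (x y : M) : f (altProd n x y) = altProd n (f x) (f y) := by
  induction n generalizing x y with
  | zero => exact map_one f
  | succ n ih => rw [altProd, altProd, map_mul, ih]

/-- The rotation-like matrix. -/
noncomputable def rotMat (m : ℕ) : Matrix (Fin 2) (Fin 2) ℝ := !![twoCos m, -1; 1, 0]

lemma rotMat_pow (m : ℕ) (hm : 2 ≤ m) (n : ℕ) : rotMat m ^ n =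
    !![sinRatio m (n + 1), - sinRatio m n; sinRatio m n, - sinRatio m (n - 1)] := by
  induction n with
  | zero =>
    have : sinRatio m (-1) = -1 := by rw [sinRatio_neg, sinRatio_one hm]
    ext i j
    fin_cases i <;> fin_cases j <;> simp [sinRatio_zero, sinRatio_one hm, this]
  | succ n ih =>
    rw [pow_succ', ih, rotMat]
    have h1 := sinRatio_add_one (m := m) (n + 1)
    have h2 := sinRatio_add_one (m := m) n
    rw [show (n : ℤ) + 1 - 1 = n by ring] at h1
    ext i j
    fin_cases i <;> fin_cases j <;> simp [Matrix.mul_apply, Fin.sum_univ_two, h1, h2] <;> ring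

lemma rotMat_pow_self {m : ℕ} (hm : 2 ≤ m) : rotMat m ^ m = -1 := by
  rw [rotMat_pow m hm, sinRatio_self hm, add_comm, sinRatio_add_self hm, sinRatio_one hm]
  have : sinRatio m ((m : ℤ) - 1) = 1 := by
    rw [sub_eq_neg_add, sinRatio_add_self hm, sinRatio_neg, sinRatio_one hm, neg_neg]
  rw [this]
  ext i j
  fin_cases i <;> fin_cases j <;> simp

lemma altProd_matrix {m : ℕ} (hm : 2 ≤ m) :
    altProd m (!![1, twoCos m; 0, 1] : Matrix (Fin 2) (Fin 2) ℝ) !![1, 0; - twoCos m, 1] =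
      altProd m !![1, 0; - twoCos m, 1] !![1, twoCos m; 0, 1] := by
  set C : Matrix (Fin 2) (Fin 2) ℝ := !![1, twoCos m; 0, 1] with hC
  set D : Matrix (Fin 2) (Fin 2) ℝ := !![1, 0; - twoCos m, 1] with hD
  let S : Matrix (Fin 2) (Fin 2) ℝ := !![0, -1; 1, 0]
  have hSC : S * C = D * S := by
    ext i j
    fin_cases i <;> fin_cases j <;> simp [S, C, D, Matrix.mul_apply, Fin.sum_univ_two]
  have hSD : S * D = C * S := by
    ext i j
    fin_cases i <;> fin_cases j <;> simp [S, C, D, Matrix.mul_apply, Fin.sum_univ_two]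
  have hR : C * S = rotMat m := by
    ext i j
    fin_cases i <;> fin_cases j <;> simp [S, C, rotMat, Matrix.mul_apply, Fin.sum_univ_two]
  have hS4 : S ^ 4 = 1 := by
    ext i j
    fin_cases i <;> fin_cases j <;>
      simp [S, pow_succ, Matrix.mul_apply, Fin.sum_univ_two]
  have h1 : ∀ n, S * altProd n C D = altProd n D C * S ∧ S * altProd n D C = altProd n C D * S := by
    intro n
    induction n with
    | zero => simp [altProd]
    | succ n ih =>
      simp only [altProd]
      exact ⟨by rw [← mul_assoc, hSC, mul_assoc, ih.2, mul_assoc],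
        by rw [← mul_assoc, hSD, mul_assoc, ih.1, mul_assoc]⟩
  have h2 : ∀ n, altProd n C D * S ^ n = rotMat m ^ n := by
    intro n
    induction n with
    | zero => simp [altProd]
    | succ n ih =>
      rw [altProd, pow_succ' S, mul_assoc, ← mul_assoc (altProd n D C), ← (h1 n).1, pow_succ', ← ih,
        ← hR]
      simp only [mul_assoc]
  have h3 : altProd m C D * S ^ (m + 1) = altProd m D C * S ^ (m + 1) := by
    rw [pow_succ' S, ← mul_assoc (altProd m D C), ← (h1 m).1, mul_assoc S, h2, ← pow_succ',
      pow_succ, ← mul_assoc, h2, rotMat_pow_self hm]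
    simp
  have h4 : S ^ (m + 1) * (S ^ 3) ^ (m + 1) = 1 := by
    rw [← pow_mul, ← pow_add, show m + 1 + 3 * (m + 1) = 4 * (m + 1) by ring, pow_mul, hS4, one_pow]
  calc altProd m C D = altProd m C D * S ^ (m + 1) * (S ^ 3) ^ (m + 1) := by
        rw [mul_assoc, h4, mul_one]
    _ = altProd m D C := by rw [h3, mul_assoc, h4, mul_one]

end Dihedral

section Transvection

variable {W : Type*} [AddCommGroup W] [Module ℝ W]

/-- The invertible transvection `v ↦ v + f v • e`, where `f e = 0`. -/
def transv (e : W) (f : W →ₗ[ℝ] ℝ) (h : f e = 0) : (Module.End ℝ W)ˣ where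
  val := 1 + f.smulRight e
  inv := 1 - f.smulRight e
  val_inv := by
    ext v
    simp [h]
  inv_val := by
    ext v
    simp [h]

lemma transv_apply (e : W) (f : W →ₗ[ℝ] ℝ) (h : f e = 0) (v : W) :
    (transv e f h : Module.End ℝ W) v = v + f v • e := rfl

lemma transv_inv_apply (e : W) (f : W →ₗ[ℝ] ℝ) (h : f e = 0) (v : W) :
    ((transv e f h)⁻¹ : (Module.End ℝ W)ˣ).val v = v - f v • e := rfl

lemma transv_zpow_apply (e : W) (f : W →ₗ[ℝ] ℝ) (h : f e = 0) (k : ℤ) (v : W) :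
    ((transv e f h ^ k : (Module.End ℝ W)ˣ) : Module.End ℝ W) v = v + ((k : ℝ) * f v) • e := by
  induction k with
  | zero => simp
  | succ k ih =>
    rw [zpow_add_one, Units.val_mul, Module.End.mul_apply, transv_apply]
    have : ∀ v', ((transv e f h ^ (k : ℤ) : (Module.End ℝ W)ˣ) : Module.End ℝ W) (v' + f v • e) =
      ((transv e f h ^ (k : ℤ) : (Module.End ℝ W)ˣ) : Module.End ℝ W) v' +
        f v • ((transv e f h ^ (k : ℤ) : (Module.End ℝ W)ˣ) : Module.End ℝ W) e := by
      intro v'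
      rw [map_add, map_smul]
    rw [this, ih]
    have he : ((transv e f h ^ (k : ℤ) : (Module.End ℝ W)ˣ) : Module.End ℝ W) e = e := by
      have hfix : transv e f h ∈ MulAction.stabilizer (Module.End ℝ W)ˣ e := by
        rw [MulAction.mem_stabilizer_iff]
        change (transv e f h : Module.End ℝ W) e = e
        rw [transv_apply, h, zero_smul, add_zero]
      exact zpow_mem hfix k
    rw [he]
    push_cast
    module
  | pred k ih =>
    rw [zpow_sub_one, Units.val_mul, Module.End.mul_apply, transv_inv_apply]
    have he : ((transv e f h ^ (-(k : ℤ)) : (Module.End ℝ W)ˣ) : Module.End ℝ W) e = e := by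
      have hfix : transv e f h ∈ MulAction.stabilizer (Module.End ℝ W)ˣ e := by
        rw [MulAction.mem_stabilizer_iff]
        change (transv e f h : Module.End ℝ W) e = e
        rw [transv_apply, h, zero_smul, add_zero]
      exact zpow_mem hfix (-(k : ℤ))
    rw [map_sub, map_smul, he, ih]
    push_cast
    module

lemma altProd_transv {m : ℕ} (hm : 2 ≤ m) {e₀ e₁ : W} {f₀ f₁ : W →ₗ[ℝ] ℝ} (h₀ : f₀ e₀ = 0)
    (h₁ : f₁ e₁ = 0) (h01 : f₀ e₁ = twoCos m) (h10 : f₁ e₀ = - twoCos m) :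
    altProd m (transv e₀ f₀ h₀) (transv e₁ f₁ h₁) = altProd m (transv e₁ f₁ h₁) (transv e₀ f₀ h₀) := by
  rcases hm.eq_or_lt with rfl | hm3
  · rw [twoCos_two] at h01
    rw [twoCos_two, neg_zero] at h10
    simp only [altProd, mul_one]
    ext v
    simp only [Units.val_mul, Module.End.mul_apply, transv_apply, map_add, map_smul, h01, h10]
    module
  have hμ : twoCos m ≠ 0 := (twoCos_pos hm3).ne'
  let J : (Fin 2 → ℝ) → W := fun p => p 0 • e₀ + p 1 • e₁
  have hJ0 : ∀ p, (transv e₀ f₀ h₀ : Module.End ℝ W) (J p) =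
      J (Matrix.mulVec !![1, twoCos m; 0, 1] p) := by
    intro p
    simp only [transv_apply, J, map_add, map_smul, h₀, h01, Matrix.mulVec, dotProduct,
      Fin.sum_univ_two]
    simp
    module
  have hJ1 : ∀ p, (transv e₁ f₁ h₁ : Module.End ℝ W) (J p) =
      J (Matrix.mulVec !![1, 0; - twoCos m, 1] p) := by
    intro p
    simp only [transv_apply, J, map_add, map_smul, h₁, h10, Matrix.mulVec, dotProduct,
      Fin.sum_univ_two]
    simp
    module
  have hJ : ∀ n p, (altProd n (transv e₀ f₀ h₀) (transv e₁ f₁ h₁)).val (J p) =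
        J (Matrix.mulVec (altProd n !![1, twoCos m; 0, 1] !![1, 0; - twoCos m, 1]) p) ∧
      (altProd n (transv e₁ f₁ h₁) (transv e₀ f₀ h₀)).val (J p) =
        J (Matrix.mulVec (altProd n !![1, 0; - twoCos m, 1] !![1, twoCos m; 0, 1]) p) := by
    intro n
    induction n with
    | zero => intro p; simp [altProd]
    | succ n ih =>
      intro p
      simp only [altProd, Units.val_mul, Module.End.mul_apply]
      rw [(ih p).1, (ih p).2, hJ0, hJ1, Matrix.mulVec_mulVec, Matrix.mulVec_mulVec]
      exact ⟨rfl, rfl⟩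
  have hker : ∀ n v, f₀ v = 0 → f₁ v = 0 →
      (altProd n (transv e₀ f₀ h₀) (transv e₁ f₁ h₁)).val v = v ∧
      (altProd n (transv e₁ f₁ h₁) (transv e₀ f₀ h₀)).val v = v := by
    intro n v hv0 hv1
    induction n with
    | zero => simp [altProd]
    | succ n ih =>
      simp only [altProd, Units.val_mul, Module.End.mul_apply]
      rw [ih.1, ih.2, transv_apply, transv_apply, hv0, hv1]
      simp
  ext v
  have hdec : v = (v - J ![- f₁ v / twoCos m, f₀ v / twoCos m]) +
      J ![- f₁ v / twoCos m, f₀ v / twoCos m] := by abel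
  have k0 : f₀ (v - J ![- f₁ v / twoCos m, f₀ v / twoCos m]) = 0 := by
    simp only [J, map_sub, map_add, map_smul, h₀, h01]
    simp
    field_simp
    ring
  have k1 : f₁ (v - J ![- f₁ v / twoCos m, f₀ v / twoCos m]) = 0 := by
    simp only [J, map_sub, map_add, map_smul, h₁, h10]
    simp
    field_simp
    ring
  have key : ∀ k q, f₀ k = 0 → f₁ k = 0 →
      (altProd m (transv e₀ f₀ h₀) (transv e₁ f₁ h₁)).val (k + J q) =
      (altProd m (transv e₁ f₁ h₁) (transv e₀ f₀ h₀)).val (k + J q) := by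
    intro k q k0 k1
    rw [LinearMap.map_add _ k, LinearMap.map_add _ k, (hker m _ k0 k1).1, (hker m _ k0 k1).2, (hJ m _).1, (hJ m _).2,
      altProd_matrix hm]
  have := key _ ![- f₁ v / twoCos m, f₀ v / twoCos m] k0 k1
  rwa [← hdec] at this

end Transvection

section Recursion

/-- The solution of `z (n + 2) = z n + y (n + 1) * z (n + 1)` with `z 0 = 0` and `z 1 = 1`. -/
def recSeq (y : ℕ → ℝ) : ℕ → ℝ
  | 0 => 0
  | 1 => 1
  | n + 2 => recSeq y n + y (n + 1) * recSeq y (n + 1)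

variable {m : ℕ}

lemma recursion_growth (hm : 2 ≤ m) {y z : ℕ → ℝ} (h0 : z 0 = 0) (h1 : z 1 = 1) {N : ℕ}
    (hz : ∀ i, i < N → z (i + 2) = z i + y (i + 1) * z (i + 1))
    (hy : ∀ i, twoCos m ≤ |y i|) (i : ℕ) (hi : i + 2 ≤ m) (hiN : i < N) :
    z (i + 1) ≠ 0 ∧ 0 ≤ y (i + 1) * z (i + 1) * z (i + 2) ∧
      sinRatio m (i + 2) * |z (i + 1)| ≤ |z (i + 2)| * sinRatio m (i + 1) := by
  induction i with
  | zero =>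
    have : z 2 = y 1 := by simpa [h0, h1] using hz 0 hiN
    simp only [zero_add, this, h1, CharP.cast_eq_zero, sinRatio_one hm, ← twoCos_eq hm]
    refine ⟨one_ne_zero, by nlinarith [mul_self_nonneg (y 1)], by simpa using hy 1⟩
  | succ i ih =>
    obtain ⟨hne, -, hle⟩ := ih (by omega) (by omega)
    have u1 : 0 < sinRatio m (i + 1) := sinRatio_pos hm (by omega) (by omega)
    have u2 : 0 < sinRatio m (i + 2) := sinRatio_pos hm (by omega) (by omega)
    have u3 : 0 ≤ sinRatio m (i + 3) := sinRatio_nonneg hm (by omega) (by omega)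
    have hu : sinRatio m (i + 3) = twoCos m * sinRatio m (i + 2) - sinRatio m (i + 1) := by
      have := sinRatio_add_one (m := m) (i + 2)
      rwa [add_assoc, show (i : ℤ) + 2 - 1 = i + 1 by ring] at this
    have a1 : 0 < |z (i + 1)| := abs_pos.2 hne
    have a2 : 0 < |z (i + 2)| := by
      by_contra hcon
      have : |z (i + 2)| * sinRatio m (i + 1) ≤ 0 := by nlinarith
      nlinarith
    have hz3 := hz (i + 1) hiN
    have hlow : sinRatio m (i + 3) * |z (i + 2)| ≤
        (|y (i + 2)| * |z (i + 2)| - |z (i + 1)|) * sinRatio m (i + 2) := by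
      have := mul_le_mul_of_nonneg_right (hy (i + 2)) (mul_pos a2 u2).le
      rw [hu]
      nlinarith
    have hlow' : 0 ≤ |y (i + 2)| * |z (i + 2)| - |z (i + 1)| := by
      by_contra hcon
      have := mul_pos_of_neg_of_neg (not_le.1 hcon) (neg_neg_of_pos u2)
      nlinarith [mul_nonneg u3 a2.le]
    push_cast
    rw [show (i : ℤ) + 1 + 2 = i + 3 by ring, show (i : ℤ) + 1 + 1 = i + 2 by ring]
    refine ⟨abs_pos.1 a2, ?_, hlow.trans ?_⟩
    · change 0 ≤ y (i + 2) * z (i + 2) * z (i + 1 + 2)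
      rw [hz3]
      change 0 ≤ y (i + 2) * z (i + 2) * (z (i + 1) + y (i + 2) * z (i + 2))
      have h2 : -(|y (i + 2)| * |z (i + 2)| * |z (i + 1)|) ≤ y (i + 2) * z (i + 2) * z (i + 1) := by
        rw [← abs_mul, ← abs_mul]
        exact neg_abs_le _
      have h3 : y (i + 2) * z (i + 2) * (y (i + 2) * z (i + 2)) =
          (|y (i + 2)| * |z (i + 2)|) * (|y (i + 2)| * |z (i + 2)|) := by
        rw [← abs_mul, abs_mul_abs_self]
      have := mul_nonneg (mul_nonneg (abs_nonneg (y (i + 2))) a2.le) hlow'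
      nlinarith
    · apply mul_le_mul_of_nonneg_right _ u2.le
      rw [hz3, ← abs_mul]
      have := abs_sub_abs_le_abs_sub (y (i + 2) * z (i + 2)) (- z (i + 1))
      rwa [abs_neg, sub_neg_eq_add, add_comm (y (i + 2) * z (i + 2))] at this

/-- A periodic solution with a sign coincidence in the middle forces a long period. -/
lemma recursion_period (hm : 2 ≤ m) {y z : ℕ → ℝ} (h0 : z 0 = 0) (h1 : z 1 = 1) {r : ℕ}
    (hr : 2 ≤ r) (hz : ∀ i, z (i + 2) = z i + y (i + 1) * z (i + 1))
    (hy : ∀ i, twoCos m ≤ |y i|) (hn0 : z (2 * r) = 0) (hn1 : z (2 * r + 1) = 1)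
    (hpos : 0 < y r * y (r + 1)) : m ≤ r := by
  by_contra hlt
  push Not at hlt
  obtain ⟨r, rfl⟩ : ∃ s, r = s + 2 := ⟨r - 2, by omega⟩
  obtain ⟨ha, hb, -⟩ := recursion_growth hm h0 h1 (N := r + 2) (fun i _ => hz i) hy (r + 1)
    (by omega) (by omega)
  obtain ⟨hc, hd, he⟩ := recursion_growth hm (y := fun i => - y (2 * (r + 2) - i))
    (z := fun i => z (2 * (r + 2) - i)) (N := 2 * (r + 2) - 1) (by simpa using hn0)
    (by
      have := hz (2 * (r + 2) - 1)
      rw [show 2 * (r + 2) - 1 + 2 = 2 * (r + 2) + 1 by omega, hn1,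
        show 2 * (r + 2) - 1 + 1 = 2 * (r + 2) by omega, hn0] at this
      simpa using this.symm)
    (by
      intro i hi
      have := hz (2 * (r + 2) - (i + 2))
      rw [show 2 * (r + 2) - (i + 2) + 2 = 2 * (r + 2) - i by omega,
        show 2 * (r + 2) - (i + 2) + 1 = 2 * (r + 2) - (i + 1) by omega] at this
      linarith)
    (fun i => by simpa using hy _) r (by omega) (by omega)
  rw [show 2 * (r + 2) - (r + 1) = r + 3 by omega] at hc hd he
  rw [show 2 * (r + 2) - (r + 2) = r + 2 by omega] at hd he
  change 0 < y (r + 2) * y (r + 3) at hpos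
  change 0 ≤ y (r + 2) * z (r + 2) * z (r + 3) at hb
  change z (r + 2) ≠ 0 at ha
  have hy3 : y (r + 3) ≠ 0 := by
    intro h
    rw [h, mul_zero] at hpos
    exact lt_irrefl _ hpos
  have hneg : y (r + 3) * z (r + 3) * z (r + 2) < 0 := by
    refine lt_of_le_of_ne (by linarith) ?_
    exact mul_ne_zero (mul_ne_zero hy3 hc) ha
  have hy2 : 0 < (z (r + 3) * z (r + 2)) ^ 2 := by positivity
  nlinarith [mul_nonneg hb (neg_nonneg.2 hneg.le), mul_pos hpos hy2]

end Recursion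

section Representation

variable {V : Type*} (Γ : LabeledGraph V)

/-- The homomorphism sending every standard generator to `1`. -/
def deg : ArtinGroup Γ →* Multiplicative ℤ :=
  PresentedGroup.toGroup (f := fun _ => Multiplicative.ofAdd 1) (by
    rintro _ ⟨a, b, -, rfl⟩
    simp [map_altProd])

lemma deg_gen (v : V) : deg Γ (artinGen Γ v) = Multiplicative.ofAdd 1 := by
  simp [deg, artinGen]

lemma deg_gen_zpow (v : V) (k : ℤ) : deg Γ (artinGen Γ v ^ k) = Multiplicative.ofAdd k := by
  rw [map_zpow, deg_gen, ← ofAdd_zsmul, smul_eq_mul, mul_one]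

lemma gen_zpow_eq_one {v : V} {k : ℤ} (h : artinGen Γ v ^ k = 1) : k = 0 := by
  have := deg_gen_zpow Γ v k
  rw [h, map_one] at this
  exact (Multiplicative.ofAdd.injective this).symm

lemma artin_relation {a b : V} (h : Γ.graph.Adj a b) :
    altProd (Γ.label a b) (artinGen Γ a) (artinGen Γ b) =
      altProd (Γ.label a b) (artinGen Γ b) (artinGen Γ a) := by
  have := PresentedGroup.one_of_mem (rels := Γ.artinRels) ⟨a, b, h, rfl⟩
  rw [map_mul, map_inv, mul_inv_eq_one, map_altProd, map_altProd] at this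
  exact this

/-- An antisymmetric choice of signs. -/
noncomputable def sgn (s t : V) : ℝ :=
  open scoped Classical in if WellOrderingRel s t then 1 else -1

variable {Γ} in
lemma sgn_cases {s t : V} (h : s ≠ t) : (sgn s t = 1 ∧ sgn t s = -1) ∨ (sgn s t = -1 ∧ sgn t s = 1) := by
  unfold sgn
  rcases trichotomous_of WellOrderingRel s t with h1 | h1 | h1
  · rw [if_pos h1, if_neg (asymm h1)]
    exact Or.inl ⟨rfl, rfl⟩
  · exact absurd h1 h
  · rw [if_pos h1, if_neg (asymm h1)]
    exact Or.inr ⟨rfl, rfl⟩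

/-- The representation space: one vector for each generator, and one dual vector for each
generator. -/
abbrev RepSpace (V : Type*) := (V ⊕ V) →₀ ℝ

/-- The vector of a generator. -/
noncomputable def vec (s : V) : RepSpace V := Finsupp.single (Sum.inl s) 1

/-- The dual vector of a generator. -/
noncomputable def dualVec (s : V) : RepSpace V := Finsupp.single (Sum.inr s) 1

/-- The linear form of a generator. -/
noncomputable def form (s : V) : RepSpace V →ₗ[ℝ] ℝ :=
  Finsupp.linearCombination ℝ (Sum.elim
    (fun t => open scoped Classical in
      if Γ.graph.Adj s t then sgn s t * twoCos (Γ.label s t) else 0)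
    (fun t => open scoped Classical in if t = s then 1 else 0))

lemma form_vec_self (s : V) : form Γ s (vec s) = 0 := by simp [form, vec]

lemma form_vec {s t : V} (h : Γ.graph.Adj s t) :
    form Γ s (vec t) = sgn s t * twoCos (Γ.label s t) := by simp [form, vec, h]

lemma form_dualVec_self (s : V) : form Γ s (dualVec s) = 1 := by simp [form, dualVec]

lemma form_dualVec {s t : V} (h : t ≠ s) : form Γ s (dualVec t) = 0 := by
  simp [form, dualVec, h]

/-- The transvection representing a generator. -/
noncomputable def repGen (s : V) : (Module.End ℝ (RepSpace V))ˣ :=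
  transv (vec s) (form Γ s) (form_vec_self Γ s)

/-- A linear representation of an Artin group by transvections. -/
noncomputable def rep : ArtinGroup Γ →* (Module.End ℝ (RepSpace V))ˣ :=
  PresentedGroup.toGroup (f := repGen Γ) (by
    rintro _ ⟨a, b, h, rfl⟩
    rw [map_mul, map_inv, mul_inv_eq_one, map_altProd, map_altProd]
    simp only [FreeGroup.lift_apply_of]
    rcases sgn_cases h.ne with ⟨h1, h2⟩ | ⟨h1, h2⟩
    · exact altProd_transv (Γ.two_le_label h) _ _ (by rw [form_vec Γ h, h1, one_mul])
        (by rw [form_vec Γ h.symm, h2, Γ.label_symm b a, neg_one_mul])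
    · exact (altProd_transv (Γ.two_le_label h) _ _
        (by rw [form_vec Γ h.symm, h2, Γ.label_symm b a, one_mul])
        (by rw [form_vec Γ h, h1, neg_one_mul])).symm)

/-- The action of a group element on a vector. -/
noncomputable def act (g : ArtinGroup Γ) (v : RepSpace V) : RepSpace V := (rep Γ g).val v

lemma act_one (v : RepSpace V) : act Γ 1 v = v := by simp [act]

lemma act_mul (g h : ArtinGroup Γ) (v : RepSpace V) : act Γ (g * h) v = act Γ g (act Γ h v) := by
  simp [act]

lemma act_add (g : ArtinGroup Γ) (v w : RepSpace V) : act Γ g (v + w) = act Γ g v + act Γ g w :=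
  map_add _ _ _

lemma act_smul (g : ArtinGroup Γ) (c : ℝ) (v : RepSpace V) :
    act Γ g (c • v) = c • act Γ g v :=
  map_smul _ _ _

lemma act_injective (g : ArtinGroup Γ) : Function.Injective (act Γ g) := by
  intro v w h
  have := congrArg (act Γ g⁻¹) h
  rwa [← act_mul, ← act_mul, inv_mul_cancel, act_one, act_one] at this

lemma act_gen_zpow (s : V) (k : ℤ) (v : RepSpace V) :
    act Γ (artinGen Γ s ^ k) v = v + ((k : ℝ) * form Γ s v) • vec s := by
  unfold act
  rw [map_zpow, show rep Γ (artinGen Γ s) = repGen Γ s by simp [rep, artinGen]]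
  exact transv_zpow_apply _ _ _ _ _

/-- The smallest discs over a dihedral Artin group: a relation whose letters alternate has at
least `2 m` syllables. -/
lemma label_le_of_alternating {p q : V} (hpq : Γ.graph.Adj p q) {r : ℕ} (hr : 1 ≤ r)
    (dev : ℕ → ArtinGroup Γ) (k : ℕ → ℤ) (hk : ∀ i, k i ≠ 0)
    (hdev : ∀ i, dev (i + 1) = dev i * artinGen Γ (if Even i then p else q) ^ k i)
    (hper : ∀ i, dev (i + 2 * r) = dev i) (hkper : ∀ i, k (i + 2 * r) = k i) :
    Γ.label p q ≤ r := by
  have hm := Γ.two_le_label hpq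
  rcases hr.eq_or_lt with rfl | hr2
  · exfalso
    have h2 := hper 0
    simp only [mul_one, zero_add] at h2
    rw [hdev 1, hdev 0, mul_assoc, mul_eq_left, if_pos (by decide), if_neg (by decide)] at h2
    have h3 : act Γ (artinGen Γ p ^ k 0 * artinGen Γ q ^ k 1) (dualVec p) = dualVec p := by
      rw [h2, act_one]
    rw [act_mul, act_gen_zpow Γ q, form_dualVec Γ hpq.ne, mul_zero, zero_smul, add_zero,
      act_gen_zpow, form_dualVec_self, mul_one, add_eq_left] at h3
    have := DFunLike.congr_fun h3 (Sum.inl p)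
    simp [vec, hk 0] at this
  obtain ⟨i, hi⟩ : ∃ i, k i * k (i + 1) < 0 := by
    by_contra hcon
    push Not at hcon
    have hpos : ∀ i, 0 < k i * k (i + 1) := fun i =>
      lt_of_le_of_ne (hcon i) (mul_ne_zero (hk i) (hk _)).symm
    have h0 : ∀ i, 0 < k 0 * k i := by
      intro i
      induction i with
      | zero => exact mul_self_pos.2 (hk 0)
      | succ i ih =>
        have := mul_pos ih (hpos i)
        have h2 : 0 < k i * k i := mul_self_pos.2 (hk i)
        by_contra h3
        nlinarith
    have hd : ∀ i, 0 ≤ k 0 * ((deg Γ (dev i)).toAdd - (deg Γ (dev 0)).toAdd) ∧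
        (0 < i → 0 < k 0 * ((deg Γ (dev i)).toAdd - (deg Γ (dev 0)).toAdd)) := by
      intro i
      induction i with
      | zero => simp
      | succ i ih =>
        have : (deg Γ (dev (i + 1))).toAdd = (deg Γ (dev i)).toAdd + k i := by
          rw [hdev, map_mul, deg_gen_zpow]
          rfl
        rw [this]
        have h2 := h0 i
        constructor
        · nlinarith [ih.1]
        · intro
          nlinarith [ih.1]
    have := (hd (2 * r)).2 (by omega)
    rw [← zero_add (2 * r), hper] at this
    simp at this
  set b := i + r with hb
  let l : ℕ → V := fun j => if Even j then p else q
  have hl2 : ∀ j, l (j + 2) = l j := by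
    intro j
    simp [l, Nat.even_add]
  have hform : ∀ j, form Γ (l (j + 1)) (vec (l j)) =
      (if Even j then -1 else 1) * (sgn p q * twoCos (Γ.label p q)) := by
    intro j
    have hs : sgn q p = - sgn p q := by
      rcases sgn_cases hpq.ne with ⟨h1, h2⟩ | ⟨h1, h2⟩ <;> rw [h1, h2]
      simp
    by_cases hj : Even j
    · simp only [l, hj, Nat.even_add_one, not_true, if_true, if_false]
      rw [form_vec Γ hpq.symm, hs, Γ.label_symm q p]
      ring
    · simp only [l, hj, Nat.even_add_one, not_false_iff, if_true, if_false]
      rw [form_vec Γ hpq]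
      ring
  have hsq : sgn p q * sgn p q = 1 := by
    rcases sgn_cases hpq.ne with ⟨h1, -⟩ | ⟨h1, -⟩ <;> rw [h1] <;> norm_num
  have hsa : |sgn p q| = 1 := by
    rcases sgn_cases hpq.ne with ⟨h1, -⟩ | ⟨h1, -⟩ <;> rw [h1] <;> norm_num
  have hμ0 : 0 ≤ twoCos (Γ.label p q) := by
    rcases hm.eq_or_lt with h | h
    · rw [← h, twoCos_two]
    · exact (twoCos_pos h).le
  let y : ℕ → ℝ := fun j => - ((k (b + j) : ℝ) *
    ((if Even (b + j) then 1 else -1) * (sgn p q * twoCos (Γ.label p q))))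
  have hconst : ∀ j, act Γ (dev (b + 1 + j))
      (recSeq y (j + 1) • vec (l (b + j)) + recSeq y j • vec (l (b + j + 1))) =
      act Γ (dev (b + 1)) (vec (l b)) := by
    intro j
    induction j with
    | zero => simp [recSeq]
    | succ j ih =>
      rw [← ih, ← add_assoc, hdev, act_mul]
      congr 1
      change act Γ (artinGen Γ (l (b + 1 + j)) ^ _) _ = _
      rw [act_gen_zpow, show b + (j + 1) + 1 = b + j + 2 by ring, hl2,
        show b + (j + 1) = b + j + 1 by ring, show b + 1 + j = b + j + 1 by ring, map_add,
        map_smul, map_smul, form_vec_self, hform]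
      simp only [recSeq, y, Nat.even_add_one, smul_eq_mul, ← add_assoc]
      by_cases hj : Even (b + j) <;> simp only [hj, if_true, if_false, not_true, not_false_iff] <;>
        module
  have hend := hconst (2 * r)
  rw [hper] at hend
  have hend := act_injective Γ _ hend
  have hlr : l (b + 2 * r) = l b := by simp [l, Nat.even_add]
  have hlr' : l (b + 2 * r + 1) = l (b + 1) := by simp [l, Nat.even_add, Nat.even_add_one]
  have hlne : l (b + 1) ≠ l b := by
    by_cases hj : Even b <;> simp [l, hj, Nat.even_add_one, hpq.ne, hpq.ne.symm]
  rw [hlr, hlr'] at hend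
  have hz1 := DFunLike.congr_fun hend (Sum.inl (l b))
  have hz0 := DFunLike.congr_fun hend (Sum.inl (l (b + 1)))
  simp [vec, hlne] at hz1
  simp [vec, hlne.symm] at hz0
  by_cases hm3 : Γ.label p q = 2
  · omega
  have hμ : 0 < twoCos (Γ.label p q) := twoCos_pos (by omega)
  refine recursion_period hm (y := y) (z := recSeq y) rfl rfl (by omega) (fun _ => rfl) ?_ hz0 hz1 ?_
  · intro j
    simp only [y, abs_neg, abs_mul, hsa, one_mul]
    have h1 : (1 : ℝ) ≤ |(k (b + j) : ℝ)| := by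
      rw [← Int.cast_abs]
      exact_mod_cast Int.one_le_abs (hk _)
    have h2 : |(if Even (b + j) then 1 else -1 : ℝ)| = 1 := by split_ifs <;> simp
    rw [h2, one_mul, abs_of_nonneg hμ0]
    nlinarith
  · have e1 : k (b + r) = k i := by rw [hb, show i + r + r = i + 2 * r by ring, hkper]
    have e2 : k (b + r + 1) = k (i + 1) := by
      rw [hb, show i + r + r + 1 = i + 1 + 2 * r by ring, hkper]
    have hi' : (k i : ℝ) * k (i + 1) < 0 := by exact_mod_cast hi
    simp only [y, ← add_assoc, e1, e2, Nat.even_add_one]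
    have : 0 < - ((k i : ℝ) * k (i + 1)) * (twoCos (Γ.label p q) * twoCos (Γ.label p q)) :=
      mul_pos (by linarith) (mul_pos hμ hμ)
    by_cases hj : Even (b + r) <;> simp only [hj, if_true, if_false, not_true, not_false_iff] <;>
    · refine this.trans_eq ?_
      linear_combination (k i : ℝ) * k (i + 1) * (twoCos (Γ.label p q) * twoCos (Γ.label p q)) *
        hsq

end Representation

lemma periodic_of_modEq {α : Type*} {f : ℤ → α} {m : ℕ} (hf : ∀ i, f (i + m) = f i) {i j : ℤ}
    (h : i ≡ j [ZMOD m]) : f i = f j := by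
  obtain ⟨t, ht⟩ := h.symm.dvd
  have := (show Function.Periodic f (m : ℤ) from hf).int_mul t j
  rwa [mul_comm, Int.cast_eq, ← ht, add_sub_cancel] at this

section Atoms

variable {G : Type*} [Group G]

/-- The atoms of the dual Garside structure on a dihedral Artin group. -/
def atom (x y : G) (i : ℤ) : G :=
  (y * x) ^ (i / 2) * (if Even i then x else y) * ((y * x) ^ (i / 2))⁻¹

lemma atom_zero (x y : G) : atom x y 0 = x := by simp [atom]

lemma atom_one (x y : G) : atom x y 1 = y := by simp [atom]

lemma atom_add_two (x y : G) (i : ℤ) : atom x y (i + 2) = (y * x) * atom x y i * (y * x)⁻¹ := by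
  unfold atom
  rw [show (i + 2) / 2 = i / 2 + 1 by omega, add_comm (i / 2) 1, zpow_add, zpow_one]
  simp only [Int.even_add, even_two, iff_true, mul_assoc, mul_inv_rev]

lemma int_induction_two {P : ℤ → Prop} (h0 : P 0) (h1 : P 1) (hs : ∀ i, P i ↔ P (i + 2)) (i : ℤ) :
    P i := by
  have h : P i ∧ P (i + 1) := by
    induction i with
    | zero => exact ⟨h0, h1⟩
    | succ i ih => exact ⟨ih.2, by rw [add_assoc]; exact (hs _).1 ih.1⟩
    | pred i ih =>
      refine ⟨(hs _).2 ?_, by rw [sub_add_cancel]; exact ih.1⟩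
      rw [show -(i : ℤ) - 1 + 2 = -i + 1 by ring]
      exact ih.2
  exact h.1

lemma atom_mul_atom (x y : G) (i : ℤ) : atom x y (i + 1) * atom x y i = y * x := by
  induction i using int_induction_two with
  | h0 => rw [zero_add, atom_zero, atom_one]
  | h1 => rw [show (1 : ℤ) + 1 = 0 + 2 by norm_num, atom_add_two, atom_zero, atom_one]; group
  | hs i =>
    rw [show i + 2 + 1 = i + 1 + 2 by ring, atom_add_two, atom_add_two, conj_mul]
    constructor
    · intro h
      rw [h]
      group
    · intro h
      rwa [mul_inv_eq_iff_eq_mul, mul_right_inj] at h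

lemma delta_mul_atom (x y : G) (i : ℤ) : (y * x) * atom x y i = atom x y (i + 2) * (y * x) := by
  rw [atom_add_two]
  group

lemma delta_zpow_mul_atom (x y : G) (i j : ℤ) :
    (y * x) ^ j * atom x y i = atom x y (i + 2 * j) * (y * x) ^ j := by
  induction j generalizing i with
  | zero => simp
  | succ j ih =>
    rw [zpow_add_one, mul_assoc, delta_mul_atom, ← mul_assoc, ih]
    rw [mul_assoc]
    ring_nf
  | pred j ih =>
    have h : (y * x)⁻¹ * atom x y i = atom x y (i - 2) * (y * x)⁻¹ := by
      rw [inv_mul_eq_iff_eq_mul, ← mul_assoc, delta_mul_atom, sub_add_cancel, mul_inv_cancel_right]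
    rw [zpow_sub_one, mul_assoc, h, ← mul_assoc, ih, mul_assoc]
    ring_nf

lemma atom_inv (x y : G) (i : ℤ) : (atom x y i)⁻¹ = (y * x)⁻¹ * atom x y (i + 1) := by
  rw [← atom_mul_atom x y i]
  group

lemma altProd_add_two (n : ℕ) (x y : G) : altProd (n + 2) x y = x * y * altProd n x y := by
  rw [altProd, altProd, mul_assoc]

lemma altProd_two_mul (n : ℕ) (x y : G) : altProd (2 * n) x y = (x * y) ^ n := by
  induction n with
  | zero => simp [altProd]
  | succ n ih => rw [show 2 * (n + 1) = 2 * n + 2 by ring, altProd_add_two, ih, pow_succ']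

lemma altProd_two_mul_add_one (n : ℕ) (x y : G) : altProd (2 * n + 1) x y = (x * y) ^ n * x := by
  induction n with
  | zero => simp [altProd]
  | succ n ih =>
    rw [show 2 * (n + 1) + 1 = 2 * n + 1 + 2 by ring, altProd_add_two, ih, pow_succ', mul_assoc,
      mul_assoc, mul_assoc]

lemma atom_add {m : ℕ} {x y : G} (h : altProd m x y = altProd m y x) (i : ℤ) :
    atom x y (i + m) = atom x y i := by
  have h0 : atom x y m = x := by
    unfold atom
    rcases Nat.even_or_odd' m with ⟨n, rfl | rfl⟩
    · rw [altProd_two_mul, altProd_two_mul] at h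
      have h2 : altProd (2 * n + 1) x y = x * altProd (2 * n) y x := rfl
      rw [altProd_two_mul_add_one, altProd_two_mul, h] at h2
      rw [if_pos (by simp), show ((2 * n : ℕ) : ℤ) / 2 = n by omega, zpow_natCast, h2]
      group
    · have h2 : altProd (2 * n + 1) x y = x * altProd (2 * n) y x := rfl
      rw [h, altProd_two_mul_add_one, altProd_two_mul] at h2
      rw [if_neg (by simp), show ((2 * n + 1 : ℕ) : ℤ) / 2 = n by omega, zpow_natCast, h2]
      group
  induction i with
  | zero => rw [zero_add, h0, atom_zero]
  | succ i ih =>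
    have h1 := atom_mul_atom x y (i + m)
    rw [ih, ← atom_mul_atom x y i, mul_left_inj] at h1
    rw [← h1]
    ring_nf
  | pred i ih =>
    have h1 := atom_mul_atom x y (-i - 1 + m)
    rw [show -(i : ℤ) - 1 + m + 1 = -i + m by ring, ih, ← atom_mul_atom x y (-i - 1),
      sub_add_cancel, mul_right_inj] at h1
    exact h1

/-- The first index of a list of atoms. -/
def headIdx (σ : ℤ) : List ℤ → ℤ
  | [] => σ - 1
  | i :: _ => i

/-- Normal forms for the dual Garside structure, relative to a final atom. -/
def GoodList (m : ℕ) (σ : ℤ) : List ℤ → Prop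
  | [] => True
  | i :: l => ¬ i ≡ headIdx σ l + 1 [ZMOD m] ∧ GoodList m σ l

lemma exists_goodList {m : ℕ} {x y : G} (h : altProd m x y = altProd m y x) (σ : ℤ) {w : G}
    (hw : w ∈ Subgroup.closure {x, y}) : ∃ (j : ℤ) (l : List ℤ) (k : ℤ), GoodList m σ l ∧
      w = (y * x) ^ j * (l.map (atom x y)).prod * atom x y σ ^ k := by
  have key : ∀ (i : ℤ) (w : G), (∃ (j : ℤ) (l : List ℤ) (k : ℤ), GoodList m σ l ∧
      w = (y * x) ^ j * (l.map (atom x y)).prod * atom x y σ ^ k) →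
      ∃ (j : ℤ) (l : List ℤ) (k : ℤ), GoodList m σ l ∧
      atom x y i * w = (y * x) ^ j * (l.map (atom x y)).prod * atom x y σ ^ k := by
    rintro i _ ⟨j, l, k, hl, rfl⟩
    have hc := delta_zpow_mul_atom x y (i - 2 * j) j
    rw [sub_add_cancel] at hc
    by_cases hi : i - 2 * j ≡ headIdx σ l + 1 [ZMOD m]
    · have ha := periodic_of_modEq (atom_add h) hi
      cases l with
      | nil =>
        refine ⟨j, [], k + 1, trivial, ?_⟩
        simp only [headIdx, sub_add_cancel] at ha
        simp only [List.map_nil, List.prod_nil, mul_one]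
        rw [← mul_assoc, ← hc, ha, add_comm k 1, zpow_add, zpow_one, mul_assoc]
      | cons i' l =>
        refine ⟨j + 1, l, k, hl.2, ?_⟩
        simp only [headIdx] at ha
        simp only [List.map_cons, List.prod_cons]
        rw [← mul_assoc, ← mul_assoc, ← hc, ha, mul_assoc _ _ (atom x y i' * _),
          ← mul_assoc (atom x y (i' + 1)), atom_mul_atom, ← mul_assoc, zpow_add_one]
    · refine ⟨j, (i - 2 * j) :: l, k, ⟨hi, hl⟩, ?_⟩
      simp only [List.map_cons, List.prod_cons]
      rw [← mul_assoc, ← mul_assoc, ← hc]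
      simp only [mul_assoc]
  have key' : ∀ (i : ℤ) (w : G), (∃ (j : ℤ) (l : List ℤ) (k : ℤ), GoodList m σ l ∧
      w = (y * x) ^ j * (l.map (atom x y)).prod * atom x y σ ^ k) →
      ∃ (j : ℤ) (l : List ℤ) (k : ℤ), GoodList m σ l ∧
      (atom x y i)⁻¹ * w = (y * x) ^ j * (l.map (atom x y)).prod * atom x y σ ^ k := by
    intro i w hw
    obtain ⟨j, l, k, hl, he⟩ := key (i + 1) w hw
    refine ⟨-1 + j, l, k, hl, ?_⟩
    rw [atom_inv, mul_assoc, he, zpow_add, zpow_neg_one]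
    simp only [mul_assoc]
  induction hw using Subgroup.closure_induction_left with
  | one => exact ⟨0, [], 0, trivial, by simp⟩
  | mul_left z hz w hw ih =>
    rcases hz with rfl | rfl
    · simpa only [atom_zero] using key 0 w ih
    · simpa only [atom_one] using key 1 w ih
  | inv_mul_cancel z hz w hw ih =>
    rcases hz with rfl | rfl
    · simpa only [atom_zero] using key' 0 w ih
    · simpa only [atom_one] using key' 1 w ih

end Atoms

section PingPong

variable {V : Type*} {Γ : LabeledGraph V} {c d : V}

lemma sinRatio_sq (m : ℕ) (hm : 2 ≤ m) (i : ℤ) :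
    sinRatio m i * sinRatio m i - sinRatio m (i - 1) * sinRatio m (i + 1) = 1 := by
  induction i with
  | zero => simp [sinRatio_zero, sinRatio_one hm, sinRatio_neg]
  | succ i ih =>
    have := sinRatio_add_one (m := m) (i + 1)
    have h2 := sinRatio_add_one (m := m) i
    rw [add_sub_cancel_right] at this ⊢
    rw [this]
    rw [h2] at ih ⊢
    linear_combination ih
  | pred i ih =>
    have := sinRatio_add_one (m := m) (-i)
    have h2 := sinRatio_add_one (m := m) (-i - 1)
    rw [sub_add_cancel] at h2 ⊢
    rw [this] at ih
    have h3 : sinRatio m (-i - 1 - 1) = twoCos m * sinRatio m (-i - 1) - sinRatio m (-i) := by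
      linarith
    rw [h3]
    linear_combination ih

/-- The vectors fixed by the atoms of a dihedral Artin group. -/
noncomputable def atomVec (m : ℕ) (c d : V) (i : ℤ) : RepSpace V :=
  sinRatio m i • vec d - sinRatio m (i - 1) • vec c

lemma atomVec_zero {m : ℕ} (hm : 2 ≤ m) : atomVec m c d 0 = vec c := by
  simp [atomVec, sinRatio_zero, sinRatio_neg, sinRatio_one hm]

lemma atomVec_one {m : ℕ} (hm : 2 ≤ m) : atomVec m c d 1 = vec d := by
  simp [atomVec, sinRatio_zero, sinRatio_one hm]

lemma atomVec_add_one (m : ℕ) (i : ℤ) :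
    atomVec m c d (i + 1) = twoCos m • atomVec m c d i - atomVec m c d (i - 1) := by
  have h1 := sinRatio_add_one (m := m) i
  have h2 := sinRatio_add_one (m := m) (i - 1)
  rw [sub_add_cancel] at h2
  simp only [atomVec]
  rw [h1, add_sub_cancel_right, h2]
  have h3 := sinRatio_add_one (m := m) (i - 1)
  module

lemma atomVec_add (m : ℕ) (hm : 2 ≤ m) (i l : ℤ) :
    atomVec m c d (i + l) =
      sinRatio m l • atomVec m c d (i + 1) - sinRatio m (l - 1) • atomVec m c d i := by
  have : ∀ l, (atomVec m c d (i + l) = sinRatio m l • atomVec m c d (i + 1) -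
      sinRatio m (l - 1) • atomVec m c d i) ∧ (atomVec m c d (i + (l + 1)) =
      sinRatio m (l + 1) • atomVec m c d (i + 1) - sinRatio m l • atomVec m c d i) := by
    intro l
    induction l with
    | zero => simp [sinRatio_zero, sinRatio_one hm, sinRatio_neg]
    | succ l ih =>
      refine ⟨by rw [add_sub_cancel_right]; exact ih.2, ?_⟩
      rw [← add_assoc, atomVec_add_one, add_sub_assoc, add_sub_cancel_right, ih.1, ih.2]
      have h1 := sinRatio_add_one (m := m) (l + 1)
      have h2 := sinRatio_add_one (m := m) l
      rw [add_sub_cancel_right] at h1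
      rw [h1, h2]
      module
    | pred l ih =>
      rw [sub_add_cancel]
      refine ⟨?_, ih.1⟩
      have h0 := atomVec_add_one (c := c) (d := d) m (i + -l)
      rw [add_assoc, ih.1, ih.2, add_sub_assoc] at h0
      have h1 := sinRatio_add_one (m := m) (-l)
      have h2 := sinRatio_add_one (m := m) (-l - 1)
      rw [sub_add_cancel] at h2
      have h3 : sinRatio m (-l - 1 - 1) = twoCos m * sinRatio m (-l - 1) - sinRatio m (-l) := by
        linarith
      rw [h3]
      rw [h1] at h0
      rw [← sub_eq_zero] at h0 ⊢
      rw [← h0]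
      module
  exact (this l).1

lemma atomVec_add_self (m : ℕ) (hm : 2 ≤ m) (i : ℤ) :
    atomVec m c d (i + m) = - atomVec m c d i := by
  unfold atomVec
  rw [sinRatio_add_self hm, show i + (m : ℤ) - 1 = i - 1 + m by ring, sinRatio_add_self hm]
  module

lemma atomVec_independent {m : ℕ} (hm : 2 ≤ m) (hcd : c ≠ d) (i : ℤ) {p q p' q' : ℝ}
    (h : p • atomVec m c d i + q • atomVec m c d (i + 1) =
      p' • atomVec m c d i + q' • atomVec m c d (i + 1)) : p = p' ∧ q = q' := by
  have hd := DFunLike.congr_fun h (Sum.inl d)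
  have hc := DFunLike.congr_fun h (Sum.inl c)
  simp [atomVec, vec, hcd] at hd
  simp [atomVec, vec, hcd.symm] at hc
  have hs := sinRatio_sq m hm i
  constructor
  · linear_combination (p' - p) * hs + sinRatio m i * hd + sinRatio m (i + 1) * hc
  · linear_combination (q' - q) * hs - sinRatio m i * hc - sinRatio m (i - 1) * hd

variable (Γ) in
/-- The edge from `c` to `d` is positively oriented with label `m`. -/
structure PosEdge (c d : V) (m : ℕ) : Prop where
  two_le : 2 ≤ m
  ne : c ≠ d
  rel : altProd m (artinGen Γ c) (artinGen Γ d) = altProd m (artinGen Γ d) (artinGen Γ c)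
  form_cd : form Γ c (vec d) = twoCos m
  form_dc : form Γ d (vec c) = - twoCos m

namespace PosEdge

variable {m : ℕ}

variable (Γ c) in
lemma act_gen (v : RepSpace V) : act Γ (artinGen Γ c) v = v + form Γ c v • vec c := by
  simpa using act_gen_zpow Γ c 1 v

lemma act_delta (h : PosEdge Γ c d m) (i : ℤ) : act Γ (artinGen Γ d * artinGen Γ c) (atomVec m c d i) =
    - atomVec m c d (i + 2) := by
  have h1 := sinRatio_add_one (m := m) i
  have h2 := sinRatio_add_one (m := m) (i + 1)
  rw [add_sub_cancel_right, add_assoc, one_add_one_eq_two] at h2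
  rw [act_mul, act_gen Γ c, act_gen Γ d]
  simp only [atomVec, map_sub, map_add, map_smul, form_vec_self, h.form_cd, h.form_dc]
  rw [show i + 2 - 1 = i + 1 by ring, h2, h1]
  simp only [smul_eq_mul]
  module

lemma act_delta_inv (h : PosEdge Γ c d m) (i : ℤ) : act Γ (artinGen Γ d * artinGen Γ c)⁻¹ (atomVec m c d (i + 2)) =
    - atomVec m c d i := by
  apply act_injective Γ (artinGen Γ d * artinGen Γ c)
  rw [← act_mul, mul_inv_cancel, act_one, ← neg_one_smul ℝ, act_smul, h.act_delta]
  simp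

lemma act_atom (h : PosEdge Γ c d m) (j : ℤ) : ∀ l, act Γ (atom (artinGen Γ c) (artinGen Γ d) j) (atomVec m c d (j + l)) =
    sinRatio m (l + 1) • atomVec m c d j + sinRatio m l • atomVec m c d (j + 1) := by
  induction j using int_induction_two with
  | h0 =>
    intro l
    rw [atom_zero, zero_add, zero_add, atomVec_zero h.two_le, atomVec_one h.two_le, act_gen Γ c,
      atomVec, map_sub, map_smul, map_smul, h.form_cd, form_vec_self, sinRatio_add_one]
    simp only [smul_eq_mul]
    module
  | h1 =>
    intro l
    rw [atom_one, atomVec_add_one, sub_self, atomVec_zero h.two_le, atomVec_one h.two_le,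
      act_gen Γ d, atomVec, map_sub, map_smul, map_smul, h.form_dc, form_vec_self, add_comm 1 l,
      add_sub_cancel_right]
    simp only [smul_eq_mul]
    module
  | hs j =>
    refine forall_congr' fun l => ?_
    rw [atom_add_two, act_mul, act_mul, show j + 2 + l = j + l + 2 by ring, h.act_delta_inv,
      ← neg_one_smul ℝ (atomVec m c d (j + l)), act_smul, act_smul, neg_one_smul, neg_eq_iff_eq_neg]
    constructor
    · intro hh
      rw [hh, act_add, act_smul, act_smul, h.act_delta, h.act_delta]
      rw [show j + 1 + 2 = j + 2 + 1 by ring]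
      module
    · intro hh
      apply act_injective Γ (artinGen Γ d * artinGen Γ c)
      rw [hh, act_add, act_smul, act_smul, h.act_delta, h.act_delta]
      rw [show j + 1 + 2 = j + 2 + 1 by ring]
      module

variable (m c d) in
/-- The double cone spanned by two consecutive atom vectors. -/
def Cone (i : ℤ) (v : RepSpace V) : Prop :=
  ∃ p q : ℝ, 0 ≤ p * q ∧ q ≠ 0 ∧ v = p • atomVec m c d i + q • atomVec m c d (i + 1)

lemma cone_add (h : PosEdge Γ c d m) (i : ℤ) : Cone c d m (i + m) = Cone c d m i := by
  ext v
  unfold Cone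
  rw [atomVec_add_self m h.two_le, show i + (m : ℤ) + 1 = i + 1 + m by ring,
    atomVec_add_self m h.two_le]
  constructor
  · rintro ⟨p, q, h1, h2, rfl⟩
    exact ⟨-p, -q, by linarith, by simpa using h2, by module⟩
  · rintro ⟨p, q, h1, h2, rfl⟩
    exact ⟨-p, -q, by linarith, by simpa using h2, by module⟩

lemma cone_atom (h : PosEdge Γ c d m) {i j : ℤ} {v : RepSpace V} (hv : Cone c d m i v) (hij : ¬ j ≡ i + 1 [ZMOD m]) :
    Cone c d m j (act Γ (atom (artinGen Γ c) (artinGen Γ d) j) v) := by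
  have hm := h.two_le
  set l := (i - j) % m with hl
  have hl0 : 0 ≤ l := Int.emod_nonneg _ (by omega)
  have hlm : l < m := Int.emod_lt_of_pos _ (by omega)
  have hmod : i ≡ j + l [ZMOD m] := by
    have := (Int.mod_modEq (i - j) m).symm.add_left j
    rwa [add_sub_cancel] at this
  have hl1 : l + 1 < m := by
    by_contra hcon
    have : l + 1 = m := by omega
    apply hij
    have h2 := (hmod.add_right 1).symm
    rw [add_assoc, this] at h2
    exact (by simpa using h2 : j ≡ i + 1 [ZMOD m])
  rw [periodic_of_modEq (f := Cone c d m) h.cone_add hmod] at hv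
  obtain ⟨p, q, hpq, hq, rfl⟩ := hv
  have u0 : 0 ≤ sinRatio m l := sinRatio_nonneg hm hl0 (by omega)
  have u1 : 0 < sinRatio m (l + 1) := sinRatio_pos hm (by omega) hl1
  have u2 : 0 ≤ sinRatio m (l + 1 + 1) := sinRatio_nonneg hm (by omega) (by omega)
  have hq2 : 0 < q * q := mul_self_pos.2 hq
  refine ⟨p * sinRatio m (l + 1) + q * sinRatio m (l + 1 + 1), p * sinRatio m l +
    q * sinRatio m (l + 1), ?_, ?_, ?_⟩
  · have h1 := mul_nonneg (mul_nonneg (mul_self_nonneg p) u1.le) u0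
    have h2 := mul_nonneg hpq (mul_self_nonneg (sinRatio m (l + 1)))
    have h3 := mul_nonneg hpq (mul_nonneg u0 u2)
    have h4 := mul_nonneg (mul_nonneg hq2.le u1.le) u2
    nlinarith
  · intro h0
    have h1 := mul_nonneg hpq u0
    have h2 := mul_pos hq2 u1
    have : q * (p * sinRatio m l + q * sinRatio m (l + 1)) = 0 := by rw [h0, mul_zero]
    nlinarith
  · rw [act_add, act_smul, act_smul, h.act_atom, add_assoc j, h.act_atom]
    module

lemma cone_prod (h : PosEdge Γ c d m) (σ : ℤ) (l : List ℤ) (hl : GoodList m σ l) : Cone c d m (headIdx σ l)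
    (act Γ (l.map (atom (artinGen Γ c) (artinGen Γ d))).prod (atomVec m c d σ)) := by
  induction l with
  | nil =>
    refine ⟨0, 1, by simp, one_ne_zero, ?_⟩
    simp [act_one, headIdx]
  | cons i l ih =>
    rw [List.map_cons, List.prod_cons, act_mul]
    exact h.cone_atom (ih hl.2) hl.1

lemma modEq_of_cone (h : PosEdge Γ c d m) {i σ : ℤ} {r : ℝ} (hc : Cone c d m i (r • atomVec m c d σ)) :
    σ ≡ i + 1 [ZMOD m] := by
  have hm := h.two_le
  set l := (σ - i) % m with hl
  have hl0 : 0 ≤ l := Int.emod_nonneg _ (by omega)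
  have hlm : l < m := Int.emod_lt_of_pos _ (by omega)
  have hmod : σ ≡ i + l [ZMOD m] := by
    have := (Int.mod_modEq (σ - i) m).symm.add_left i
    rwa [add_sub_cancel] at this
  have hper := periodic_of_modEq (f := fun σ => ∃ r : ℝ, Cone c d m i (r • atomVec m c d σ)) (m := m)
    (fun j => propext ⟨by
      rintro ⟨r, hr⟩
      rw [atomVec_add_self m hm] at hr
      exact ⟨-r, by simpa using hr⟩, by
      rintro ⟨r, hr⟩
      refine ⟨-r, ?_⟩
      rw [atomVec_add_self m hm]
      simpa using hr⟩) hmod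
  have hc' : ∃ r : ℝ, Cone c d m i (r • atomVec m c d σ) := ⟨r, hc⟩
  rw [show (∃ r : ℝ, Cone c d m i (r • atomVec m c d σ)) =
    (∃ r : ℝ, Cone c d m i (r • atomVec m c d (i + l))) from hper] at hc'
  obtain ⟨r, p, q, hpq, hq, he⟩ := hc'
  rw [atomVec_add m hm] at he
  obtain ⟨h1, h2⟩ := atomVec_independent hm h.ne i (p := - r * sinRatio m (l - 1))
    (q := r * sinRatio m l) (p' := p) (q' := q) (by rw [← he]; module)
  have hl1 : 1 ≤ l := by
    by_contra hcon
    have : l = 0 := by omega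
    rw [this, sinRatio_zero, mul_zero] at h2
    exact hq h2.symm
  have hl2 : l = 1 := by
    by_contra hcon
    have ha := sinRatio_pos hm (n := l - 1) (by omega) (by omega)
    have hb := sinRatio_pos hm (n := l) (by omega) (by omega)
    have hr : 0 < r * r := mul_self_pos.2 (by
      rintro rfl
      rw [zero_mul] at h2
      exact hq h2.symm)
    rw [← h1, ← h2] at hpq
    nlinarith [mul_pos hr (mul_pos ha hb)]
  rw [hl2] at hmod
  exact hmod

lemma act_atom_zpow (h : PosEdge Γ c d m) (N : ℤ) (hN : N ≠ 0) (i : ℤ) :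
    (∀ v, ∃ r : ℝ, act Γ (atom (artinGen Γ c) (artinGen Γ d) i ^ N) v = v + r • atomVec m c d i) ∧
    ∃ v, ∃ r : ℝ, r ≠ 0 ∧
      act Γ (atom (artinGen Γ c) (artinGen Γ d) i ^ N) v = v + r • atomVec m c d i := by
  have hN' : (N : ℝ) ≠ 0 := by exact_mod_cast hN
  induction i using int_induction_two with
  | h0 =>
    rw [atom_zero, atomVec_zero h.two_le]
    refine ⟨fun v => ⟨_, act_gen_zpow Γ c N v⟩, dualVec c, _, ?_, act_gen_zpow Γ c N _⟩
    rwa [form_dualVec_self, mul_one]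
  | h1 =>
    rw [atom_one, atomVec_one h.two_le]
    refine ⟨fun v => ⟨_, act_gen_zpow Γ d N v⟩, dualVec d, _, ?_, act_gen_zpow Γ d N _⟩
    rwa [form_dualVec_self, mul_one]
  | hs i =>
    have key : ∀ v (r : ℝ), act Γ (atom (artinGen Γ c) (artinGen Γ d) (i + 2) ^ N)
        (act Γ (artinGen Γ d * artinGen Γ c) v) =
        act Γ (artinGen Γ d * artinGen Γ c) v + r • atomVec m c d (i + 2) ↔
        act Γ (atom (artinGen Γ c) (artinGen Γ d) i ^ N) v = v + (-r) • atomVec m c d i := by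
      intro v r
      rw [atom_add_two, conj_zpow, ← act_mul, inv_mul_cancel_right, act_mul,
        ← (act_injective Γ (artinGen Γ d * artinGen Γ c)).eq_iff (b := v + _), act_add, act_smul,
        h.act_delta, neg_smul_neg]
    have hsurj : ∀ v, act Γ (artinGen Γ d * artinGen Γ c)
        (act Γ (artinGen Γ d * artinGen Γ c)⁻¹ v) = v := by
      intro v
      rw [← act_mul, mul_inv_cancel, act_one]
    constructor
    · rintro ⟨h1, v, r, hr, hv⟩
      refine ⟨fun v => ?_, act Γ (artinGen Γ d * artinGen Γ c) v, -r, by simpa using hr,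
        (key _ _).2 (by rwa [neg_neg])⟩
      obtain ⟨r, hr⟩ := h1 (act Γ (artinGen Γ d * artinGen Γ c)⁻¹ v)
      refine ⟨-r, ?_⟩
      rw [← hsurj v]
      exact (key _ _).2 (by rwa [neg_neg])
    · rintro ⟨h1, v, r, hr, hv⟩
      rw [← hsurj v] at hv
      refine ⟨fun v => ?_, _, -r, by simpa using hr, (key _ _).1 hv⟩
      obtain ⟨r, hr⟩ := h1 (act Γ (artinGen Γ d * artinGen Γ c) v)
      exact ⟨-r, (key _ _).1 hr⟩

lemma cone_of_conj (h : PosEdge Γ c d m) {N : ℤ} (hN : N ≠ 0) (σ : ℤ) (l : List ℤ) (hl : GoodList m σ l) (τ : ℤ)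
    (hc : (l.map (atom (artinGen Γ c) (artinGen Γ d))).prod *
      atom (artinGen Γ c) (artinGen Γ d) σ ^ N =
      atom (artinGen Γ c) (artinGen Γ d) τ ^ N *
        (l.map (atom (artinGen Γ c) (artinGen Γ d))).prod) :
    ∃ r : ℝ, Cone c d m (headIdx σ l) (r • atomVec m c d τ) := by
  have hp := h.cone_prod σ l hl
  set P := (l.map (atom (artinGen Γ c) (artinGen Γ d))).prod
  obtain ⟨v, r, hr, hv⟩ := (h.act_atom_zpow N hN σ).2
  obtain ⟨r', hr'⟩ := (h.act_atom_zpow N hN τ).1 (act Γ P v)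
  rw [← act_mul, ← hc, act_mul, hv, act_add, add_right_inj, act_smul] at hr'
  refine ⟨r⁻¹ * r', ?_⟩
  rwa [mul_smul, ← hr', smul_smul, inv_mul_cancel₀ hr, one_smul]

lemma conj_atom (h : PosEdge Γ c d m) {N : ℤ} (hN : N ≠ 0) (σ : ℤ) (l : List ℤ) (hl : GoodList m σ l) (τ : ℤ)
    (hc : (l.map (atom (artinGen Γ c) (artinGen Γ d))).prod *
      atom (artinGen Γ c) (artinGen Γ d) σ ^ N =
      atom (artinGen Γ c) (artinGen Γ d) τ ^ N *
        (l.map (atom (artinGen Γ c) (artinGen Γ d))).prod) :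
    (l.map (atom (artinGen Γ c) (artinGen Γ d))).prod * atom (artinGen Γ c) (artinGen Γ d) σ =
      atom (artinGen Γ c) (artinGen Γ d) τ *
        (l.map (atom (artinGen Γ c) (artinGen Γ d))).prod := by
  induction l generalizing τ with
  | nil =>
    have h1 := h.modEq_of_cone (h.cone_of_conj hN σ [] hl τ hc).choose_spec
    simp only [headIdx, sub_add_cancel] at h1
    rw [periodic_of_modEq (atom_add h.rel) h1]
    simp
  | cons i l ih =>
    have h1 := h.modEq_of_cone (h.cone_of_conj hN σ (i :: l) hl τ hc).choose_spec
    have h2 := atom_mul_atom (artinGen Γ c) (artinGen Γ d) i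
    rw [headIdx] at h1
    rw [← periodic_of_modEq (atom_add h.rel) h1] at h2
    have h3 : atom (artinGen Γ c) (artinGen Γ d) τ = (artinGen Γ d * artinGen Γ c) *
        atom (artinGen Γ c) (artinGen Γ d) (τ - 2) * (artinGen Γ d * artinGen Γ c)⁻¹ := by
      rw [← atom_add_two, sub_add_cancel]
    simp only [List.map_cons, List.prod_cons] at hc ⊢
    set R := (l.map (atom (artinGen Γ c) (artinGen Γ d))).prod
    set T := atom (artinGen Γ c) (artinGen Γ d) τ
    generalize hD : artinGen Γ d * artinGen Γ c = D at h2 h3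
    set A := atom (artinGen Γ c) (artinGen Γ d) i
    rw [← mul_right_inj T, ← mul_assoc, ← mul_assoc, h2, ← mul_assoc, ← mul_assoc,
      (Commute.refl T).zpow_right N |>.eq, mul_assoc _ T A, h2, h3, conj_zpow,
      inv_mul_cancel_right, mul_assoc, mul_assoc, mul_right_inj] at hc
    rw [← mul_right_inj T, ← mul_assoc, ← mul_assoc, h2, mul_assoc, ih hl.2 _ hc, ← mul_assoc,
      ← mul_assoc, h3, inv_mul_cancel_right]

/-- In a dihedral Artin group, conjugate powers of generators come from conjugate generators. -/
lemma conj_of_conj_zpow (h : PosEdge Γ c d m) {w : ArtinGroup Γ}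
    (hw : w ∈ Subgroup.closure {artinGen Γ c, artinGen Γ d}) {s t : V} (hs : s = c ∨ s = d)
    (ht : t = c ∨ t = d) {N : ℤ} (hN : N ≠ 0)
    (hc : w * artinGen Γ t ^ N * w⁻¹ = artinGen Γ s ^ N) :
    w * artinGen Γ t * w⁻¹ = artinGen Γ s := by
  have key : ∀ t, t = c ∨ t = d → ∃ i, artinGen Γ t = atom (artinGen Γ c) (artinGen Γ d) i := by
    rintro t (rfl | rfl)
    · exact ⟨0, (atom_zero _ _).symm⟩
    · exact ⟨1, (atom_one _ _).symm⟩
  obtain ⟨τ, hτ⟩ := key s hs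
  obtain ⟨σ, hσ⟩ := key t ht
  obtain ⟨j, l, k, hl, rfl⟩ := exists_goodList h.rel σ hw
  rw [hτ, hσ] at hc ⊢
  have hj := delta_zpow_mul_atom (artinGen Γ c) (artinGen Γ d) (τ - 2 * j) j
  rw [sub_add_cancel] at hj
  set D := (artinGen Γ d * artinGen Γ c) ^ j
  have h3 : atom (artinGen Γ c) (artinGen Γ d) τ =
      D * atom (artinGen Γ c) (artinGen Γ d) (τ - 2 * j) * D⁻¹ := by
    rw [hj, mul_inv_cancel_right]
  have hck : ∀ n : ℤ, D * (l.map (atom (artinGen Γ c) (artinGen Γ d))).prod *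
      atom (artinGen Γ c) (artinGen Γ d) σ ^ k * atom (artinGen Γ c) (artinGen Γ d) σ ^ n *
      (D * (l.map (atom (artinGen Γ c) (artinGen Γ d))).prod *
      atom (artinGen Γ c) (artinGen Γ d) σ ^ k)⁻¹ =
      atom (artinGen Γ c) (artinGen Γ d) τ ^ n ↔
      (l.map (atom (artinGen Γ c) (artinGen Γ d))).prod *
      atom (artinGen Γ c) (artinGen Γ d) σ ^ n =
      atom (artinGen Γ c) (artinGen Γ d) (τ - 2 * j) ^ n *
        (l.map (atom (artinGen Γ c) (artinGen Γ d))).prod := by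
    intro n
    rw [h3, conj_zpow, mul_assoc _ (_ ^ k) (_ ^ n), (Commute.refl _).zpow_zpow k n |>.eq,
      mul_inv_eq_iff_eq_mul]
    simp only [← mul_assoc]
    rw [mul_left_inj, inv_mul_cancel_right]
    simp only [mul_assoc]
    rw [mul_right_inj]
  have h1 := (hck 1).2 (by
    simpa only [zpow_one] using h.conj_atom hN σ l hl _ ((hck N).1 hc))
  simpa only [zpow_one] using h1

end PosEdge

variable (Γ) in
/-- In a dihedral Artin group, conjugate powers of generators come from conjugate generators. -/
lemma dihedral_conj (h : Γ.graph.Adj c d) {w : ArtinGroup Γ}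
    (hw : w ∈ Subgroup.closure {artinGen Γ c, artinGen Γ d}) {s t : V} (hs : s = c ∨ s = d)
    (ht : t = c ∨ t = d) {N : ℤ} (hN : N ≠ 0)
    (hc : w * artinGen Γ t ^ N * w⁻¹ = artinGen Γ s ^ N) :
    w * artinGen Γ t * w⁻¹ = artinGen Γ s := by
  rcases sgn_cases h.ne with ⟨h1, h2⟩ | ⟨h1, h2⟩
  · have hp : PosEdge Γ c d (Γ.label c d) := ⟨Γ.two_le_label h, h.ne, artin_relation Γ h,
      by rw [form_vec Γ h, h1, one_mul],
      by rw [form_vec Γ h.symm, h2, Γ.label_symm d c, neg_one_mul]⟩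
    exact hp.conj_of_conj_zpow hw hs ht hN hc
  · have hp : PosEdge Γ d c (Γ.label d c) := ⟨Γ.two_le_label h.symm, h.ne.symm,
      artin_relation Γ h.symm, by rw [form_vec Γ h.symm, h2, one_mul],
      by rw [form_vec Γ h, h1, Γ.label_symm d c, neg_one_mul]⟩
    rw [Set.pair_comm] at hw
    exact hp.conj_of_conj_zpow hw hs.symm ht.symm hN hc

end PingPong

section Edge

variable {V : Type*} (Γ : LabeledGraph V)

/-- The standard subgroup of an edge. -/
def edgeSub (e : Sym2 V) : Subgroup (ArtinGroup Γ) :=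
  Subgroup.closure {g | ∃ v ∈ e, artinGen Γ v = g}

/-- The label of an edge. -/
def edgeLabel (e : Sym2 V) : ℕ := Sym2.lift ⟨Γ.label, Γ.label_symm⟩ e

lemma gen_mem_edgeSub {e : Sym2 V} {v : V} (h : v ∈ e) : artinGen Γ v ∈ edgeSub Γ e :=
  Subgroup.subset_closure ⟨v, h, rfl⟩

lemma edgeSub_mk (a b : V) :
    edgeSub Γ s(a, b) = Subgroup.closure {artinGen Γ a, artinGen Γ b} := by
  unfold edgeSub
  congr 1
  ext g
  simp [eq_comm]

lemma two_le_edgeLabel {e : Sym2 V} (he : e ∈ Γ.graph.edgeSet) : 2 ≤ edgeLabel Γ e := by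
  induction e with
  | _ a b => exact Γ.two_le_label he

lemma edge_conj {e : Sym2 V} (he : e ∈ Γ.graph.edgeSet) {w : ArtinGroup Γ} (hw : w ∈ edgeSub Γ e)
    {s t : V} (hs : s ∈ e) (ht : t ∈ e) {N : ℤ} (hN : N ≠ 0)
    (hc : w * artinGen Γ t ^ N * w⁻¹ = artinGen Γ s ^ N) :
    w * artinGen Γ t * w⁻¹ = artinGen Γ s := by
  induction e with
  | _ a b =>
    rw [edgeSub_mk] at hw
    exact dihedral_conj Γ he hw (Sym2.mem_iff.1 hs) (Sym2.mem_iff.1 ht) hN hc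

lemma edge_label_le {e : Sym2 V} (he : e ∈ Γ.graph.edgeSet) {n : ℕ} (hn : 1 ≤ n)
    (dev : ℕ → ArtinGroup Γ) (k : ℕ → ℤ) (c : ℕ → V) (hk : ∀ i, k i ≠ 0)
    (hce : ∀ i, c i ∈ e) (hc : ∀ i, c (i + 1) ≠ c i)
    (hdev : ∀ i, dev (i + 1) = dev i * artinGen Γ (c i) ^ k i)
    (hper : ∀ i, dev (i + n) = dev i) (hkper : ∀ i, k (i + n) = k i)
    (hcper : ∀ i, c (i + n) = c i) : 2 * edgeLabel Γ e ≤ n := by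
  have he2 : e = s(c 0, c 1) := ((Sym2.mem_and_mem_iff (hc 0).symm).1 ⟨hce 0, hce 1⟩)
  have halt : ∀ i, c i = if Even i then c 0 else c 1 := by
    intro i
    induction i with
    | zero => simp
    | succ i ih =>
      have h1 := hce (i + 1)
      rw [he2, Sym2.mem_iff] at h1
      have h2 := hc i
      rw [ih] at h2
      by_cases h3 : Even i
      · rw [if_pos h3] at h2
        rw [if_neg (by simpa [Nat.even_add_one] using h3)]
        exact h1.resolve_left h2
      · rw [if_neg h3] at h2
        rw [if_pos (by simpa [Nat.even_add_one] using h3)]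
        exact h1.resolve_right h2
  have hev : Even n := by
    by_contra hodd
    have h1 := hcper 0
    rw [zero_add, halt n, if_neg hodd] at h1
    exact hc 0 h1
  obtain ⟨r, rfl⟩ := hev
  rw [he2] at he ⊢
  have := label_le_of_alternating Γ (p := c 0) (q := c 1) he (r := r) (by omega) dev k hk
    (fun i => by rw [hdev, ← halt]) (fun i => by rw [two_mul]; exact hper i)
    (fun i => by rw [two_mul]; exact hkper i)
  change 2 * Γ.label (c 0) (c 1) ≤ _
  omega

end Edge

section Holonomy

open Classical in
/-- The total of `j` on the cell of `x`. -/
noncomputable def hol (A : Finset ℕ) (j : ℕ → ℤ) (f : ℕ → ℕ) (x : ℕ) : ℤ :=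
  ∑ z ∈ A with f z = f x, j z

variable {A : Finset ℕ} {j : ℕ → ℤ} {f : ℕ → ℕ} {x y z w : ℕ}

lemma hol_congr (h : f x = f y) : hol A j f x = hol A j f y := by
  unfold hol
  rw [h]

lemma hol_ker_congr {g : ℕ → ℕ} (h : ∀ z ∈ A, f z = f x ↔ g z = g x) :
    hol A j f x = hol A j g x := by
  unfold hol
  congr 1
  ext z
  simp only [Finset.mem_filter]
  constructor
  · rintro ⟨h1, h2⟩
    exact ⟨h1, (h z h1).1 h2⟩
  · rintro ⟨h1, h2⟩
    exact ⟨h1, (h z h1).2 h2⟩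

lemma hol_erase (hx : x ∈ A) :
    hol A j f z = hol (A.erase x) j f z + (open Classical in if f x = f z then j x else 0) := by
  classical
  unfold hol
  rw [Finset.sum_filter, Finset.sum_filter, ← Finset.sum_erase_add _ _ hx]

lemma hol_update_of_not_mem {v : ℤ} (hx : x ∉ A) :
    hol A (Function.update j x v) f z = hol A j f z := by
  classical
  unfold hol
  refine Finset.sum_congr rfl fun w hw => ?_
  rw [Function.update_of_ne]
  rintro rfl
  exact hx (Finset.mem_filter.1 hw).1

lemma hol_fuse (hx : x ∈ A) (hy : y ∈ A) (hxy : x ≠ y) (hf : f x = f y) :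
    hol (A.erase y) (Function.update j x (j x + j y)) f z = hol A j f z := by
  have hxe : x ∈ A.erase y := Finset.mem_erase.2 ⟨hxy, hx⟩
  rw [hol_erase hxe, hol_update_of_not_mem (Finset.notMem_erase _ _), Function.update_self,
    hol_erase hy, hol_erase hxe, hf]
  split_ifs <;> ring

lemma exists_ne_of_hol_ne (hx : x ∈ A)
    (h : hol A j f z ≠ (open Classical in if f x = f z then j x else 0)) :
    ∃ w ∈ A.erase x, f w = f z := by
  classical
  by_contra hcon
  push Not at hcon
  apply h
  rw [hol_erase hx, hol, Finset.sum_eq_zero, zero_add]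
  intro w hw
  rw [Finset.mem_filter] at hw
  exact absurd hw.2 (hcon w hw.1)

open Classical in
lemma hol_relabel (hxy : f x ≠ f y) :
    hol A j (relabel f x y) z =
      if f z = f x ∨ f z = f y then hol A j f x + hol A j f y else hol A j f z := by
  split_ifs with h
  · unfold hol
    rw [Finset.sum_filter, Finset.sum_filter, Finset.sum_filter, ← Finset.sum_add_distrib]
    refine Finset.sum_congr rfl fun w _ => ?_
    simp only [relabel_eq_iff, h, and_true]
    by_cases h1 : f w = f x
    · rw [if_pos (.inr (.inl h1)), if_pos h1, if_neg (by rwa [h1]), add_zero]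
    by_cases h2 : f w = f y
    · rw [if_pos (.inr (.inr h2)), if_pos h2, if_neg h1, zero_add]
    rw [if_neg, if_neg h1, if_neg h2, zero_add]
    rintro (h3 | h3)
    · rw [h3] at h1 h2
      tauto
    · tauto
  · refine hol_ker_congr fun w _ => ?_
    rw [relabel_eq_iff]
    tauto

/-- There is a cell of nonzero holonomy, and a cell of nonzero holonomy is determined by
whether it is good. The cells are the fibres of `cl false` and `cl true`. -/
structure HolOK (A : Finset ℕ) (j : ℕ → ℤ) (cl : Bool → ℕ → ℕ) (Gd : Bool → ℕ → Prop) : Prop where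
  exists_ne : ∃ s, ∃ x ∈ A, hol A j (cl s) x ≠ 0
  unique : ∀ s s', ∀ x ∈ A, ∀ y ∈ A, hol A j (cl s) x ≠ 0 → hol A j (cl s') y ≠ 0 →
    (Gd s x ↔ Gd s' y) → s = s' ∧ cl s x = cl s y

variable {cl : Bool → ℕ → ℕ} {Gd : Bool → ℕ → Prop}

lemma HolOK.congr {j' : ℕ → ℤ} {Gd' : Bool → ℕ → Prop} (h : HolOK A j cl Gd)
    (hj : ∀ s, ∀ x ∈ A, hol A j' (cl s) x = hol A j (cl s) x)
    (hG : ∀ s, ∀ x ∈ A, Gd' s x ↔ Gd s x) : HolOK A j' cl Gd' where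
  exists_ne := by
    obtain ⟨s, x, hx, h1⟩ := h.exists_ne
    exact ⟨s, x, hx, by rwa [hj s x hx]⟩
  unique s s' x hx y hy h1 h2 h3 := by
    rw [hj _ _ hx] at h1
    rw [hj _ _ hy] at h2
    rw [hG _ _ hx, hG _ _ hy] at h3
    exact h.unique s s' x hx y hy h1 h2 h3

lemma HolOK.merge (h : HolOK A j cl Gd) (hx : x ∈ A) (hy : y ∈ A) (s₀ : Bool)
    (hGd : ∀ s, ∀ z ∈ A, ∀ w ∈ A, cl s z = cl s w → (Gd s z ↔ Gd s w))
    (hxy : Gd s₀ x ↔ Gd s₀ y) :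
    HolOK A j (Function.update cl s₀ (relabel (cl s₀) x y)) Gd := by
  classical
  by_cases hf : cl s₀ x = cl s₀ y
  · rwa [relabel_eq_self hf, Function.update_eq_self]
  have hzero : hol A j (cl s₀) x = 0 ∨ hol A j (cl s₀) y = 0 := by
    by_contra hcon
    push Not at hcon
    exact hf (h.unique s₀ s₀ x hx y hy hcon.1 hcon.2 hxy).2
  have key : ∀ s, ∀ z ∈ A, hol A j (Function.update cl s₀ (relabel (cl s₀) x y) s) z ≠ 0 →
      ∃ w ∈ A, hol A j (cl s) w ≠ 0 ∧ (Gd s w ↔ Gd s z) ∧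
        Function.update cl s₀ (relabel (cl s₀) x y) s w =
          Function.update cl s₀ (relabel (cl s₀) x y) s z := by
    intro s z hz h1
    by_cases hs : s = s₀
    · subst hs
      rw [Function.update_self] at h1 ⊢
      rw [hol_relabel hf] at h1
      split_ifs at h1 with h2
      · have hG : Gd s x ↔ Gd s z := by
          rcases h2 with h2 | h2
          · exact hGd s x hx z hz h2.symm
          · exact hxy.trans (hGd s y hy z hz h2.symm)
        rcases hzero with h3 | h3
        · rw [h3, zero_add] at h1
          exact ⟨y, hy, h1, hxy.symm.trans hG, relabel_eq_iff.2 (.inr ⟨.inr rfl, h2⟩)⟩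
        · rw [h3, add_zero] at h1
          exact ⟨x, hx, h1, hG, relabel_eq_iff.2 (.inr ⟨.inl rfl, h2⟩)⟩
      · exact ⟨z, hz, h1, Iff.rfl, rfl⟩
    · rw [Function.update_of_ne hs] at h1 ⊢
      exact ⟨z, hz, h1, Iff.rfl, rfl⟩
  refine ⟨?_, ?_⟩
  · obtain ⟨s, z, hz, h1⟩ := h.exists_ne
    by_cases hs : s = s₀
    · subst hs
      by_cases h2 : cl s z = cl s x ∨ cl s z = cl s y
      · refine ⟨s, z, hz, ?_⟩
        rw [Function.update_self, hol_relabel hf, if_pos h2]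
        rcases h2 with h2 | h2
        · rw [hol_congr h2] at h1
          rwa [hzero.resolve_left h1, add_zero]
        · rw [hol_congr h2] at h1
          rwa [hzero.resolve_right h1, zero_add]
      · refine ⟨s, z, hz, ?_⟩
        rwa [Function.update_self, hol_relabel hf, if_neg h2]
    · exact ⟨s, z, hz, by rwa [Function.update_of_ne hs]⟩
  · intro s s' z hz w hw h1 h2 h3
    obtain ⟨z', hz', h4, h5, h6⟩ := key s z hz h1
    obtain ⟨w', hw', h7, h8, h9⟩ := key s' w hw h2
    obtain ⟨rfl, h10⟩ := h.unique s s' z' hz' w' hw' h4 h7 (h5.trans (h3.trans h8.symm))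
    refine ⟨rfl, h6.symm.trans (Eq.trans ?_ h9)⟩
    by_cases hs : s = s₀
    · subst hs
      rw [Function.update_self]
      exact relabel_eq_iff.2 (.inl h10)
    · rwa [Function.update_of_ne hs]

lemma HolOK.fuse (h : HolOK A j cl Gd) (hx : x ∈ A) (hy : y ∈ A) (hne : x ≠ y)
    (hxy : ∀ s, cl s x = cl s y) :
    HolOK (A.erase y) (Function.update j x (j x + j y)) cl Gd where
  exists_ne := by
    obtain ⟨s, z, hz, h1⟩ := h.exists_ne
    by_cases hzy : z = y
    · subst hzy
      refine ⟨s, x, Finset.mem_erase.2 ⟨hne, hx⟩, ?_⟩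
      rwa [hol_fuse hx hy hne (hxy s), hol_congr (hxy s)]
    · refine ⟨s, z, Finset.mem_erase.2 ⟨hzy, hz⟩, ?_⟩
      rwa [hol_fuse hx hy hne (hxy s)]
  unique s s' z hz w hw h1 h2 h3 := by
    rw [hol_fuse hx hy hne (hxy _)] at h1 h2
    exact h.unique s s' z (Finset.mem_of_mem_erase hz) w (Finset.mem_of_mem_erase hw) h1 h2 h3

lemma HolOK.drop_zero (h : HolOK A j cl Gd) (hx : x ∈ A) (hj : j x = 0) :
    HolOK (A.erase x) j cl Gd where
  exists_ne := by
    obtain ⟨s, z, hz, h1⟩ := h.exists_ne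
    obtain ⟨w, hw, h2⟩ := exists_ne_of_hol_ne (z := z) (f := cl s) (j := j) hx
      (by rw [hj, ite_self]; exact h1)
    refine ⟨s, w, hw, ?_⟩
    rwa [hol_erase hx, hj, ite_self, add_zero, ← hol_congr h2] at h1
  unique s s' z hz w hw h1 h2 h3 := by
    refine h.unique s s' z (Finset.mem_of_mem_erase hz) w (Finset.mem_of_mem_erase hw) ?_ ?_ h3
    · rwa [hol_erase hx, hj, ite_self, add_zero]
    · rwa [hol_erase hx, hj, ite_self, add_zero]

lemma HolOK.drop_single (h : HolOK A j cl Gd) (hx : x ∈ A) (s₀ : Bool)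
    (hs₀ : ∀ z ∈ A, cl s₀ z = cl s₀ x → z = x)
    (hGd : ∀ s, ∀ z ∈ A, ∀ w ∈ A, cl s z = cl s w → (Gd s z ↔ Gd s w))
    (hG : j x ≠ 0 → (Gd s₀ x ↔ Gd (!s₀) x)) :
    HolOK (A.erase x) j cl Gd := by
  classical
  by_cases hj : j x = 0
  · exact h.drop_zero hx hj
  have hGx := hG hj
  have hx0 : hol A j (cl s₀) x ≠ 0 := by
    by_contra hcon
    obtain ⟨w, hw, h2⟩ := exists_ne_of_hol_ne (z := x) (f := cl s₀) (j := j) hx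
      (by rw [hcon, if_pos rfl]; exact Ne.symm hj)
    exact (Finset.mem_erase.1 hw).1 (hs₀ w (Finset.mem_of_mem_erase hw) h2)
  have hx1 : hol A j (cl (!s₀)) x = 0 := by
    by_contra hcon
    have := (h.unique s₀ (!s₀) x hx x hx hx0 hcon hGx).1
    simp at this
  have hx2 : hol (A.erase x) j (cl (!s₀)) x ≠ 0 := by
    rw [hol_erase hx, if_pos rfl] at hx1
    omega
  have key : ∀ s, ∀ z ∈ A.erase x, hol (A.erase x) j (cl s) z ≠ 0 →
      (s = !s₀ ∧ cl s z = cl s x) ∨ hol A j (cl s) z ≠ 0 := by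
    intro s z hz h1
    by_cases h2 : cl s x = cl s z
    · left
      refine ⟨?_, h2.symm⟩
      rw [Bool.eq_not]
      rintro rfl
      exact (Finset.mem_erase.1 hz).1 (hs₀ z (Finset.mem_of_mem_erase hz) h2.symm)
    · right
      rwa [hol_erase hx, if_neg h2, add_zero]
  have key2 : ∀ s, ∀ z ∈ A.erase x, hol A j (cl s) z ≠ 0 → ¬ (Gd s z ↔ Gd s₀ x) := by
    intro s z hz h1 h2
    obtain ⟨rfl, h3⟩ := h.unique s s₀ z (Finset.mem_of_mem_erase hz) x hx h1 hx0 h2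
    exact (Finset.mem_erase.1 hz).1 (hs₀ z (Finset.mem_of_mem_erase hz) h3)
  have key3 : ∀ z ∈ A.erase x, cl (!s₀) z = cl (!s₀) x → (Gd (!s₀) z ↔ Gd s₀ x) := by
    intro z hz h1
    exact (hGd _ z (Finset.mem_of_mem_erase hz) x hx h1).trans hGx.symm
  refine ⟨?_, ?_⟩
  · obtain ⟨w, hw, h2⟩ := exists_ne_of_hol_ne (z := x) (f := cl (!s₀)) (j := j) hx
      (by rw [hx1, if_pos rfl]; exact Ne.symm hj)
    exact ⟨!s₀, w, hw, by rwa [hol_congr h2]⟩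
  · intro s s' z hz w hw h1 h2 h3
    rcases key s z hz h1 with ⟨rfl, h4⟩ | h4
    · rcases key s' w hw h2 with ⟨rfl, h5⟩ | h5
      · exact ⟨rfl, h4.trans h5.symm⟩
      · exact absurd (h3.symm.trans (key3 z hz h4)) (key2 s' w hw h5)
    · rcases key s' w hw h2 with ⟨rfl, h5⟩ | h5
      · exact absurd (h3.trans (key3 w hw h5)) (key2 s z hz h4)
      · exact h.unique s s' z (Finset.mem_of_mem_erase hz) w (Finset.mem_of_mem_erase hw) h4 h5 h3

end Holonomy

/-- A diagram over an Artin group: each dart `x` runs from `dev x` and reads `c x ^ k x`, up to a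
translation counted by `j`; each face cell is an edge cell or free. -/
structure Diagram {V : Type*} (Γ : LabeledGraph V) extends HMap where
  c : ℕ → V
  k : ℕ → ℤ
  j : ℕ → ℤ
  dev : ℕ → ArtinGroup Γ
  ty : ℕ → Option (Sym2 V)
  pot : ℕ → FreeGroup V

namespace Diagram

variable {V : Type*} {Γ : LabeledGraph V}

/-- The cells of a diagram: face cells and vertex cells. -/
def cell (D : Diagram Γ) : Bool → ℕ → ℕ := fun s => if s then D.P else D.F

/-- The cell of `x` contains a generator of the given conjugate cyclic group. -/
def Good (b : V) (D : Diagram Γ) : Bool → ℕ → Prop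
  | true, x => D.dev x * artinGen Γ (D.c x) * (D.dev x)⁻¹ = artinGen Γ b
  | false, x => ∃ e, D.ty x = some e ∧ ∃ u ∈ edgeSub Γ e, ∃ s ∈ e,
      (D.dev x * u) * artinGen Γ s * (D.dev x * u)⁻¹ = artinGen Γ b

/-- The conditions on a diagram. -/
structure Valid (b : V) (n : ℤ) (D : Diagram Γ) : Prop where
  wf : D.toHMap.Wf
  planar : D.toHMap.Planar
  step : ∀ x ∈ D.A, D.dev (D.φ x) = artinGen Γ b ^ (n * D.j x) * D.dev x * artinGen Γ (D.c x) ^ D.k x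
  corner : ∀ x ∈ D.A, D.dev (D.φ (D.π x)) = D.dev x
  letter : ∀ z ∈ D.A, ∀ w ∈ D.A, D.P z = D.P w → D.c z = D.c w
  type : ∀ z ∈ D.A, ∀ w ∈ D.A, D.F z = D.F w → D.ty z = D.ty w
  edge : ∀ x ∈ D.A, ∀ e, D.ty x = some e → e ∈ Γ.graph.edgeSet ∧ D.c x ∈ e
  good : ∀ s, ∀ z ∈ D.A, ∀ w ∈ D.A, D.cell s z = D.cell s w → (D.Good b s z ↔ D.Good b s w)
  hol : HolOK D.A D.j D.cell (D.Good b)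
  free_cycle : ∀ z ∈ D.A, ∀ w ∈ D.A, D.ty z = none → D.ty w = none → SameCycle D.φ z w
  free_hol : ∀ x ∈ D.A, D.ty x = none → ArtinDiagram.hol D.A D.j D.F x = 0
  free_pot : ∀ x ∈ D.A, D.ty x = none → D.pot (D.φ x) = D.pot x * FreeGroup.of (D.c x) ^ D.k x

variable {b : V} {n : ℤ} {D : Diagram Γ}

lemma Valid.face_mem (h : D.Valid b n) {x : ℕ} (hx : x ∈ D.A) : D.φ x ∈ D.A :=
  (h.wf.suppφ.mem_iff x).2 hx

lemma Valid.vert_mem (h : D.Valid b n) {x : ℕ} (hx : x ∈ D.A) : D.π x ∈ D.A :=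
  (h.wf.suppπ.mem_iff x).2 hx

/-- Delete a dart. -/
def drop (D : Diagram Γ) (x : ℕ) : Diagram Γ := { D with toHMap := D.toHMap.drop x }

lemma Valid.drop (h : D.Valid b n) {x : ℕ} (hx : x ∈ D.A) (hdev : D.dev (D.φ x) = D.dev x)
    (hfree : D.ty x = none → D.pot (D.φ x) = D.pot x ∧ D.j x = 0)
    (hpl : (D.toHMap.drop x).Planar) (hhol : HolOK (D.A.erase x) D.j D.cell (D.Good b)) :
    (D.drop x).Valid b n := by
  have hne : ∀ {z}, z ∈ D.A.erase x → z ≠ x := fun hz => (Finset.mem_erase.1 hz).1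
  have hmem : ∀ {z}, z ∈ D.A.erase x → z ∈ D.A := fun hz => Finset.mem_of_mem_erase hz
  have hφ : ∀ z ≠ x, D.dev (iso x D.φ z) = D.dev (D.φ z) := by
    intro z hz
    rw [iso_apply_of_ne hz]
    split_ifs with h1
    · rw [hdev, h1]
    · rfl
  have wf' := h.wf.drop x
  refine ⟨wf', hpl, ?_, ?_, ?_, ?_, ?_, ?_, hhol, ?_, ?_, ?_⟩
  · intro z hz
    exact (hφ z (hne hz)).trans (h.step z (hmem hz))
  · intro z hz
    have h1 : iso x D.π z ∈ D.A.erase x := (wf'.suppπ.mem_iff z).2 hz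
    refine (hφ _ (hne h1)).trans ?_
    rw [iso_apply_of_ne (hne hz)]
    split_ifs with h2
    · have h3 := h.corner z (hmem hz)
      rw [h2, hdev] at h3
      rw [h.corner x hx, h3]
      rfl
    · exact h.corner z (hmem hz)
  · exact fun z hz w hw => h.letter z (hmem hz) w (hmem hw)
  · exact fun z hz w hw => h.type z (hmem hz) w (hmem hw)
  · exact fun z hz => h.edge z (hmem hz)
  · exact fun s z hz w hw => h.good s z (hmem hz) w (hmem hw)
  · intro z hz w hw h1 h2
    exact (sameCycle_iso_iff h.wf.suppφ (hne hz) (hne hw)).2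
      (h.free_cycle z (hmem hz) w (hmem hw) h1 h2)
  · intro z hz h1
    have h2 := h.free_hol z (hmem hz) h1
    rw [hol_erase hx] at h2
    split_ifs at h2 with h3
    · rw [(hfree ((h.type x hx z (hmem hz) h3).trans h1)).2, add_zero] at h2
      exact h2
    · rwa [add_zero] at h2
  · intro z hz h1
    change D.pot (iso x D.φ z) = _
    rw [iso_apply_of_ne (hne hz)]
    split_ifs with h2
    · have h3 : D.ty x = none := by
        rw [← h2, h.type _ (h.face_mem (hmem hz)) z (hmem hz) (h.wf.face z)]
        exact h1
      rw [(hfree h3).1, ← h2]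
      exact h.free_pot z (hmem hz) h1
    · exact h.free_pot z (hmem hz) h1

/-- Translate the starting points of darts. -/
def gauge (b : V) (n : ℤ) (D : Diagram Γ) (f : ℕ → ℤ) : Diagram Γ :=
  { D with
    dev := fun x => artinGen Γ b ^ (-(n * f x)) * D.dev x
    j := fun x => D.j x - f (D.φ x) + f x }

lemma zpow_mul_conj_eq_iff {G : Type*} [Group G] {B g s : G} (m : ℤ) :
    (B ^ m * g) * s * (B ^ m * g)⁻¹ = B ↔ g * s * g⁻¹ = B := by
  rw [mul_inv_rev, show B ^ m * g * s * (g⁻¹ * (B ^ m)⁻¹) = B ^ m * (g * s * g⁻¹) * (B ^ m)⁻¹ by group,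
    mul_inv_eq_iff_eq_mul, ← zpow_one_add, add_comm, zpow_add_one, mul_right_inj]

lemma good_gauge (f : ℕ → ℤ) (s : Bool) (x : ℕ) : (D.gauge b n f).Good b s x ↔ D.Good b s x := by
  cases s
  · simp only [Good, gauge]
    refine exists_congr fun e => and_congr_right fun _ => exists_congr fun u =>
      and_congr_right fun _ => exists_congr fun s => and_congr_right fun _ => ?_
    rw [mul_assoc (_ ^ _) (D.dev x), zpow_mul_conj_eq_iff]
  · exact zpow_mul_conj_eq_iff _

lemma sum_filter_perm {A : Finset ℕ} {g : Perm ℕ} (hg : SuppIn A g) {F : ℕ → ℕ}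
    (hF : ∀ x, F (g x) = F x) (f : ℕ → ℤ) (v : ℕ) :
    (∑ z ∈ A with F z = v, f (g z)) = ∑ z ∈ A with F z = v, f z := by
  refine Finset.sum_nbij' (fun z => g z) (fun z => g⁻¹ z) ?_ ?_ ?_ ?_ ?_
  · intro z hz
    simp only [Finset.mem_filter] at hz ⊢
    rwa [hg.mem_iff, hF]
  · intro z hz
    simp only [Finset.mem_filter] at hz ⊢
    rw [hg.inv.mem_iff]
    refine ⟨hz.1, ?_⟩
    rw [← hF, show g (g⁻¹ z) = z from g.apply_symm_apply z]
    exact hz.2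
  · intro z _
    exact g.symm_apply_apply z
  · intro z _
    exact g.apply_symm_apply z
  · intro z _
    rfl

lemma hol_gauge (h : D.Valid b n) {f : ℕ → ℤ} (hf : ∀ x, f (D.φ (D.π x)) = f x) (s : Bool) (x : ℕ) :
    hol D.A (D.gauge b n f).j (D.cell s) x = hol D.A D.j (D.cell s) x := by
  unfold hol
  rw [show (D.gauge b n f).j = fun x => D.j x - f (D.φ x) + f x from rfl, Finset.sum_add_distrib,
    Finset.sum_sub_distrib]
  have : (∑ z ∈ D.A with D.cell s z = D.cell s x, f (D.φ z)) =
      ∑ z ∈ D.A with D.cell s z = D.cell s x, f z := by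
    cases s
    · exact sum_filter_perm h.wf.suppφ h.wf.face f (D.F x)
    · have h1 := sum_filter_perm h.wf.suppπ h.wf.vert (fun z => f (D.φ z)) (D.P x)
      simp only [hf] at h1
      exact h1.symm
  convert sub_add_cancel _ _ using 2
  convert this.symm

lemma Valid.gauge (h : D.Valid b n) {f : ℕ → ℤ} (hf : ∀ x, f (D.φ (D.π x)) = f x) :
    (D.gauge b n f).Valid b n := by
  refine ⟨h.wf, h.planar, ?_, ?_, h.letter, h.type, h.edge, ?_, ?_, h.free_cycle, ?_, h.free_pot⟩
  · intro x hx
    change artinGen Γ b ^ (-(n * f (D.φ x))) * D.dev (D.φ x) =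
      artinGen Γ b ^ (n * (D.j x - f (D.φ x) + f x)) * (artinGen Γ b ^ (-(n * f x)) * D.dev x) * _
    rw [h.step x hx, ← mul_assoc, ← mul_assoc, ← mul_assoc, ← zpow_add, ← zpow_add,
      show -(n * f (D.φ x)) + n * D.j x =
        n * (D.j x - f (D.φ x) + f x) + -(n * f x) by ring]
    rfl
  · intro x hx
    change artinGen Γ b ^ (-(n * f (D.φ (D.π x)))) * D.dev (D.φ (D.π x)) = _ * D.dev x
    rw [hf, h.corner x hx]
  · intro s z hz w hw h1
    rw [good_gauge, good_gauge]
    exact h.good s z hz w hw h1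
  · exact h.hol.congr (fun s x _ => hol_gauge h hf s x) fun s x _ => good_gauge f s x
  · intro x hx h1
    exact (hol_gauge h hf false x).trans (h.free_hol x hx h1)

/-- A dart of exponent zero that is not a loop can be removed. -/
lemma Valid.exists_of_exponent_zero (h : D.Valid b n) (hn : n ≠ 0) {x : ℕ} (hx : x ∈ D.A)
    (hk : D.k x = 0) (hφ : D.φ x ≠ x) : ∃ D' : Diagram Γ, D'.Valid b n ∧ D'.A.card < D.A.card := by
  classical
  let ν := D.φ * D.π
  let f : ℕ → ℤ := fun z => if SameCycle ν (D.φ x) z then D.j x else 0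
  have hf : ∀ z, f (D.φ (D.π z)) = f z := by
    intro z
    have : SameCycle ν (D.φ x) (D.φ (D.π z)) ↔ SameCycle ν (D.φ x) z :=
      sameCycle_apply_right (f := ν)
    simp only [f, this]
  have hj : D.j x - f (D.φ x) + f x = 0 := by
    simp only [f, if_pos (SameCycle.refl ν (D.φ x))]
    split_ifs with h1
    · have hν : SuppIn D.A ν := h.wf.suppφ.mul h.wf.suppπ
      have h2 := (hν.periodic.rel_of_sameCycle
        (R := fun z w => z ∈ D.A → w ∈ D.A ∧ D.dev z = D.dev w) (fun _ hu => ⟨hu, rfl⟩)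
        (fun u v w huv hvw hu => ⟨(hvw (huv hu).1).1, (huv hu).2.trans (hvw (huv hu).1).2⟩)
        (fun z hz => ⟨(hν.mem_iff z).2 hz, (h.corner z hz).symm⟩) h1 (h.face_mem hx)).2
      have h3 := h.step x hx
      rw [hk, zpow_zero, mul_one, h2, right_eq_mul] at h3
      have h4 := (mul_eq_zero.1 (gen_zpow_eq_one Γ h3)).resolve_left hn
      omega
    · omega
  have hv := h.gauge hf
  refine ⟨(D.gauge b n f).drop x, ?_, Finset.card_erase_lt_of_mem hx⟩
  have h3 := hv.step x hx
  rw [show (D.gauge b n f).j x = 0 from hj, show (D.gauge b n f).k x = 0 from hk, mul_zero, zpow_zero,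
    zpow_zero, one_mul, mul_one] at h3
  refine hv.drop hx h3 (fun h4 => ⟨?_, hj⟩) (HMap.Planar.drop_of_ne hv.wf hv.planar hx hφ)
    (hv.hol.drop_zero hx hj)
  rw [hv.free_pot x hx h4, show (D.gauge b n f).k x = 0 from hk, zpow_zero, mul_one]

end Diagram

namespace Diagram

variable {V : Type*} {Γ : LabeledGraph V} {b : V} {n : ℤ} {D : Diagram Γ} {x y : ℕ}

/-- Fuse the dart `y = φ x` into `x`. -/
noncomputable def fuseP (D : Diagram Γ) (x y : ℕ) : Diagram Γ :=
  { D with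
    toHMap := D.toHMap.fuseP x y
    k := Function.update D.k x (D.k x + D.k y)
    j := Function.update D.j x (D.j x + D.j y) }

/-- Fuse the dart `y = π⁻¹ x` into `x`. -/
noncomputable def fuseF (D : Diagram Γ) (x y : ℕ) : Diagram Γ :=
  { D with
    toHMap := D.toHMap.fuseF x y
    k := Function.update D.k x (D.k x + D.k y)
    j := Function.update D.j x (D.j x + D.j y) }

lemma cell_fuseP : (D.fuseP x y).cell = Function.update D.cell true (relabel (D.cell true) x y) := by
  ext s z
  cases s <;> rfl

lemma cell_fuseF : (D.fuseF x y).cell = Function.update D.cell false (relabel (D.cell false) x y) := by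
  ext s z
  cases s <;> rfl

lemma good_fuse_cell {s₀ : Bool} {A : Finset ℕ} {cl : Bool → ℕ → ℕ} {Gd : Bool → ℕ → Prop}
    (hx : x ∈ A) (hy : y ∈ A)
    (hG : ∀ s, ∀ z ∈ A, ∀ w ∈ A, cl s z = cl s w → (Gd s z ↔ Gd s w)) (hxy : Gd s₀ x ↔ Gd s₀ y)
    (s : Bool) (z : ℕ) (hz : z ∈ A) (w : ℕ) (hw : w ∈ A)
    (h : Function.update cl s₀ (relabel (cl s₀) x y) s z =
      Function.update cl s₀ (relabel (cl s₀) x y) s w) : Gd s z ↔ Gd s w := by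
  by_cases hs : s = s₀
  · subst hs
    rw [Function.update_self, relabel_eq_iff] at h
    have key : ∀ u ∈ A, (cl s u = cl s x ∨ cl s u = cl s y) → (Gd s u ↔ Gd s x) := by
      rintro u hu (h1 | h1)
      · exact hG s u hu x hx h1
      · exact (hG s u hu y hy h1).trans hxy.symm
    rcases h with h | ⟨h1, h2⟩
    · exact hG s z hz w hw h
    · exact (key z hz h1).trans (key w hw h2).symm
  · rw [Function.update_of_ne hs] at h
    exact hG s z hz w hw h

lemma relabel_const {A : Finset ℕ} {f : ℕ → ℕ} {T : Type*} {g : ℕ → T}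
    (hx : x ∈ A) (hy : y ∈ A) (hG : ∀ z ∈ A, ∀ w ∈ A, f z = f w → g z = g w) (hxy : g x = g y)
    (z : ℕ) (hz : z ∈ A) (w : ℕ) (hw : w ∈ A) (h : relabel f x y z = relabel f x y w) : g z = g w := by
  have key : ∀ u ∈ A, (f u = f x ∨ f u = f y) → g u = g x := by
    rintro u hu (h1 | h1)
    · exact hG u hu x hx h1
    · exact (hG u hu y hy h1).trans hxy.symm
  rcases relabel_eq_iff.1 h with h | ⟨h1, h2⟩
  · exact hG z hz w hw h
  · exact (key z hz h1).trans (key w hw h2).symm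

lemma Valid.good_vert_face (h : D.Valid b n) (hx : x ∈ D.A) (hc : D.c x = D.c (D.φ x)) :
    D.Good b true x ↔ D.Good b true (D.φ x) := by
  simp only [Good]
  rw [h.step x hx, ← hc, mul_assoc (_ ^ _) (D.dev x), zpow_mul_conj_eq_iff]
  rw [show D.dev x * artinGen Γ (D.c x) ^ D.k x * artinGen Γ (D.c x) *
    (D.dev x * artinGen Γ (D.c x) ^ D.k x)⁻¹ =
      D.dev x * artinGen Γ (D.c x) * (D.dev x)⁻¹ by group]

lemma Valid.good_face_vert (h : D.Valid b n) (hy : y ∈ D.A) (ht : D.ty (D.π y) = D.ty y) :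
    D.Good b false (D.π y) ↔ D.Good b false y := by
  have hx := h.vert_mem hy
  simp only [Good]
  rw [ht, ← h.corner y hy, h.step _ hx]
  refine exists_congr fun e => and_congr_right fun he => ?_
  have hce : D.c (D.π y) ∈ e := (h.edge _ hx e (ht.trans he)).2
  have hg := Subgroup.zpow_mem _ (gen_mem_edgeSub Γ hce) (D.k (D.π y))
  constructor
  · rintro ⟨u, hu, s, hs, h1⟩
    refine ⟨(artinGen Γ (D.c (D.π y)) ^ D.k (D.π y))⁻¹ * u,
      Subgroup.mul_mem _ (Subgroup.inv_mem _ hg) hu, s, hs, ?_⟩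
    rwa [mul_assoc (_ * _) (_ ^ _), mul_inv_cancel_left, mul_assoc (_ ^ _), zpow_mul_conj_eq_iff]
  · rintro ⟨u, hu, s, hs, h1⟩
    refine ⟨(artinGen Γ (D.c (D.π y)) ^ D.k (D.π y)) * u, Subgroup.mul_mem _ hg hu, s, hs, ?_⟩
    rw [mul_assoc (_ ^ _), mul_assoc (_ ^ _), zpow_mul_conj_eq_iff, mul_assoc (D.dev _)] at h1
    exact h1

lemma Valid.fuseP (h : D.Valid b n) (hx : x ∈ D.A) (hy : D.φ x = y) (hxy : x ≠ y)
    (hc : D.c x = D.c y) : (D.fuseP x y).Valid b n := by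
  have hyA : y ∈ D.A := hy ▸ h.face_mem hx
  have hne : ∀ {z}, z ∈ D.A.erase y → z ≠ y := fun hz => (Finset.mem_erase.1 hz).1
  have hmem : ∀ {z}, z ∈ D.A.erase y → z ∈ D.A := fun hz => Finset.mem_of_mem_erase hz
  have wf' := h.wf.fuseP hx hy
  have hG : D.Good b true x ↔ D.Good b true y := hy ▸ h.good_vert_face hx (hy ▸ hc)
  have hφx : iso y D.φ x = D.φ y := by rw [iso_apply_of_ne hxy, if_pos hy]
  have hφ : ∀ z, z ≠ x → z ≠ y → iso y D.φ z = D.φ z := by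
    intro z h1 h2
    rw [iso_apply_of_ne h2, if_neg]
    intro h3
    exact h1 (D.φ.injective (h3.trans hy.symm))
  have hF : D.F x = D.F y := by rw [← hy, h.wf.face]
  refine ⟨wf', HMap.Planar.fuseP h.wf h.planar hx hy hxy, ?_, ?_, ?_, ?_, ?_, ?_, ?_, ?_, ?_, ?_⟩
  · intro z hz
    change D.dev (iso y D.φ z) = artinGen Γ b ^ (n * Function.update D.j x _ z) * D.dev z *
      artinGen Γ (D.c z) ^ Function.update D.k x _ z
    by_cases hzx : z = x
    · subst hzx
      rw [Function.update_self, Function.update_self, hφx, h.step y hyA, ← hy, h.step z hx, hy, ← hc,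
        mul_add, add_comm (n * D.j z), zpow_add, zpow_add]
      simp only [mul_assoc]
    · rw [Function.update_of_ne hzx, Function.update_of_ne hzx, hφ z hzx (hne hz)]
      exact h.step z (hmem hz)
  · intro z hz
    have hzy := hne hz
    change D.dev (iso y D.φ (iso y (swap x y * D.π) z)) = D.dev z
    by_cases h1 : D.π z = x
    · have h2 : (swap x y * D.π) z = y := by rw [Perm.mul_apply, h1, swap_apply_left]
      rw [iso_apply_of_ne hzy, if_pos h2, Perm.mul_apply]
      have h3 : D.dev z = D.dev y := by rw [← h.corner z (hmem hz), h1, hy]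
      by_cases h4 : D.π y = y
      · rw [h4, swap_apply_right, hφx, h3, ← h.corner y hyA, h4]
      · have h5 : D.π y ≠ x := fun h5 => hzy (D.π.injective (h1.trans h5.symm))
        rw [swap_apply_of_ne_of_ne h5 h4, hφ _ h5 h4, h.corner y hyA, h3]
    · have h2 : (swap x y * D.π) z ≠ y := by
        rw [Perm.mul_apply]
        intro h2
        exact h1 ((swap x y).injective (h2.trans (swap_apply_left x y).symm))
      rw [iso_apply_of_ne hzy, if_neg h2]
      by_cases h3 : D.π z = y
      · rw [Perm.mul_apply, h3, swap_apply_right, hφx, ← h3, h.corner z (hmem hz)]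
      · rw [Perm.mul_apply, swap_apply_of_ne_of_ne h1 h3, hφ _ h1 h3, h.corner z (hmem hz)]
  · exact fun z hz w hw => relabel_const hx hyA h.letter hc z (hmem hz) w (hmem hw)
  · exact fun z hz w hw => h.type z (hmem hz) w (hmem hw)
  · exact fun z hz => h.edge z (hmem hz)
  · intro s z hz w hw h1
    rw [cell_fuseP] at h1
    exact good_fuse_cell (Gd := D.Good b) hx hyA h.good hG s z (hmem hz) w (hmem hw) h1
  · rw [cell_fuseP]
    refine (h.hol.merge hx hyA true h.good hG).fuse hx hyA hxy fun s => ?_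
    cases s
    · exact hF
    · exact relabel_eq_iff.2 (.inr ⟨.inl rfl, .inr rfl⟩)
  · intro z hz w hw h1 h2
    exact (sameCycle_iso_iff h.wf.suppφ (hne hz) (hne hw)).2
      (h.free_cycle z (hmem hz) w (hmem hw) h1 h2)
  · intro z hz h1
    exact (hol_fuse hx hyA hxy hF).trans (h.free_hol z (hmem hz) h1)
  · intro z hz h1
    change D.pot (iso y D.φ z) = D.pot z * FreeGroup.of (D.c z) ^ Function.update D.k x _ z
    by_cases hzx : z = x
    · subst hzx
      have h2 : D.ty y = none := by
        rw [h.type y hyA z hx hF.symm]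
        exact h1
      rw [Function.update_self, hφx, h.free_pot y hyA h2, ← hy, h.free_pot z hx h1, hy, ← hc, zpow_add,
        mul_assoc]
    · rw [Function.update_of_ne hzx, hφ z hzx (hne hz)]
      exact h.free_pot z (hmem hz) h1

lemma Valid.fuseF (h : D.Valid b n) (hy : y ∈ D.A) (hx : D.π y = x) (hxy : x ≠ y)
    (ht : D.ty x = D.ty y) (hfree : ∀ z ∈ D.A, D.ty z ≠ none) : (D.fuseF x y).Valid b n := by
  have hxA : x ∈ D.A := hx ▸ h.vert_mem hy
  have hne : ∀ {z}, z ∈ D.A.erase y → z ≠ y := fun hz => (Finset.mem_erase.1 hz).1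
  have hmem : ∀ {z}, z ∈ D.A.erase y → z ∈ D.A := fun hz => Finset.mem_of_mem_erase hz
  have wf' := h.wf.fuseF hy hx
  have hG : D.Good b false x ↔ D.Good b false y := hx ▸ h.good_face_vert hy (hx ▸ ht)
  have hφx : D.dev (D.φ x) = D.dev y := by rw [← hx, h.corner y hy]
  have hdx : D.dev (iso y (D.φ * swap x y) x) = D.dev (D.φ y) := by
    rw [iso_apply_of_ne hxy]
    simp only [Perm.mul_apply, swap_apply_left, swap_apply_right]
    split_ifs with h1
    · rw [hφx, h1]
    · rfl
  have hd : ∀ z, z ≠ x → z ≠ y → D.dev (iso y (D.φ * swap x y) z) = D.dev (D.φ z) := by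
    intro z h1 h2
    rw [iso_apply_of_ne h2]
    simp only [Perm.mul_apply, swap_apply_right, swap_apply_of_ne_of_ne h1 h2]
    split_ifs with h3
    · rw [hφx, h3]
    · rfl
  have hP : D.P x = D.P y := by rw [← hx, h.wf.vert]
  have hc : D.c x = D.c y := h.letter x hxA y hy hP
  refine ⟨wf', HMap.Planar.fuseF h.wf h.planar hy hx hxy, ?_, ?_, ?_, ?_, ?_, ?_, ?_, ?_, ?_, ?_⟩
  · intro z hz
    change D.dev (iso y (D.φ * swap x y) z) = artinGen Γ b ^ (n * Function.update D.j x _ z) * D.dev z *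
      artinGen Γ (D.c z) ^ Function.update D.k x _ z
    by_cases hzx : z = x
    · subst hzx
      rw [Function.update_self, Function.update_self, hdx, h.step y hy, ← hφx, h.step z hxA, ← hc,
        mul_add, add_comm (n * D.j z), zpow_add, zpow_add]
      simp only [mul_assoc]
    · rw [Function.update_of_ne hzx, Function.update_of_ne hzx, hd z hzx (hne hz)]
      exact h.step z (hmem hz)
  · intro z hz
    have hzy := hne hz
    change D.dev (iso y (D.φ * swap x y) (iso y D.π z)) = D.dev z
    rw [iso_apply_of_ne hzy]
    split_ifs with h1
    · rw [hx, hdx, ← h1, h.corner z (hmem hz)]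
    · rw [hd _ (fun h2 => hzy (D.π.injective (h2.trans hx.symm))) h1, h.corner z (hmem hz)]
  · exact fun z hz w hw => h.letter z (hmem hz) w (hmem hw)
  · exact fun z hz w hw => relabel_const hxA hy h.type ht z (hmem hz) w (hmem hw)
  · exact fun z hz => h.edge z (hmem hz)
  · intro s z hz w hw h1
    rw [cell_fuseF] at h1
    exact good_fuse_cell (Gd := D.Good b) hxA hy h.good hG s z (hmem hz) w (hmem hw) h1
  · rw [cell_fuseF]
    refine (h.hol.merge hxA hy false h.good hG).fuse hxA hy hxy fun s => ?_
    cases s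
    · exact relabel_eq_iff.2 (.inr ⟨.inl rfl, .inr rfl⟩)
    · exact hP
  · intro z hz w hw h1 h2
    exact absurd h1 (hfree z (hmem hz))
  · intro z hz h1
    exact absurd h1 (hfree z (hmem hz))
  · intro z hz h1
    exact absurd h1 (hfree z (hmem hz))

lemma Valid.good_iff_of_loop (h : D.Valid b n) (hn : n ≠ 0) (hx : x ∈ D.A)
    (hdev : D.dev (D.φ x) = D.dev x) (ht : D.ty x ≠ none) (hj : D.j x ≠ 0) :
    D.Good b true x ↔ D.Good b false x := by
  obtain ⟨e, he⟩ := Option.ne_none_iff_exists'.1 ht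
  obtain ⟨he1, hce⟩ := h.edge x hx e he
  have h1 := h.step x hx
  rw [hdev] at h1
  have hk : D.k x = -(n * D.j x) := by
    have h2 := congrArg (deg Γ) h1
    rw [map_mul, map_mul, deg_gen_zpow, deg_gen_zpow, mul_right_comm, right_eq_mul, ← ofAdd_add,
      ← ofAdd_zero] at h2
    have := Multiplicative.ofAdd.injective h2
    omega
  have hN : n * D.j x ≠ 0 := mul_ne_zero hn hj
  have h3 : D.dev x * artinGen Γ (D.c x) ^ (n * D.j x) * (D.dev x)⁻¹ = artinGen Γ b ^ (n * D.j x) := by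
    rw [hk, zpow_neg, eq_mul_inv_iff_mul_eq] at h1
    rw [h1, mul_inv_cancel_right]
  simp only [Good]
  constructor
  · intro h4
    exact ⟨e, he, 1, one_mem _, D.c x, hce, by rwa [mul_one]⟩
  · rintro ⟨e', he', u, hu, s, hs, h4⟩
    obtain rfl : e = e' := Option.some.inj (he.symm.trans he')
    have h5 := congrArg (· ^ (n * D.j x)) h4
    simp only [conj_zpow] at h5
    rw [← h3] at h5
    have h6 : u * artinGen Γ s ^ (n * D.j x) * u⁻¹ = artinGen Γ (D.c x) ^ (n * D.j x) := by
      have := congrArg (fun g => (D.dev x)⁻¹ * g * D.dev x) h5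
      simpa only [mul_inv_rev, mul_assoc, inv_mul_cancel_left, inv_mul_cancel, mul_one] using this
    have h7 := edge_conj Γ he1 hu hce hs hN h6
    rw [← h7, ← h4]
    group

/-- A dart which is alone in its face cell or vertex cell can be removed. -/
lemma Valid.exists_of_single (h : D.Valid b n) (hn : n ≠ 0) (hx : x ∈ D.A)
    (hfree : ∀ z ∈ D.A, D.ty z ≠ none) (s : Bool) (hs : ∀ z ∈ D.A, D.cell s z = D.cell s x → z = x) :
    ∃ D' : Diagram Γ, D'.Valid b n ∧ D'.A.card < D.A.card := by
  have hdev : D.dev (D.φ x) = D.dev x := by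
    cases s
    · rw [hs _ (h.face_mem hx) (h.wf.face x)]
    · have := h.corner x hx
      rwa [hs _ (h.vert_mem hx) (h.wf.vert x)] at this
  refine ⟨D.drop x, h.drop hx hdev (fun h1 => absurd h1 (hfree x hx)) ?_ ?_,
    Finset.card_erase_lt_of_mem hx⟩
  · cases s
    · exact HMap.Planar.drop_of_face_eq h.wf h.planar hx hs
    · exact HMap.Planar.drop_of_vert_eq h.wf h.planar hx hs
  · refine h.hol.drop_single hx s hs h.good fun hj => ?_
    have := h.good_iff_of_loop hn hx hdev (hfree x hx) hj
    cases s
    · exact this.symm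
    · exact this

end Diagram

section FreeWord

variable {V : Type*}

lemma of_zpow_eq_mk (v : V) (k : ℤ) :
    FreeGroup.of v ^ k = FreeGroup.mk (List.replicate k.natAbs (v, decide (0 ≤ k))) := by
  have key : ∀ (m : ℕ), FreeGroup.of v ^ m = FreeGroup.mk (List.replicate m (v, true)) := by
    intro m
    induction m with
    | zero => rfl
    | succ m ih =>
      rw [pow_succ', ih, List.replicate_succ]
      rfl
  rcases le_or_gt 0 k with h | h
  · obtain ⟨m, rfl⟩ := Int.eq_ofNat_of_zero_le h
    rw [zpow_natCast, key, Int.natAbs_natCast, decide_eq_true h]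
  · obtain ⟨m, hm⟩ := Int.eq_ofNat_of_zero_le (neg_pos.2 h).le
    obtain rfl : k = -m := by omega
    rw [zpow_neg, zpow_natCast, key, Int.natAbs_neg, Int.natAbs_natCast, decide_eq_false (not_le.2 h),
      FreeGroup.inv_mk]
    simp [FreeGroup.invRev]

/-- A nonempty product of powers with distinct consecutive letters is not trivial. -/
lemma pot_ne {pot : ℕ → FreeGroup V} {c : ℕ → V} {k : ℕ → ℤ} (hk : ∀ i, k i ≠ 0)
    (hc : ∀ i, c (i + 1) ≠ c i) (h : ∀ i, pot (i + 1) = pot i * FreeGroup.of (c i) ^ k i) {r : ℕ}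
    (hr : 0 < r) : pot r ≠ pot 0 := by
  classical
  have key : ∀ i, ∃ L : List (V × Bool), FreeGroup.IsReduced L ∧
      pot (i + 1) = pot 0 * FreeGroup.mk L ∧ ∃ s, L.getLast? = some (c i, s) := by
    have hrep : ∀ i, FreeGroup.IsReduced (List.replicate (k i).natAbs (c i, decide (0 ≤ k i))) :=
      fun i => List.isChain_replicate_of_rel _ fun _ => rfl
    have hlast : ∀ i, (List.replicate (k i).natAbs (c i, decide (0 ≤ k i))).getLast? =
        some (c i, decide (0 ≤ k i)) := by
      intro i
      rw [List.getLast?_replicate, if_neg]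
      simpa using hk i
    intro i
    induction i with
    | zero => exact ⟨_, hrep 0, by rw [h, of_zpow_eq_mk], _, hlast 0⟩
    | succ i ih =>
      obtain ⟨L, h1, h2, s, h3⟩ := ih
      refine ⟨L ++ List.replicate (k (i + 1)).natAbs (c (i + 1), decide (0 ≤ k (i + 1))), ?_, ?_, ?_⟩
      · refine List.IsChain.append h1 (hrep _) ?_
        intro a ha a' ha' haa
        rw [h3, Option.mem_some_iff] at ha
        have h4 := List.eq_of_mem_replicate (List.mem_of_mem_head? ha')
        subst ha
        subst h4
        exact absurd haa.symm (hc i)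
      · rw [h, h2, of_zpow_eq_mk, mul_assoc, FreeGroup.mul_mk]
      · exact ⟨_, by rw [List.getLast?_append, hlast]; rfl⟩
  obtain ⟨i, rfl⟩ := Nat.exists_eq_add_of_le' hr
  obtain ⟨L, h1, h2, s, h3⟩ := key i
  intro h4
  rw [h4, left_eq_mul, FreeGroup.one_eq_mk] at h2
  have h5 := congrArg FreeGroup.toWord h2
  rw [FreeGroup.toWord_mk, FreeGroup.toWord_mk, h1.reduce_eq, FreeGroup.reduce_nil] at h5
  simp [h5] at h3

end FreeWord

section Corner

variable {V : Type*} {Γ : LabeledGraph V}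

open Classical in
/-- The angle sum around a point is at least `2` half turns. -/
lemma corner_bound (h2d : Γ.TwoDimensional) {C : ℕ → V} {E : ℕ → Sym2 V} {r : ℕ} (hr : 1 ≤ r)
    (hC : C r = C 0) (hE : E r = E 0) (h1 : ∀ i, C i ∈ E i) (h2 : ∀ i, C i ∈ E (i + 1))
    (hE' : ∀ i, E i ∈ Γ.graph.edgeSet) :
    (2 : ℚ) ≤ ∑ i ∈ Finset.range r, ((if E (i + 1) = E i then 1 else 0) +
      (if C (i + 1) = C i then 1 else 1 - 1 / (edgeLabel Γ (E (i + 1)) : ℚ))) := by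
  have hm : ∀ i, 1 / (edgeLabel Γ (E i) : ℚ) ≤ 1 / 2 := fun i =>
    one_div_le_one_div_of_le (by norm_num) (by exact_mod_cast two_le_edgeLabel Γ (hE' i))
  have hm0 : ∀ i, 0 ≤ 1 / (edgeLabel Γ (E i) : ℚ) := fun i => by positivity
  have ha : ∀ i, (0 : ℚ) ≤ if E (i + 1) = E i then 1 else 0 := fun i => by split_ifs <;> norm_num
  have hb : ∀ i, (1 / 2 : ℚ) ≤ if C (i + 1) = C i then 1 else 1 - 1 / (edgeLabel Γ (E (i + 1)) : ℚ) :=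
    fun i => by
      split_ifs
      · norm_num
      · linarith [hm (i + 1)]
  have hedge : ∀ i, C (i + 1) ≠ C i → E (i + 1) = s(C i, C (i + 1)) := fun i hi =>
    (Sym2.mem_and_mem_iff hi.symm).1 ⟨h2 i, h1 (i + 1)⟩
  obtain rfl | rfl | rfl | hr4 : r = 1 ∨ r = 2 ∨ r = 3 ∨ 4 ≤ r := by omega
  · simp [hC, hE]
    norm_num
  · simp only [Finset.sum_range_succ, Finset.sum_range_zero, zero_add, Nat.reduceAdd]
    rw [hC, hE]
    by_cases hc : C 1 = C 0
    · have := ha 0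
      have := ha 1
      simp only [zero_add, Nat.reduceAdd, hE] at *
      rw [if_pos hc, if_pos hc.symm]
      linarith
    · have h3 := hedge 0 hc
      have h4 := hedge 1 (by rw [hC]; exact Ne.symm hc)
      simp only [zero_add, Nat.reduceAdd, hC] at h3 h4
      have h5 : E 1 = E 0 := by rw [h3, ← hE, h4, Sym2.eq_swap]
      have := hb 0
      have := hb 1
      simp only [zero_add, Nat.reduceAdd, hC, hE] at *
      rw [if_pos h5, if_pos h5.symm]
      linarith
  · simp only [Finset.sum_range_succ, Finset.sum_range_zero, zero_add, Nat.reduceAdd]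
    have a0 := ha 0
    have a1 := ha 1
    have a2 := ha 2
    have b0 := hb 0
    have b1 := hb 1
    have b2 := hb 2
    simp only [zero_add, Nat.reduceAdd] at *
    by_cases e0 : E 1 = E 0
    · rw [if_pos e0]; linarith
    by_cases e1 : E 2 = E 1
    · rw [if_pos e1]; linarith
    by_cases e2 : E 3 = E 2
    · rw [if_pos e2]; linarith
    by_cases c0 : C 1 = C 0
    · rw [if_pos c0]; linarith
    by_cases c1 : C 2 = C 1
    · rw [if_pos c1]; linarith
    by_cases c2 : C 3 = C 2
    · rw [if_pos c2]; linarith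
    have g0 := hedge 0 c0
    have g1 := hedge 1 c1
    have g2 := hedge 2 c2
    simp only [zero_add, Nat.reduceAdd, hC] at g0 g1 g2 c2
    have t0 := hE' 1
    have t1 := hE' 2
    have t2 := hE' 3
    rw [if_neg e0, if_neg e1, if_neg e2, if_neg c0, if_neg c1, if_neg (hC ▸ c2)]
    rw [g0] at t0 ⊢
    rw [g1] at t1 ⊢
    rw [g2] at t2 ⊢
    have := h2d (C 0) (C 1) (C 2) t0 t1 (SimpleGraph.Adj.symm (G := Γ.graph) t2)
    rw [Γ.label_symm (C 0) (C 2)] at this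
    change (2 : ℚ) ≤ 0 + (1 - 1 / (Γ.label (C 0) (C 1) : ℚ)) + (0 + (1 - 1 / (Γ.label (C 1) (C 2) : ℚ)))
      + (0 + (1 - 1 / (Γ.label (C 2) (C 0) : ℚ)))
    linarith
  · calc (2 : ℚ) ≤ r * (1 / 2) := by
          have : (4 : ℚ) ≤ r := by exact_mod_cast hr4
          linarith
      _ = ∑ i ∈ Finset.range r, (1 / 2 : ℚ) := by simp
      _ ≤ _ := Finset.sum_le_sum fun i _ => by linarith [ha i, hb i]

end Corner

section CycleSums

variable {A : Finset ℕ} {g : Perm ℕ}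

lemma iterate_mem (hg : SuppIn A g) {x : ℕ} (hx : x ∈ A) (i : ℕ) : g^[i] x ∈ A := by
  induction i with
  | zero => exact hx
  | succ i ih =>
    rw [Function.iterate_succ_apply']
    exact (hg.mem_iff _).2 ih

lemma minimalPeriod_pos (hg : SuppIn A g) (x : ℕ) : 0 < Function.minimalPeriod g x := by
  obtain ⟨n, hn, h⟩ := hg.periodic x
  refine Function.IsPeriodicPt.minimalPeriod_pos hn ?_
  rw [← Equiv.Perm.iterate_eq_pow] at h
  exact h

lemma sameCycle_iterate (x : ℕ) (i : ℕ) : SameCycle g x (g^[i] x) :=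
  ⟨i, by rw [zpow_natCast, Equiv.Perm.iterate_eq_pow]⟩

lemma sum_orbit_le {θ : ℕ → ℚ} {x : ℕ} {S : Finset ℕ} (hθ : ∀ z ∈ S, 0 ≤ θ z)
    (hS : ∀ i, g^[i] x ∈ S) :
    ∑ i ∈ Finset.range (Function.minimalPeriod g x), θ (g^[i] x) ≤ ∑ z ∈ S, θ z := by
  classical
  rw [← Finset.sum_image (f := θ) (g := fun i => g^[i] x)]
  · refine Finset.sum_le_sum_of_subset_of_nonneg ?_ fun z hz _ => hθ z hz
    intro z hz
    obtain ⟨i, _, rfl⟩ := Finset.mem_image.1 hz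
    exact hS i
  · intro i hi l hl h
    exact Function.iterate_injOn_Iio_minimalPeriod (by simpa using hi) (by simpa using hl) h

lemma two_mul_cyc_le (hg : SuppIn A g) {θ : ℕ → ℚ} (hθ : ∀ z ∈ A, 0 ≤ θ z)
    (h : ∀ x ∈ A, 2 ≤ ∑ i ∈ Finset.range (Function.minimalPeriod g x), θ (g^[i] x)) :
    2 * (cyc A g : ℚ) ≤ ∑ z ∈ A, θ z := by
  classical
  rw [← Finset.sum_fiberwise_of_maps_to (g := Quotient.mk (SameCycle.setoid g))
    (t := A.image (Quotient.mk (SameCycle.setoid g))) fun z hz => Finset.mem_image_of_mem _ hz]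
  have h1 : (cyc A g : ℚ) = ∑ q ∈ A.image (Quotient.mk (SameCycle.setoid g)), (1 : ℚ) := by
    rw [Finset.sum_const, nsmul_one, cyc]
    congr!
  rw [h1, Finset.mul_sum]
  refine Finset.sum_le_sum fun q hq => ?_
  obtain ⟨x, hx, rfl⟩ := Finset.mem_image.1 hq
  rw [mul_one]
  refine (h x hx).trans (sum_orbit_le (fun z hz => hθ z (Finset.mem_filter.1 hz).1) fun i => ?_)
  exact Finset.mem_filter.2 ⟨iterate_mem hg hx i, mk_eq_iff.2 (sameCycle_iterate x i).symm⟩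

lemma cyc_eq_sum_fiber {F : ℕ → ℕ} (hF : ∀ z w, SameCycle g z w → F z = F w) :
    cyc A g = ∑ v ∈ A.image F, cyc {z ∈ A | F z = v} g := by
  unfold cyc
  let := Classical.decEq (Quotient (SameCycle.setoid g))
  rw [← Finset.card_biUnion]
  · congr 1
    ext q
    simp only [Finset.mem_image, Finset.mem_biUnion, Finset.mem_filter]
    constructor
    · rintro ⟨x, hx, rfl⟩
      exact ⟨F x, ⟨x, hx, rfl⟩, x, ⟨hx, rfl⟩, rfl⟩
    · rintro ⟨_, _, x, ⟨hx, _⟩, rfl⟩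
      exact ⟨x, hx, rfl⟩
  · intro v _ w _ hvw
    rw [Function.onFun, Finset.disjoint_left]
    intro q hq hq'
    obtain ⟨x, hx, rfl⟩ := Finset.mem_image.1 hq
    obtain ⟨y, hy, hxy⟩ := Finset.mem_image.1 hq'
    apply hvw
    rw [← (Finset.mem_filter.1 hx).2, ← (Finset.mem_filter.1 hy).2]
    exact (hF _ _ (mk_eq_iff.1 hxy)).symm

lemma one_le_cyc {x : ℕ} (hx : x ∈ A) : 1 ≤ cyc A g := by
  let := Classical.decEq (Quotient (SameCycle.setoid g))
  exact Finset.card_pos.2 ⟨_, Finset.mem_image_of_mem _ hx⟩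

lemma sameCycle_of_cyc_le_one (h : cyc A g ≤ 1) {x y : ℕ} (hx : x ∈ A) (hy : y ∈ A) :
    SameCycle g x y := by
  let := Classical.decEq (Quotient (SameCycle.setoid g))
  unfold cyc at h
  exact mk_eq_iff.1 (Finset.card_le_one.1 h _ (Finset.mem_image_of_mem _ hx) _
    (Finset.mem_image_of_mem _ hy))

end CycleSums

namespace Diagram

variable {V : Type*} {Γ : LabeledGraph V} {b : V} {n : ℤ} {D : Diagram Γ}

/-- A valid diagram with the least number of darts. -/
structure Minimal (b : V) (n : ℤ) (D : Diagram Γ) : Prop extends D.Valid b n where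
  card_le : ∀ D' : Diagram Γ, D'.Valid b n → D.A.card ≤ D'.A.card

lemma Minimal.exponent_ne (h : D.Minimal b n) (hn : n ≠ 0) {x : ℕ} (hx : x ∈ D.A)
    (hφ : D.φ x ≠ x) : D.k x ≠ 0 := by
  intro hk
  obtain ⟨D', h1, h2⟩ := h.toValid.exists_of_exponent_zero hn hx hk hφ
  exact absurd (h.card_le D' h1) (not_le.2 h2)

lemma Minimal.letter_ne (h : D.Minimal b n) {x : ℕ} (hx : x ∈ D.A) (hφ : D.φ x ≠ x) :
    D.c (D.φ x) ≠ D.c x := by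
  intro hc
  exact absurd (h.card_le _ (h.toValid.fuseP hx rfl hφ.symm hc.symm))
    (not_le.2 (Finset.card_erase_lt_of_mem (h.toValid.face_mem hx)))

lemma iterate_face_mem (h : D.Valid b n) {x : ℕ} (hx : x ∈ D.A) (i : ℕ) : D.φ^[i] x ∈ D.A :=
  iterate_mem h.wf.suppφ hx i

lemma iterate_face (h : D.Valid b n) (x : ℕ) (i : ℕ) : D.F (D.φ^[i] x) = D.F x := by
  induction i with
  | zero => rfl
  | succ i ih => rw [Function.iterate_succ_apply', h.wf.face, ih]

lemma iterate_apply_ne {x : ℕ} (hφ : D.φ x ≠ x) (i : ℕ) : D.φ (D.φ^[i] x) ≠ D.φ^[i] x := by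
  rw [← Function.iterate_succ_apply' D.φ, Function.iterate_succ_apply]
  exact (D.φ.injective.iterate i).ne hφ

lemma Minimal.not_free (h : D.Minimal b n) (hn : n ≠ 0) {x : ℕ} (hx : x ∈ D.A) :
    D.ty x ≠ none := by
  intro hty
  have hv := h.toValid
  by_cases hφ : D.φ x = x
  · have hcell : ∀ z ∈ D.A, D.F z = D.F x → z = x := fun z hz hzx =>
      (sameCycle_fixed_iff hφ).1 (hv.free_cycle z hz x hx ((hv.type z hz x hx hzx).trans hty) hty)
    have hj : D.j x = 0 := by
      have h1 := hv.free_hol x hx hty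
      have h2 : D.A.filter (fun z => D.F z = D.F x) = {x} := by
        ext z
        simp only [Finset.mem_filter, Finset.mem_singleton]
        refine ⟨fun hz => hcell z hz.1 hz.2, ?_⟩
        rintro rfl
        exact ⟨hx, rfl⟩
      rwa [hol, h2, Finset.sum_singleton] at h1
    exact absurd (h.card_le _ (hv.drop hx (by rw [hφ]) (fun _ => ⟨by rw [hφ], hj⟩)
      (hv.planar.drop_of_face_eq hv.wf hx hcell) (hv.hol.drop_zero hx hj)))
      (not_le.2 (Finset.card_erase_lt_of_mem hx))
  · have hmem := iterate_face_mem hv hx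
    have hty' : ∀ i, D.ty (D.φ^[i] x) = none := fun i =>
      (hv.type _ (hmem i) x hx (iterate_face hv x i)).trans hty
    refine pot_ne (pot := fun i => D.pot (D.φ^[i] x)) (c := fun i => D.c (D.φ^[i] x))
      (k := fun i => D.k (D.φ^[i] x)) (fun i => h.exponent_ne hn (hmem i) (iterate_apply_ne hφ i))
      (fun i => ?_) (fun i => ?_) (minimalPeriod_pos hv.wf.suppφ x) ?_
    · rw [Function.iterate_succ_apply']
      exact h.letter_ne (hmem i) (iterate_apply_ne hφ i)
    · simp only [Function.iterate_succ_apply']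
      exact hv.free_pot _ (hmem i) (hty' i)
    · simp only [Function.iterate_minimalPeriod, Function.iterate_zero, id]

lemma Minimal.exists_cell_ne (h : D.Minimal b n) (hn : n ≠ 0) (s : Bool) {x : ℕ} (hx : x ∈ D.A) :
    ∃ z ∈ D.A, D.cell s z = D.cell s x ∧ z ≠ x := by
  by_contra! hs
  obtain ⟨D', h1, h2⟩ := h.toValid.exists_of_single hn hx (fun z hz => h.not_free hn hz) s hs
  exact absurd (h.card_le D' h1) (not_le.2 h2)

lemma Minimal.type_ne (h : D.Minimal b n) (hn : n ≠ 0) {x : ℕ} (hx : x ∈ D.A) (hπ : D.π x ≠ x) :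
    D.ty (D.π x) ≠ D.ty x := by
  intro ht
  exact absurd (h.card_le _ (h.toValid.fuseF hx rfl hπ ht fun z hz => h.not_free hn hz))
    (not_le.2 (Finset.card_erase_lt_of_mem hx))

/-- The edge of the face cell of a dart. -/
def faceEdge (b : V) (D : Diagram Γ) (x : ℕ) : Sym2 V := (D.ty x).getD s(b, b)

lemma Minimal.type_eq (h : D.Minimal b n) (hn : n ≠ 0) {x : ℕ} (hx : x ∈ D.A) :
    D.ty x = some (D.faceEdge b x) := by
  obtain ⟨e, he⟩ := Option.ne_none_iff_exists'.1 (h.not_free hn hx)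
  rw [faceEdge, he, Option.getD_some]

lemma Minimal.edge_mem (h : D.Minimal b n) (hn : n ≠ 0) {x : ℕ} (hx : x ∈ D.A) :
    D.faceEdge b x ∈ Γ.graph.edgeSet ∧ D.c x ∈ D.faceEdge b x :=
  h.toValid.edge x hx _ (h.type_eq hn hx)

/-- The angle weight of a dart in its face cell. -/
noncomputable def faceWeight (b : V) (D : Diagram Γ) (x : ℕ) : ℚ :=
  if D.φ x = x then 0 else 1 / (edgeLabel Γ (D.faceEdge b x) : ℚ)

/-- The angle weight of a dart in its vertex cell. -/
def vertWeight (D : Diagram Γ) (x : ℕ) : ℚ := if D.π x = x then 0 else 1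

lemma faceWeight_nonneg (x : ℕ) : 0 ≤ D.faceWeight b x := by
  unfold faceWeight
  split_ifs <;> positivity

lemma vertWeight_nonneg (x : ℕ) : 0 ≤ D.vertWeight x := by
  unfold vertWeight
  split_ifs <;> positivity

lemma Minimal.vert_cell_weight (h : D.Minimal b n) (hn : n ≠ 0) {x : ℕ} (hx : x ∈ D.A) :
    2 * (2 - (cyc {z ∈ D.A | D.P z = D.P x} D.π : ℚ)) ≤
      ∑ z ∈ D.A with D.P z = D.P x, D.vertWeight z := by
  have hsum : 0 ≤ ∑ z ∈ D.A with D.P z = D.P x, D.vertWeight z :=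
    Finset.sum_nonneg fun z _ => vertWeight_nonneg z
  have hxm : x ∈ D.A.filter (fun z => D.P z = D.P x) := Finset.mem_filter.2 ⟨hx, rfl⟩
  obtain h1 | h1 := (one_le_cyc (g := D.π) hxm).eq_or_lt'
  · obtain ⟨z, hz, hzx, hne⟩ := h.exists_cell_ne hn true hx
    have hzm : z ∈ D.A.filter (fun z => D.P z = D.P x) := Finset.mem_filter.2 ⟨hz, hzx⟩
    have h2 : SameCycle D.π x z := sameCycle_of_cyc_le_one h1.le hxm hzm
    have hx' : D.π x ≠ x := fun h3 => hne ((sameCycle_fixed_iff h3).1 h2.symm)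
    have hz' : D.π z ≠ z := fun h3 => hne ((sameCycle_fixed_iff h3).1 h2).symm
    calc _ = ∑ w ∈ ({z, x} : Finset ℕ), D.vertWeight w := by
          rw [Finset.sum_pair hne, vertWeight, vertWeight, if_neg hx', if_neg hz', h1]
          norm_num
      _ ≤ _ := by
          refine Finset.sum_le_sum_of_subset_of_nonneg ?_ fun w _ _ => vertWeight_nonneg w
          intro w hw
          rw [Finset.mem_insert, Finset.mem_singleton] at hw
          rcases hw with rfl | rfl
          · exact hzm
          · exact hxm
  · have : (2 : ℚ) ≤ cyc {z ∈ D.A | D.P z = D.P x} D.π := by exact_mod_cast h1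
    linarith

lemma Minimal.face_cell_weight (h : D.Minimal b n) (hn : n ≠ 0) {x : ℕ} (hx : x ∈ D.A) :
    2 * (2 - (cyc {z ∈ D.A | D.F z = D.F x} D.φ : ℚ)) <
      (∑ z ∈ D.A with D.F z = D.F x, D.faceWeight b z) + 2 := by
  have hsum : 0 ≤ ∑ z ∈ D.A with D.F z = D.F x, D.faceWeight b z :=
    Finset.sum_nonneg fun z _ => faceWeight_nonneg z
  have hxm : x ∈ D.A.filter (fun z => D.F z = D.F x) := Finset.mem_filter.2 ⟨hx, rfl⟩
  obtain h1 | h1 := (one_le_cyc (g := D.φ) hxm).eq_or_lt'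
  · obtain ⟨z, hz, hzx, hne⟩ := h.exists_cell_ne hn false hx
    have hzm : z ∈ D.A.filter (fun z => D.F z = D.F x) := Finset.mem_filter.2 ⟨hz, hzx⟩
    have h2 : SameCycle D.φ x z := sameCycle_of_cyc_le_one h1.le hxm hzm
    have hx' : D.φ x ≠ x := fun h3 => hne ((sameCycle_fixed_iff h3).1 h2.symm)
    have h3 : 0 < D.faceWeight b x := by
      rw [faceWeight, if_neg hx']
      have := two_le_edgeLabel Γ (h.edge_mem hn hx).1
      positivity
    have h4 := Finset.single_le_sum (f := D.faceWeight b) (fun z _ => faceWeight_nonneg z) hxm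
    rw [h1]
    push_cast
    linarith
  · have : (2 : ℚ) ≤ cyc {z ∈ D.A | D.F z = D.F x} D.φ := by exact_mod_cast h1
    linarith

lemma Minimal.face_cell_weight_of_hol (h : D.Minimal b n) (hn : n ≠ 0) {x : ℕ} (hx : x ∈ D.A)
    (hh : ArtinDiagram.hol D.A D.j D.F x = 0) :
    2 * (2 - (cyc {z ∈ D.A | D.F z = D.F x} D.φ : ℚ)) ≤
      ∑ z ∈ D.A with D.F z = D.F x, D.faceWeight b z := by
  have hv := h.toValid
  have hsum : 0 ≤ ∑ z ∈ D.A with D.F z = D.F x, D.faceWeight b z :=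
    Finset.sum_nonneg fun z _ => faceWeight_nonneg z
  have hxm : x ∈ D.A.filter (fun z => D.F z = D.F x) := Finset.mem_filter.2 ⟨hx, rfl⟩
  obtain h1 | h1 := (one_le_cyc (g := D.φ) hxm).eq_or_lt'
  · obtain ⟨z, hz, hzx, hne⟩ := h.exists_cell_ne hn false hx
    have hzm : z ∈ D.A.filter (fun z => D.F z = D.F x) := Finset.mem_filter.2 ⟨hz, hzx⟩
    have hx' : D.φ x ≠ x := fun h3 =>
      hne ((sameCycle_fixed_iff h3).1 (sameCycle_of_cyc_le_one h1.le hxm hzm).symm)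
    have hmem := iterate_face_mem hv hx
    set N := Function.minimalPeriod D.φ x with hN
    have hN0 : 1 ≤ N := minimalPeriod_pos hv.wf.suppφ x
    have hper : ∀ i, D.φ^[i + N] x = D.φ^[i] x := fun i => by
      rw [Function.iterate_add_apply, hN, Function.iterate_minimalPeriod]
    have hty : ∀ i, D.ty (D.φ^[i] x) = D.ty x := fun i => hv.type _ (hmem i) x hx (iterate_face hv x i)
    have hfe : ∀ i, D.faceEdge b (D.φ^[i] x) = D.faceEdge b x := fun i => by
      rw [faceEdge, hty, faceEdge]
    have hJ : ∑ i ∈ Finset.range N, D.j (D.φ^[i] x) = 0 := by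
      rw [← hh, hol, ← Finset.sum_image (f := D.j) (g := fun i => D.φ^[i] x)]
      · refine Finset.sum_congr ?_ fun _ _ => rfl
        ext z
        simp only [Finset.mem_image, Finset.mem_range]
        constructor
        · rintro ⟨i, _, rfl⟩
          exact Finset.mem_filter.2 ⟨hmem i, iterate_face hv x i⟩
        · intro hz
          obtain ⟨i, hi, hiz⟩ := exists_pow_lt_of_sameCycle (n := N) hN0
            (by rw [← iterate_eq_pow, hN, Function.iterate_minimalPeriod])
            (sameCycle_of_cyc_le_one h1.le hxm hz)
          exact ⟨i, hi, by rw [iterate_eq_pow, hiz]⟩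
      · intro i hi l hl h
        exact Function.iterate_injOn_Iio_minimalPeriod (by simpa using hi) (by simpa using hl) h
    have hJ' : ∀ i, ∑ l ∈ Finset.range (i + N), D.j (D.φ^[l] x) =
        ∑ l ∈ Finset.range i, D.j (D.φ^[l] x) := by
      intro i
      rw [add_comm, Finset.sum_range_add, hJ, zero_add]
      refine Finset.sum_congr rfl fun l _ => ?_
      rw [add_comm, hper]
    have key := edge_label_le Γ (h.edge_mem hn hx).1 hN0
      (fun i => artinGen Γ b ^ (-(n * ∑ l ∈ Finset.range i, D.j (D.φ^[l] x))) * D.dev (D.φ^[i] x))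
      (fun i => D.k (D.φ^[i] x)) (fun i => D.c (D.φ^[i] x))
      (fun i => h.exponent_ne hn (hmem i) (iterate_apply_ne hx' i))
      (fun i => by rw [← hfe i]; exact (h.edge_mem hn (hmem i)).2)
      (fun i => by
        rw [Function.iterate_succ_apply']
        exact h.letter_ne (hmem i) (iterate_apply_ne hx' i))
      (fun i => by
        rw [Function.iterate_succ_apply', hv.step _ (hmem i), Finset.sum_range_succ, ← mul_assoc,
          ← mul_assoc, ← zpow_add]
        congr 3
        ring)
      (fun i => by simp only [hJ', hper]) (fun i => by simp only [hper]) (fun i => by simp only [hper])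
    have h5 := sum_orbit_le (g := D.φ) (x := x) (θ := D.faceWeight b)
      (S := {z ∈ D.A | D.F z = D.F x}) (fun z _ => faceWeight_nonneg z)
      (fun i => Finset.mem_filter.2 ⟨hmem i, iterate_face hv x i⟩)
    refine le_trans ?_ h5
    have h6 : ∀ i, D.faceWeight b (D.φ^[i] x) = 1 / (edgeLabel Γ (D.faceEdge b x) : ℚ) := fun i => by
      rw [faceWeight, if_neg (iterate_apply_ne hx' i), hfe]
    simp only [h6, Finset.sum_const, Finset.card_range, nsmul_eq_mul, ← hN, h1]
    have h7 : (0 : ℚ) < edgeLabel Γ (D.faceEdge b x) := by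
      have := two_le_edgeLabel Γ (h.edge_mem hn hx).1
      positivity
    rw [mul_one_div, le_div_iff₀ h7]
    have h8 : (2 * edgeLabel Γ (D.faceEdge b x) : ℚ) ≤ N := by exact_mod_cast key
    push_cast
    linarith
  · have : (2 : ℚ) ≤ cyc {z ∈ D.A | D.F z = D.F x} D.φ := by exact_mod_cast h1
    linarith

end Diagram

namespace Diagram

variable {V : Type*} {Γ : LabeledGraph V} {b : V} {n : ℤ} {D : Diagram Γ}

lemma sum_eq_sum_fiber {A : Finset ℕ} (F : ℕ → ℕ) (w : ℕ → ℚ) :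
    ∑ x ∈ A, w x = ∑ v ∈ A.image F, ∑ z ∈ A with F z = v, w z :=
  (Finset.sum_fiberwise_of_maps_to (fun _ hx => Finset.mem_image_of_mem F hx) w).symm

lemma nval_eq_card (A : Finset ℕ) (F : ℕ → ℕ) : nval A F = (A.image F).card := by
  unfold nval
  congr!

lemma cyc_nval_eq {A : Finset ℕ} {g : Perm ℕ} {F : ℕ → ℕ} (hg : SuppIn A g) (hF : ∀ x, F (g x) = F x) :
    4 * (nval A F : ℚ) - 2 * cyc A g =
      ∑ v ∈ A.image F, 2 * (2 - (cyc {z ∈ A | F z = v} g : ℚ)) := by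
  rw [cyc_eq_sum_fiber (F := F) (g := g), ← Finset.mul_sum, Finset.sum_sub_distrib, Finset.sum_const,
    nval_eq_card, Nat.cast_sum, nsmul_eq_mul]
  · ring
  · intro z w hzw
    exact hg.periodic.rel_of_sameCycle (R := fun z w => F z = F w) (fun _ => rfl)
      (fun _ _ _ => Eq.trans) (fun z => (hF z).symm) hzw

lemma Minimal.vert_sum (h : D.Minimal b n) (hn : n ≠ 0) :
    4 * (nval D.A D.P : ℚ) - 2 * cyc D.A D.π ≤ ∑ x ∈ D.A, D.vertWeight x := by
  rw [cyc_nval_eq h.wf.suppπ h.wf.vert, sum_eq_sum_fiber D.P D.vertWeight]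
  refine Finset.sum_le_sum fun v hv => ?_
  obtain ⟨x, hx, rfl⟩ := Finset.mem_image.1 hv
  exact h.vert_cell_weight hn hx

lemma Minimal.face_sum (h : D.Minimal b n) (hn : n ≠ 0) :
    4 * (nval D.A D.F : ℚ) - 2 * cyc D.A D.φ < (∑ x ∈ D.A, D.faceWeight b x) + 4 := by
  classical
  rw [cyc_nval_eq h.wf.suppφ h.wf.face, sum_eq_sum_fiber D.F (D.faceWeight b)]
  set sp : ℕ → Prop := fun v => ∃ x ∈ D.A, D.F x = v ∧ ArtinDiagram.hol D.A D.j D.F x ≠ 0 with hsp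
  have hle : ∀ v ∈ D.A.image D.F, 2 * (2 - (cyc {z ∈ D.A | D.F z = v} D.φ : ℚ)) ≤
      (∑ z ∈ D.A with D.F z = v, D.faceWeight b z) + if sp v then 2 else 0 := by
    intro v hv
    obtain ⟨x, hx, rfl⟩ := Finset.mem_image.1 hv
    split_ifs with h1
    · exact (h.face_cell_weight hn hx).le
    · rw [add_zero]
      refine h.face_cell_weight_of_hol hn hx ?_
      by_contra h2
      exact h1 ⟨x, hx, rfl, h2⟩
  have hcard : ((D.A.image D.F).filter sp).card ≤ 2 := by
    rw [← Fintype.card_prop, ← Finset.card_univ]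
    choose! r hr using fun v (hv : v ∈ (D.A.image D.F).filter sp) => (Finset.mem_filter.1 hv).2
    refine Finset.card_le_card_of_injOn (fun v => D.Good b false (r v)) (fun _ _ => Finset.mem_univ _) ?_
    intro v hv w hw hvw
    obtain ⟨v1, v2, v3⟩ := hr v hv
    obtain ⟨w1, w2, w3⟩ := hr w hw
    have h1 := (h.hol.unique false false _ v1 _ w1 v3 w3 (iff_of_eq hvw)).2
    rw [← v2, ← w2]
    exact h1
  have hsum : (∑ v ∈ D.A.image D.F, if sp v then (2 : ℚ) else 0) =
      2 * ((D.A.image D.F).filter sp).card := by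
    rw [← Finset.sum_filter, Finset.sum_const, nsmul_eq_mul, mul_comm]
  have hc2 : (((D.A.image D.F).filter sp).card : ℚ) ≤ 2 := by exact_mod_cast hcard
  by_cases hS : ((D.A.image D.F).filter sp) = ∅
  · have := Finset.sum_le_sum hle
    rw [Finset.sum_add_distrib, hsum, hS, Finset.card_empty] at this
    push_cast at this
    linarith
  · obtain ⟨v, hv⟩ := Finset.nonempty_iff_ne_empty.2 hS
    obtain ⟨hv1, hv2⟩ := Finset.mem_filter.1 hv
    have := Finset.sum_lt_sum hle ⟨v, hv1, by
      rw [if_pos hv2]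
      obtain ⟨x, hx, rfl⟩ := Finset.mem_image.1 hv1
      exact h.face_cell_weight hn hx⟩
    rw [Finset.sum_add_distrib, hsum] at this
    linarith

lemma Minimal.corner_sum (h : D.Minimal b n) (hn : n ≠ 0) (h2d : Γ.TwoDimensional) :
    2 * (cyc D.A (D.φ * D.π) : ℚ) ≤
      2 * D.A.card - (∑ x ∈ D.A, D.faceWeight b x) - ∑ x ∈ D.A, D.vertWeight x := by
  classical
  have hv := h.toValid
  have hν : SuppIn D.A (D.φ * D.π) := hv.wf.suppφ.mul hv.wf.suppπ
  have hf1 : ∀ x ∈ D.A, D.faceWeight b x ≤ 1 := by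
    intro x hx
    rw [faceWeight]
    split_ifs
    · norm_num
    · have := two_le_edgeLabel Γ (h.edge_mem hn hx).1
      rw [div_le_one (by positivity)]
      exact_mod_cast (by omega : 1 ≤ edgeLabel Γ (D.faceEdge b x))
  have hp1 : ∀ x, D.vertWeight x ≤ 1 := by
    intro x
    rw [vertWeight]
    split_ifs <;> norm_num
  have hsum : ∑ x ∈ D.A, ((1 - D.vertWeight x) + (1 - D.faceWeight b (D.π x))) =
      2 * D.A.card - (∑ x ∈ D.A, D.faceWeight b x) - ∑ x ∈ D.A, D.vertWeight x := by
    have h1 : ∑ x ∈ D.A, D.faceWeight b (D.π x) = ∑ x ∈ D.A, D.faceWeight b x := by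
      refine Finset.sum_nbij' (fun z => D.π z) (fun z => D.π⁻¹ z) ?_ ?_ ?_ ?_ ?_
      · exact fun z hz => hv.vert_mem hz
      · exact fun z hz => (hv.wf.suppπ.inv.mem_iff z).2 hz
      · exact fun z _ => D.π.symm_apply_apply z
      · exact fun z _ => D.π.apply_symm_apply z
      · exact fun z _ => rfl
    rw [Finset.sum_add_distrib, Finset.sum_sub_distrib, Finset.sum_sub_distrib, h1, Finset.sum_const,
      nsmul_one]
    ring
  rw [← hsum]
  refine two_mul_cyc_le hν (fun z hz => ?_) fun x hx => ?_
  · linarith [hp1 z, hf1 _ (hv.vert_mem hz)]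
  set N := Function.minimalPeriod (D.φ * D.π) x with hN
  have hmem : ∀ i, (D.φ * D.π)^[i] x ∈ D.A := iterate_mem hν hx
  have hper : (D.φ * D.π)^[N] x = x := Function.iterate_minimalPeriod
  have hcy : ∀ z ∈ D.A, D.c (D.π z) = D.c z := fun z hz =>
    hv.letter _ (hv.vert_mem hz) _ hz (hv.wf.vert z)
  have hty : ∀ z ∈ D.A, D.ty (D.φ z) = D.ty z := fun z hz =>
    hv.type _ (hv.face_mem hz) _ hz (hv.wf.face z)
  have hfe : ∀ z ∈ D.A, D.faceEdge b (D.φ z) = D.faceEdge b z := fun z hz => by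
    rw [faceEdge, hty z hz, faceEdge]
  have key := corner_bound h2d (C := fun i => D.c ((D.φ * D.π)^[i] x))
    (E := fun i => D.faceEdge b ((D.φ * D.π)^[i] x)) (r := N) (minimalPeriod_pos hν x)
    (by simp only [hper, Function.iterate_zero, id]) (by simp only [hper, Function.iterate_zero, id])
    (fun i => (h.edge_mem hn (hmem i)).2)
    (fun i => by
      rw [Function.iterate_succ_apply', ← hcy _ (hmem i), Perm.mul_apply, hfe _ (hv.vert_mem (hmem i))]
      exact (h.edge_mem hn (hv.vert_mem (hmem i))).2)
    (fun i => (h.edge_mem hn (hmem i)).1)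
  refine key.trans (Finset.sum_le_sum fun i _ => ?_)
  have hz := hmem i
  simp only [Function.iterate_succ_apply', Perm.mul_apply] at hz ⊢
  generalize (D.φ * D.π)^[i] x = z at hz ⊢
  have hy := hv.vert_mem hz
  refine add_le_add ?_ ?_
  · split_ifs with h1
    · have h2 : D.π z = z := by
        by_contra h2
        apply h.type_ne hn hz h2
        rw [h.type_eq hn hy, h.type_eq hn hz, ← h1, hfe _ hy]
      rw [vertWeight, if_pos h2, sub_zero]
    · linarith [hp1 z]
  · rw [← hcy z hz, hfe _ hy, faceWeight]
    by_cases h1 : D.φ (D.π z) = D.π z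
    · rw [if_pos h1, if_pos (by rw [h1])]
      norm_num
    · rw [if_neg h1, if_neg (h.letter_ne hy h1)]

lemma Minimal.false (h : D.Minimal b n) (hn : n ≠ 0) (h2d : Γ.TwoDimensional) : False := by
  obtain ⟨_, x, hx, _⟩ := h.hol.exists_ne
  have h1 := h.planar (fun _ => 0) fun _ _ _ _ _ => rfl
  have h2 : nval D.A (fun _ => 0) = 1 := by
    rw [nval_eq_card, Finset.image_const ⟨x, hx⟩, Finset.card_singleton]
  rw [h2] at h1
  have h3 : (2 : ℚ) ≤ D.chi := by exact_mod_cast h1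
  rw [HMap.chi] at h3
  push_cast at h3
  linarith [h.vert_sum hn, h.face_sum hn, h.corner_sum hn h2d]

/-- There are no valid diagrams over a `2`-dimensional Artin group. -/
lemma Valid.false (h : D.Valid b n) (hn : n ≠ 0) (h2d : Γ.TwoDimensional) : False := by
  induction hA : D.A.card using Nat.strong_induction_on generalizing D with
  | _ m ih =>
    subst hA
    refine Minimal.false ⟨h, fun D' h' => ?_⟩ hn h2d
    by_contra! hlt
    exact ih _ hlt h' rfl

end Diagram

namespace HMap

lemma isChain_congr {L : List ℕ} {t : ℕ} {g g' : ℕ → ℕ} (h : (L ++ [t]).IsChain (fun x y => g x = y))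
    (hg : ∀ z ∈ L, g' z = g z) : (L ++ [t]).IsChain (fun x y => g' x = y) := by
  induction L with
  | nil => exact List.isChain_singleton t
  | cons x L ih =>
    rw [List.cons_append, List.isChain_cons] at h ⊢
    refine ⟨fun y hy => (hg x List.mem_cons_self).trans (h.1 y hy), ih h.2 fun z hz => ?_⟩
    exact hg z (List.mem_cons_of_mem x hz)

/-- The list `L`, starting with `0`, enumerates a face of `M`. -/
structure Ring (M : HMap) (L : List ℕ) : Prop where
  wf : M.Wf
  planar : M.Planar
  nodup : L.Nodup
  mem : ∀ x ∈ L, x ∈ M.A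
  head : L.head? = some 0
  chain : (L ++ [0]).IsChain (fun x y => M.φ x = y)

variable {M : HMap}

lemma Ring.insLoop {L₁ L₂ : List ℕ} {x y p : ℕ} (h : M.Ring (L₁ ++ y :: L₂)) (hx : x ∉ M.A)
    (hp : ∀ z ∈ M.A, M.P z ≠ p) : (M.insLoop y x p).Ring (L₁ ++ y :: x :: L₂) := by
  have hy : y ∈ M.A := h.mem y (by simp)
  have hxL : x ∉ L₁ ++ y :: L₂ := fun hL => hx (h.mem x hL)
  have hxy : x ≠ y := fun e => hx (e ▸ hy)
  have hxφ : M.φ x = x := h.wf.suppφ x hx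
  have hnd := h.nodup
  simp only [List.mem_append, List.mem_cons, not_or] at hxL
  have hφ : ∀ z, z ≠ x → z ≠ y → (M.φ * swap y x) z = M.φ z := fun z h1 h2 => by
    rw [Perm.mul_apply, swap_apply_of_ne_of_ne h2 h1]
  refine ⟨h.wf.insLoop hy hx, h.planar.insLoop h.wf hy hx hp, ?_, ?_, ?_, ?_⟩
  · simp only [List.nodup_append, List.nodup_cons, List.mem_cons] at hnd ⊢
    grind
  · intro z hz
    change z ∈ insert x M.A
    rw [Finset.mem_insert]
    by_cases hzx : z = x
    · exact .inl hzx
    · refine .inr (h.mem z ?_)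
      simp only [List.mem_append, List.mem_cons] at hz ⊢
      tauto
  · have := h.head
    cases L₁ <;> simpa using this
  · have hc := h.chain
    rw [List.append_assoc, List.cons_append, List.isChain_split, List.isChain_cons] at hc
    obtain ⟨c1, c2, c3⟩ := hc
    rw [List.append_assoc, List.cons_append, List.cons_append, List.isChain_split, List.isChain_cons,
      List.isChain_cons]
    change _ ∧ (∀ z ∈ _, (M.φ * swap y x) y = z) ∧ (∀ z ∈ _, (M.φ * swap y x) x = z) ∧ _
    simp only [List.nodup_append, List.nodup_cons] at hnd
    refine ⟨isChain_congr c1 fun z hz => hφ z ?_ ?_, ?_, ?_, isChain_congr c3 fun z hz => hφ z ?_ ?_⟩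
    · rintro rfl
      exact hxL.1 hz
    · rintro rfl
      exact hnd.2.2 z hz z List.mem_cons_self rfl
    · intro z hz
      rw [Perm.mul_apply, swap_apply_left, hxφ]
      simpa using hz
    · intro z hz
      rw [Perm.mul_apply, swap_apply_right]
      exact c2 z hz
    · rintro rfl
      exact hxL.2.2 hz
    · rintro rfl
      exact hnd.2.1.1 hz

lemma Ring.joinP {L : List ℕ} {x x' : ℕ} (h : M.Ring L) (hx : x ∈ M.A) (hx' : x' ∈ M.A)
    (hπ : M.π x = x) (hφ : M.φ x = x') (hne : x ≠ x') : (M.joinP x x').Ring L :=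
  ⟨h.wf.joinP hx hx', h.planar.joinP h.wf hx hx' hπ hφ hne, h.nodup, h.mem, h.head, h.chain⟩

lemma face_eq_of_chain (h : M.Wf) {L : List ℕ} {x t : ℕ} (hL : (x :: (L ++ [t])).IsChain (fun x y => M.φ x = y))
    {z : ℕ} (hz : z ∈ L) : M.F z = M.F x := by
  induction L generalizing x with
  | nil => simp at hz
  | cons w L ih =>
    rw [List.cons_append, List.isChain_cons_cons] at hL
    have h1 : M.F w = M.F x := by rw [← hL.1, h.face]
    rcases List.mem_cons.1 hz with rfl | hz
    · exact h1
    · exact (ih hL.2 hz).trans h1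

lemma Ring.face_eq {L : List ℕ} (h : M.Ring L) {z : ℕ} (hz : z ∈ L) : M.F z = M.F 0 := by
  have hc := h.chain
  have hh := h.head
  cases L with
  | nil => simp at hz
  | cons x L =>
    obtain rfl : x = 0 := by simpa using hh
    rcases List.mem_cons.1 hz with rfl | hz
    · rfl
    · exact face_eq_of_chain h.wf hc hz

lemma sameCycle_of_chain {g : Perm ℕ} {L : List ℕ} {x t : ℕ}
    (hL : (x :: (L ++ [t])).IsChain (fun x y => g x = y)) : SameCycle g x t := by
  induction L generalizing x with
  | nil =>
    rw [List.nil_append, List.isChain_cons_cons] at hL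
    exact ⟨1, by simpa using hL.1⟩
  | cons w L ih =>
    rw [List.cons_append, List.isChain_cons_cons] at hL
    refine SameCycle.trans ⟨1, ?_⟩ (ih hL.2)
    simpa using hL.1

lemma apply_mem_of_chain {g : Perm ℕ} {L : List ℕ} {x t : ℕ}
    (hL : (x :: (L ++ [t])).IsChain (fun x y => g x = y)) {z : ℕ} (hz : z ∈ x :: L) : g z ∈ L ++ [t] := by
  induction L generalizing x with
  | nil =>
    rw [List.nil_append, List.isChain_cons_cons] at hL
    rw [List.mem_singleton.1 hz, hL.1]
    exact List.mem_singleton_self t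
  | cons w L ih =>
    rw [List.cons_append, List.isChain_cons_cons] at hL
    rw [List.cons_append]
    rcases List.mem_cons.1 hz with rfl | hz
    · rw [hL.1]
      exact List.mem_cons_self
    · exact List.mem_cons_of_mem w (ih hL.2 hz)

/-- Pinch a face along the segment `X ++ [w]` following `y`. -/
lemma Ring.pinch {L₁ X L₂ : List ℕ} {y w f : ℕ} (h : M.Ring (L₁ ++ y :: (X ++ w :: L₂)))
    (hf : ∀ z ∈ M.A, M.F z ≠ f) (hmate : ∃ u ∈ X ++ [w], ∃ v ∈ L₂, M.P u = M.P v) :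
    (M.pinch y w fun z => if z ∈ X ++ [w] then f else M.F z).Ring (L₁ ++ y :: L₂) := by
  have hy : y ∈ M.A := h.mem y (by simp)
  have hw : w ∈ M.A := h.mem w (by simp)
  have hnd := h.nodup
  have hc := h.chain
  rw [List.append_assoc, List.cons_append, List.append_assoc, List.cons_append, List.isChain_split,
    List.isChain_cons] at hc
  obtain ⟨c1, c2, c3⟩ := hc
  have c0 : (y :: (X ++ [w])).IsChain (fun x y => M.φ x = y) := by
    have : (y :: (X ++ w :: (L₂ ++ [0]))).IsChain (fun x y => M.φ x = y) := by
      rw [List.isChain_cons]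
      exact ⟨c2, c3⟩
    rw [← List.cons_append, List.isChain_split] at this
    exact this.1
  rw [List.isChain_split, List.isChain_cons] at c3
  obtain ⟨c3, c4, c5⟩ := c3
  have hmem : ∀ z ∈ X ++ [w], z ∈ L₁ ++ y :: (X ++ w :: L₂) := fun z hz => by
    simp only [List.mem_append, List.mem_cons] at hz ⊢
    tauto
  have hyX : y ∉ X ++ [w] := by
    simp only [List.nodup_append, List.nodup_cons, List.mem_append, List.mem_cons] at hnd ⊢
    grind
  have hL₂ : ∀ z ∈ L₂, z ∉ X ++ [w] ∧ z ≠ y := by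
    simp only [List.nodup_append, List.nodup_cons, List.mem_append, List.mem_cons] at hnd ⊢
    grind
  have hL₁ : ∀ z ∈ L₁, z ∉ X ++ [w] ∧ z ≠ y := by
    simp only [List.nodup_append, List.nodup_cons, List.mem_append, List.mem_cons] at hnd ⊢
    grind
  have hwX : w ∈ X ++ [w] := by simp
  have hyw : y ≠ w := fun e => hyX (e ▸ hwX)
  have hFR : ∀ z ∈ X ++ [w], M.F z = M.F y := fun z hz => by
    rw [h.face_eq (hmem z hz), h.face_eq (z := y) (by simp)]
  have hφ : ∀ z, z ≠ y → z ≠ w → (M.φ * swap y w) z = M.φ z := fun z h1 h2 => by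
    rw [Perm.mul_apply, swap_apply_of_ne_of_ne h1 h2]
  have hw' : ∀ z, z ∉ X ++ [w] → z ≠ w := fun z hz e => hz (e ▸ hwX)
  have hX := fun z hz => apply_mem_of_chain c0 (z := z) hz
  have hmaps : Set.MapsTo (M.φ * swap y w) {z | z ∈ X ++ [w]} {z | z ∈ X ++ [w]} := by
    intro z hz
    by_cases hzw : z = w
    · rw [hzw, Perm.mul_apply, swap_apply_right]
      exact hX y List.mem_cons_self
    · rw [hφ z (fun e => hyX (e ▸ hz)) hzw]
      refine hX z (List.mem_cons_of_mem _ ?_)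
      simpa [hzw] using hz
  have hfin : Finite {z | z ∈ X ++ [w]} := (List.finite_toSet (X ++ [w])).to_subtype
  have hiff : ∀ z, (M.φ * swap y w) z ∈ X ++ [w] ↔ z ∈ X ++ [w] := fun z =>
    ⟨fun hz => by
      have := perm_symm_mapsTo_of_mapsTo _ hmaps hz
      rwa [symm_apply_apply] at this, fun hz => hmaps hz⟩
  have wf' : (M.pinch y w fun z => if z ∈ X ++ [w] then f else M.F z).Wf := by
    refine ⟨h.wf.suppφ.mul (SuppIn.swap hy hw), h.wf.suppπ, ?_, h.wf.vert⟩
    intro z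
    change (if (M.φ * swap y w) z ∈ X ++ [w] then f else M.F ((M.φ * swap y w) z)) =
      if z ∈ X ++ [w] then f else M.F z
    simp only [hiff]
    split_ifs with hz
    · rfl
    by_cases hzy : z = y
    · rw [hzy, Perm.mul_apply, swap_apply_left, h.wf.face]
      exact hFR w hwX
    · rw [hφ z hzy (hw' z hz), h.wf.face]
  refine ⟨wf', ?_, ?_, ?_, ?_, ?_⟩
  · obtain ⟨u, hu, v, hv, huv⟩ := hmate
    refine h.planar.pinch h.wf (R := {z | z ∈ X ++ [w]}) (f := f) hy hw hyw (sameCycle_of_chain c0) hyX hwX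
      (fun z hz => if_neg hz) (fun z hz => if_pos hz) hFR hf
      ⟨u, h.mem u (hmem u hu), v, h.mem v (by simp [hv]), hu, (hL₂ v hv).1, ?_, huv⟩
    rw [h.face_eq (z := v) (by simp [hv]), h.face_eq (z := y) (by simp)]
  · simp only [List.nodup_append, List.nodup_cons, List.mem_append, List.mem_cons] at hnd ⊢
    grind
  · intro z hz
    refine h.mem z ?_
    simp only [List.mem_append, List.mem_cons] at hz ⊢
    tauto
  · have := h.head
    cases L₁ <;> simpa using this
  · rw [List.append_assoc, List.cons_append, List.isChain_split, List.isChain_cons]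
    change _ ∧ (∀ z ∈ _, (M.φ * swap y w) y = z) ∧ _
    refine ⟨isChain_congr c1 fun z hz => hφ z (hL₁ z hz).2 (hw' z (hL₁ z hz).1), ?_,
      isChain_congr c5 fun z hz => hφ z (hL₂ z hz).2 (hw' z (hL₂ z hz).1)⟩
    intro z hz
    rw [Perm.mul_apply, swap_apply_left]
    exact c4 z hz

end HMap

/-- The element of the free group spelled by a list of syllables. -/
def lval {V : Type*} (l : List (V × ℤ)) : FreeGroup V :=
  (l.map fun p => FreeGroup.of p.1 ^ p.2).prod

section lval

variable {V : Type*}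

lemma lval_nil : lval ([] : List (V × ℤ)) = 1 := rfl

lemma lval_cons (p : V × ℤ) (l : List (V × ℤ)) : lval (p :: l) = FreeGroup.of p.1 ^ p.2 * lval l := by
  simp [lval]

lemma lval_append (l l' : List (V × ℤ)) : lval (l ++ l') = lval l * lval l' := by
  simp [lval]

end lval

namespace Diagram

variable {V : Type*} {Γ : LabeledGraph V}

/-- The syllables read along a list of darts. -/
def syl (D : Diagram Γ) (L : List ℕ) : List (V × ℤ) := L.map fun x => (D.c x, D.k x)

lemma syl_append (D : Diagram Γ) (L L' : List ℕ) : D.syl (L ++ L') = D.syl L ++ D.syl L' :=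
  List.map_append

lemma syl_cons (D : Diagram Γ) (x : ℕ) (L : List ℕ) : D.syl (x :: L) = (D.c x, D.k x) :: D.syl L := rfl

/-- A diagram under construction, with free face listed by `L` and with isolated darts `S`. -/
structure Pre (b : V) (n : ℤ) (D : Diagram Γ) (L : List ℕ) (S : Finset ℕ) : Prop where
  ring : D.toHMap.Ring L
  step : ∀ x ∈ D.A, D.dev (D.φ x) = artinGen Γ b ^ (n * D.j x) * D.dev x * artinGen Γ (D.c x) ^ D.k x
  corner : ∀ x ∈ D.A, D.dev (D.φ (D.π x)) = D.dev x
  vert : ∀ z ∈ D.A, ∀ w ∈ D.A, D.P z = D.P w →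
    D.c z = D.c w ∧ ∃ m : ℤ, D.dev w = D.dev z * artinGen Γ (D.c z) ^ m
  face : ∀ z ∈ D.A, ∀ w ∈ D.A, D.F z = D.F w →
    D.ty z = D.ty w ∧ ∀ e, D.ty z = some e → ∃ u ∈ edgeSub Γ e, D.dev w = D.dev z * u
  edge : ∀ x ∈ D.A, ∀ e, D.ty x = some e → e ∈ Γ.graph.edgeSet ∧ D.c x ∈ e
  outer : ∀ z ∈ D.A, D.ty z = none ↔ z ∈ L
  special : ∀ x ∈ S, x ∈ L ∧ ∀ z ∈ D.A, D.P z = D.P x → z = x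
  plain : ∀ x ∈ D.A, x ∉ S → D.j x = 0

/-- `D'` contains the darts of `D`, with the same labels. -/
structure Extends (D D' : Diagram Γ) : Prop where
  sub : D.A ⊆ D'.A
  c_eq : ∀ z ∈ D.A, D'.c z = D.c z
  k_eq : ∀ z ∈ D.A, D'.k z = D.k z
  j_eq : ∀ z ∈ D.A, D'.j z = D.j z
  dev_eq : ∀ z ∈ D.A, D'.dev z = D.dev z

variable {b : V} {n : ℤ} {D D' D'' : Diagram Γ} {S : Finset ℕ}

lemma Extends.refl (D : Diagram Γ) : Extends D D :=
  ⟨fun _ h => h, fun _ _ => rfl, fun _ _ => rfl, fun _ _ => rfl, fun _ _ => rfl⟩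

lemma Extends.trans (h : Extends D D') (h' : Extends D' D'') : Extends D D'' where
  sub := h.sub.trans h'.sub
  c_eq z hz := (h'.c_eq z (h.sub hz)).trans (h.c_eq z hz)
  k_eq z hz := (h'.k_eq z (h.sub hz)).trans (h.k_eq z hz)
  j_eq z hz := (h'.j_eq z (h.sub hz)).trans (h.j_eq z hz)
  dev_eq z hz := (h'.dev_eq z (h.sub hz)).trans (h.dev_eq z hz)

lemma Extends.syl_eq (h : Extends D D') {L : List ℕ} (hL : ∀ x ∈ L, x ∈ D.A) : D'.syl L = D.syl L :=
  List.map_congr_left fun x hx => by rw [h.c_eq x (hL x hx), h.k_eq x (hL x hx)]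

/-- Insert a pair of inverse darts `x`, `x'` after `y`. -/
noncomputable def insPair (D : Diagram Γ) (y x x' p p' : ℕ) (v : V) (m : ℤ) : Diagram Γ where
  toHMap := ((D.toHMap.insLoop y x p).insLoop x x' p').joinP x x'
  c := Function.update (Function.update D.c x v) x' v
  k := Function.update (Function.update D.k x m) x' (-m)
  j := Function.update (Function.update D.j x 0) x' 0
  dev := Function.update (Function.update D.dev x (D.dev (D.φ y))) x'
    (D.dev (D.φ y) * artinGen Γ v ^ m)
  ty := Function.update (Function.update D.ty x none) x' none
  pot := D.pot

lemma Pre.insPair {L₁ L₂ : List ℕ} {y x x' p p' : ℕ} (h : Pre b n D (L₁ ++ y :: L₂) S) (v : V) (m : ℤ)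
    (hx : x ∉ D.A) (hx' : x' ∉ D.A) (hxx : x ≠ x') (hp : ∀ z ∈ D.A, D.P z ≠ p)
    (hp' : ∀ z ∈ D.A, D.P z ≠ p') (hpp : p ≠ p') :
    Pre b n (D.insPair y x x' p p' v m) (L₁ ++ y :: x :: x' :: L₂) S ∧
      Extends D (D.insPair y x x' p p' v m) ∧
      (D.insPair y x x' p p' v m).P x = (D.insPair y x x' p p' v m).P x' ∧
      (∀ z ∈ D.A, (D.insPair y x x' p p' v m).P z = D.P z) := by
  classical
  have hy : y ∈ D.A := h.ring.mem y (by simp)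
  have hne : ∀ z ∈ D.A, z ≠ x ∧ z ≠ x' := fun z hz => ⟨fun e => hx (e ▸ hz), fun e => hx' (e ▸ hz)⟩
  have hyn := hne y hy
  have wf := h.ring.wf
  have r1 := h.ring.insLoop hx hp
  have hx'1 : x' ∉ (D.toHMap.insLoop y x p).A := by
    change x' ∉ insert x D.A
    simp [hx', hxx.symm]
  have hp'1 : ∀ z ∈ (D.toHMap.insLoop y x p).A, (D.toHMap.insLoop y x p).P z ≠ p' := by
    intro z hz
    change Function.update D.P x p z ≠ p'
    rcases Finset.mem_insert.1 hz with rfl | hz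
    · rwa [Function.update_self]
    · rw [Function.update_of_ne (hne z hz).1]
      exact hp' z hz
  have hsplit : L₁ ++ y :: x :: L₂ = (L₁ ++ [y]) ++ x :: L₂ := by simp
  rw [hsplit] at r1
  have r2 := r1.insLoop hx'1 hp'1
  have φx : (D.φ * swap y x * swap x x') x = x' := by
    rw [Perm.mul_apply, Perm.mul_apply, swap_apply_left, swap_apply_of_ne_of_ne hyn.2.symm hxx.symm,
      wf.suppφ x' hx']
  have πx : D.π x = x := wf.suppπ x hx
  have πx' : D.π x' = x' := wf.suppπ x' hx'
  have r3 := r2.joinP (x := x) (x' := x') (Finset.mem_insert_of_mem (Finset.mem_insert_self x D.A))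
    (Finset.mem_insert_self x' _) πx φx hxx
  rw [List.append_assoc, List.singleton_append] at r3
  have φy : (D.φ * swap y x * swap x x') y = x := by
    rw [Perm.mul_apply, Perm.mul_apply, swap_apply_of_ne_of_ne hyn.1 hyn.2, swap_apply_left,
      wf.suppφ x hx]
  have φx' : (D.φ * swap y x * swap x x') x' = D.φ y := by
    rw [Perm.mul_apply, Perm.mul_apply, swap_apply_right, swap_apply_right]
  have φz : ∀ z, z ≠ y → z ≠ x → z ≠ x' → (D.φ * swap y x * swap x x') z = D.φ z := by
    intro z h1 h2 h3
    rw [Perm.mul_apply, Perm.mul_apply, swap_apply_of_ne_of_ne h2 h3, swap_apply_of_ne_of_ne h1 h2]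
  have πx1 : (D.π * swap x x') x = x' := by rw [Perm.mul_apply, swap_apply_left, πx']
  have πx2 : (D.π * swap x x') x' = x := by rw [Perm.mul_apply, swap_apply_right, πx]
  have πz : ∀ z, z ≠ x → z ≠ x' → (D.π * swap x x') z = D.π z := by
    intro z h2 h3
    rw [Perm.mul_apply, swap_apply_of_ne_of_ne h2 h3]
  have hφA : ∀ z ∈ D.A, D.φ z ∈ D.A := fun z hz => (wf.suppφ.mem_iff z).2 hz
  have hπA : ∀ z ∈ D.A, D.π z ∈ D.A := fun z hz => (wf.suppπ.mem_iff z).2 hz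
  change (D.insPair y x x' p p' v m).toHMap.Ring _ at r3
  set E := D.insPair y x x' p p' v m with hE
  have hEA : ∀ z, z ∈ E.A ↔ z = x' ∨ z = x ∨ z ∈ D.A := by
    intro z
    change z ∈ insert x' (insert x D.A) ↔ _
    simp
  have hEφ : E.φ = D.φ * swap y x * swap x x' := rfl
  have hEπ : E.π = D.π * swap x x' := rfl
  rw [← hEφ] at φx φx' φy φz
  rw [← hEπ] at πx1 πx2 πz
  have cx : E.c x = v := by simp [hE, Diagram.insPair, hxx]
  have cx' : E.c x' = v := by simp [hE, Diagram.insPair]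
  have kx : E.k x = m := by simp [hE, Diagram.insPair, hxx]
  have kx' : E.k x' = -m := by simp [hE, Diagram.insPair]
  have jx : E.j x = 0 := by simp [hE, Diagram.insPair, hxx]
  have jx' : E.j x' = 0 := by simp [hE, Diagram.insPair]
  have tx : E.ty x = none := by simp [hE, Diagram.insPair, hxx]
  have tx' : E.ty x' = none := by simp [hE, Diagram.insPair]
  have dx : E.dev x = D.dev (D.φ y) := by simp [hE, Diagram.insPair, hxx]
  have dx' : E.dev x' = D.dev (D.φ y) * artinGen Γ v ^ m := by simp [hE, Diagram.insPair]
  have Fx : E.F x = D.F y := by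
    simp [hE, Diagram.insPair, HMap.joinP, HMap.insLoop, hxx]
  have Fx' : E.F x' = D.F y := by
    simp [hE, Diagram.insPair, HMap.joinP, HMap.insLoop]
  have Px : E.P x = p := by
    simp [hE, Diagram.insPair, HMap.joinP, HMap.insLoop, relabel, hxx]
  have Px' : E.P x' = p := by
    simp [hE, Diagram.insPair, HMap.joinP, HMap.insLoop, relabel, hxx]
  have old : ∀ z ∈ D.A, E.c z = D.c z ∧ E.k z = D.k z ∧ E.j z = D.j z ∧ E.dev z = D.dev z ∧
      E.ty z = D.ty z ∧ E.F z = D.F z ∧ E.P z = D.P z := by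
    intro z hz
    obtain ⟨h1, h2⟩ := hne z hz
    simp [hE, Diagram.insPair, HMap.joinP, HMap.insLoop, relabel, h1, h2, hp' z hz]
  clear_value E
  have hty : ∀ z ∈ D.A, D.F z = D.F y → D.ty z = none := by
    intro z hz hzy
    rw [(h.face z hz y hy hzy).1, h.outer y hy]
    simp
  refine ⟨⟨?_, ?_, ?_, ?_, ?_, ?_, ?_, ?_, ?_⟩, ⟨fun z hz => (hEA z).2 (.inr (.inr hz)), fun z hz => (old z hz).1,
    fun z hz => (old z hz).2.1, fun z hz => (old z hz).2.2.1, fun z hz => (old z hz).2.2.2.1⟩,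
    Px.trans Px'.symm, fun z hz => (old z hz).2.2.2.2.2.2⟩
  · exact r3
  · intro z hz
    rcases (hEA z).1 hz with rfl | rfl | hz
    · rw [φx', jx', kx', cx', dx', (old _ (hφA y hy)).2.2.2.1]
      simp
    · rw [φx, jx, kx, cx, dx, dx']
      simp
    · obtain ⟨o1, o2, o3, o4, -⟩ := old z hz
      rw [o1, o2, o3, o4, ← h.step z hz]
      by_cases hzy : z = y
      · rw [hzy, φy, dx]
      · rw [φz z hzy (hne z hz).1 (hne z hz).2, (old _ (hφA z hz)).2.2.2.1]
  · intro z hz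
    rcases (hEA z).1 hz with rfl | rfl | hz
    · rw [πx2, φx]
    · rw [πx1, φx', dx, (old _ (hφA y hy)).2.2.2.1]
    · rw [πz z (hne z hz).1 (hne z hz).2, (old z hz).2.2.2.1, ← h.corner z hz]
      by_cases hzy : D.π z = y
      · rw [hzy, φy, dx]
      · have h1 := hπA z hz
        rw [φz _ hzy (hne _ h1).1 (hne _ h1).2, (old _ (hφA _ h1)).2.2.2.1]
  · intro z hz w hw
    rcases (hEA z).1 hz with rfl | rfl | hz <;> rcases (hEA w).1 hw with rfl | rfl | hw
    · exact fun _ => ⟨rfl, 0, by simp⟩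
    · exact fun _ => ⟨cx'.trans cx.symm, -m, by rw [dx, dx', cx']; simp⟩
    · rw [Px', (old w hw).2.2.2.2.2.2]
      exact fun h => (hp w hw h.symm).elim
    · exact fun _ => ⟨cx.trans cx'.symm, m, by rw [dx, dx', cx]⟩
    · exact fun _ => ⟨rfl, 0, by simp⟩
    · rw [Px, (old w hw).2.2.2.2.2.2]
      exact fun h => (hp w hw h.symm).elim
    · rw [Px', (old z hz).2.2.2.2.2.2]
      exact fun h => (hp z hz h).elim
    · rw [Px, (old z hz).2.2.2.2.2.2]
      exact fun h => (hp z hz h).elim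
    · obtain ⟨o1, -, -, o4, -, -, o7⟩ := old z hz
      obtain ⟨o1', -, -, o4', -, -, o7'⟩ := old w hw
      rw [o1, o4, o7, o1', o4', o7']
      exact h.vert z hz w hw
  · have key : ∀ z ∈ E.A, E.F z = D.F y → E.ty z = none := by
      intro z hz hzy
      rcases (hEA z).1 hz with rfl | rfl | hz
      · exact tx'
      · exact tx
      · obtain ⟨-, -, -, -, o5, o6, -⟩ := old z hz
        rw [o6] at hzy
        rw [o5]
        exact hty z hz hzy
    intro z hz w hw hzw
    by_cases hzy : E.F z = D.F y
    · have h1 := key z hz hzy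
      have h2 := key w hw (hzw ▸ hzy)
      exact ⟨h1.trans h2.symm, fun e he => by simp [h1] at he⟩
    · have hA : ∀ u ∈ E.A, E.F u ≠ D.F y → u ∈ D.A := by
        intro u hu huy
        rcases (hEA u).1 hu with rfl | rfl | hu
        · exact (huy Fx').elim
        · exact (huy Fx).elim
        · exact hu
      have hw := hA w hw (hzw ▸ hzy)
      have hz := hA z hz hzy
      obtain ⟨o1, -, -, o4, o5, o6, o7⟩ := old z hz
      obtain ⟨o1', -, -, o4', o5', o6', o7'⟩ := old w hw
      rw [o6, o6'] at hzw
      rw [o4, o5, o5', o4']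
      exact h.face z hz w hw hzw
  · intro z hz e he
    rcases (hEA z).1 hz with rfl | rfl | hz
    · simp [tx'] at he
    · simp [tx] at he
    · obtain ⟨o1, -, -, o4, o5, o6, o7⟩ := old z hz
      rw [o1]
      rw [o5] at he
      exact h.edge z hz e he
  · intro z hz
    rcases (hEA z).1 hz with rfl | rfl | hz
    · simp [tx']
    · simp [tx]
    · rw [(old z hz).2.2.2.2.1, h.outer z hz]
      simp [hne z hz]
  · intro z hz
    obtain ⟨h1, h2⟩ := h.special z hz
    have hzA := h.ring.mem z h1
    refine ⟨?_, ?_⟩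
    · simp only [List.mem_append, List.mem_cons] at h1 ⊢
      tauto
    · intro w hw
      rw [(old z hzA).2.2.2.2.2.2]
      rcases (hEA w).1 hw with rfl | rfl | hw
      · rw [Px']
        exact fun h => (hp z hzA h.symm).elim
      · rw [Px]
        exact fun h => (hp z hzA h.symm).elim
      · rw [(old w hw).2.2.2.2.2.2]
        exact h2 w hw
  · intro z hz hzS
    rcases (hEA z).1 hz with rfl | rfl | hz
    · exact jx'
    · exact jx
    · rw [(old z hz).2.2.1]
      exact h.plain z hz hzS

end Diagram

namespace Diagram

variable {V : Type*} {Γ : LabeledGraph V} {b : V} {n : ℤ} {D : Diagram Γ} {S : Finset ℕ}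

/-- Insert an isolated dart `q` after `y`. -/
noncomputable def insLoop (D : Diagram Γ) (y q p : ℕ) (v : V) (m i : ℤ) : Diagram Γ where
  toHMap := D.toHMap.insLoop y q p
  c := Function.update D.c q v
  k := Function.update D.k q m
  j := Function.update D.j q i
  dev := Function.update D.dev q (D.dev (D.φ y))
  ty := Function.update D.ty q none
  pot := D.pot

lemma Pre.insLoop {L₁ L₂ : List ℕ} {y q p : ℕ} (h : Pre b n D (L₁ ++ y :: L₂) S) {v : V} {m i : ℤ}
    (hq : q ∉ D.A) (hp : ∀ z ∈ D.A, D.P z ≠ p)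
    (hstep : D.dev (D.φ y) = artinGen Γ b ^ (n * i) * D.dev (D.φ y) * artinGen Γ v ^ m) :
    Pre b n (D.insLoop y q p v m i) (L₁ ++ y :: q :: L₂) (insert q S) ∧
      Extends D (D.insLoop y q p v m i) := by
  classical
  have hy : y ∈ D.A := h.ring.mem y (by simp)
  have hne : ∀ z ∈ D.A, z ≠ q := fun z hz e => hq (e ▸ hz)
  have wf := h.ring.wf
  have r1 := h.ring.insLoop hq hp
  have φy : (D.φ * swap y q) y = q := by
    rw [Perm.mul_apply, swap_apply_left, wf.suppφ q hq]
  have φq : (D.φ * swap y q) q = D.φ y := by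
    rw [Perm.mul_apply, swap_apply_right]
  have φz : ∀ z, z ≠ y → z ≠ q → (D.φ * swap y q) z = D.φ z := by
    intro z h1 h2
    rw [Perm.mul_apply, swap_apply_of_ne_of_ne h1 h2]
  have πq : D.π q = q := wf.suppπ q hq
  have hφA : ∀ z ∈ D.A, D.φ z ∈ D.A := fun z hz => (wf.suppφ.mem_iff z).2 hz
  have hπA : ∀ z ∈ D.A, D.π z ∈ D.A := fun z hz => (wf.suppπ.mem_iff z).2 hz
  change (D.insLoop y q p v m i).toHMap.Ring _ at r1
  set E := D.insLoop y q p v m i with hE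
  have hEA : ∀ z, z ∈ E.A ↔ z = q ∨ z ∈ D.A := by
    intro z
    change z ∈ insert q D.A ↔ _
    simp
  have hEφ : E.φ = D.φ * swap y q := rfl
  have hEπ : E.π = D.π := rfl
  rw [← hEφ] at φq φy φz
  rw [← hEπ] at πq hπA
  have cq : E.c q = v := by simp [hE, Diagram.insLoop]
  have kq : E.k q = m := by simp [hE, Diagram.insLoop]
  have jq : E.j q = i := by simp [hE, Diagram.insLoop]
  have tq : E.ty q = none := by simp [hE, Diagram.insLoop]
  have dq : E.dev q = D.dev (D.φ y) := by simp [hE, Diagram.insLoop]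
  have Fq : E.F q = D.F y := by simp [hE, Diagram.insLoop, HMap.insLoop]
  have Pq : E.P q = p := by simp [hE, Diagram.insLoop, HMap.insLoop]
  have old : ∀ z ∈ D.A, E.c z = D.c z ∧ E.k z = D.k z ∧ E.j z = D.j z ∧ E.dev z = D.dev z ∧
      E.ty z = D.ty z ∧ E.F z = D.F z ∧ E.P z = D.P z := by
    intro z hz
    simp [hE, Diagram.insLoop, HMap.insLoop, hne z hz]
  clear_value E
  have hty : ∀ z ∈ D.A, D.F z = D.F y → D.ty z = none := by
    intro z hz hzy
    rw [(h.face z hz y hy hzy).1, h.outer y hy]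
    simp
  refine ⟨⟨r1, ?_, ?_, ?_, ?_, ?_, ?_, ?_, ?_⟩, ⟨fun z hz => (hEA z).2 (.inr hz), fun z hz => (old z hz).1,
    fun z hz => (old z hz).2.1, fun z hz => (old z hz).2.2.1, fun z hz => (old z hz).2.2.2.1⟩⟩
  · intro z hz
    rcases (hEA z).1 hz with rfl | hz
    · rw [φq, jq, kq, cq, dq, (old _ (hφA y hy)).2.2.2.1]
      exact hstep
    · obtain ⟨o1, o2, o3, o4, -⟩ := old z hz
      rw [o1, o2, o3, o4, ← h.step z hz]
      by_cases hzy : z = y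
      · rw [hzy, φy, dq]
      · rw [φz z hzy (hne z hz), (old _ (hφA z hz)).2.2.2.1]
  · intro z hz
    rcases (hEA z).1 hz with rfl | hz
    · rw [πq, φq, dq, (old _ (hφA y hy)).2.2.2.1]
    · rw [(old z hz).2.2.2.1, ← h.corner z hz, ← hEπ]
      by_cases hzy : E.π z = y
      · rw [hzy, φy, dq]
      · have h1 := hπA z hz
        rw [φz _ hzy (hne _ h1), (old _ (hφA _ h1)).2.2.2.1]
  · intro z hz w hw
    rcases (hEA z).1 hz with rfl | hz <;> rcases (hEA w).1 hw with rfl | hw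
    · exact fun _ => ⟨rfl, 0, by simp⟩
    · rw [Pq, (old w hw).2.2.2.2.2.2]
      exact fun h => (hp w hw h.symm).elim
    · rw [Pq, (old z hz).2.2.2.2.2.2]
      exact fun h => (hp z hz h).elim
    · obtain ⟨o1, -, -, o4, -, -, o7⟩ := old z hz
      obtain ⟨o1', -, -, o4', -, -, o7'⟩ := old w hw
      rw [o1, o4, o7, o1', o4', o7']
      exact h.vert z hz w hw
  · have key : ∀ z ∈ E.A, E.F z = D.F y → E.ty z = none := by
      intro z hz hzy
      rcases (hEA z).1 hz with rfl | hz
      · exact tq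
      · obtain ⟨-, -, -, -, o5, o6, -⟩ := old z hz
        rw [o6] at hzy
        rw [o5]
        exact hty z hz hzy
    intro z hz w hw hzw
    by_cases hzy : E.F z = D.F y
    · have h1 := key z hz hzy
      have h2 := key w hw (hzw ▸ hzy)
      exact ⟨h1.trans h2.symm, fun e he => by simp [h1] at he⟩
    · have hA : ∀ u ∈ E.A, E.F u ≠ D.F y → u ∈ D.A := by
        intro u hu huy
        rcases (hEA u).1 hu with rfl | hu
        · exact (huy Fq).elim
        · exact hu
      have hw := hA w hw (hzw ▸ hzy)
      have hz := hA z hz hzy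
      obtain ⟨o1, -, -, o4, o5, o6, o7⟩ := old z hz
      obtain ⟨o1', -, -, o4', o5', o6', o7'⟩ := old w hw
      rw [o6, o6'] at hzw
      rw [o4, o5, o5', o4']
      exact h.face z hz w hw hzw
  · intro z hz e he
    rcases (hEA z).1 hz with rfl | hz
    · simp [tq] at he
    · obtain ⟨o1, -, -, o4, o5, o6, o7⟩ := old z hz
      rw [o1]
      rw [o5] at he
      exact h.edge z hz e he
  · intro z hz
    rcases (hEA z).1 hz with rfl | hz
    · simp [tq]
    · rw [(old z hz).2.2.2.2.1, h.outer z hz]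
      simp [hne z hz]
  · intro z hz
    rcases Finset.mem_insert.1 hz with rfl | hz
    · refine ⟨by simp, fun w hw hwz => ?_⟩
      rcases (hEA w).1 hw with rfl | hw
      · rfl
      · rw [Pq, (old w hw).2.2.2.2.2.2] at hwz
        exact (hp w hw hwz).elim
    obtain ⟨h1, h2⟩ := h.special z hz
    have hzA := h.ring.mem z h1
    refine ⟨?_, ?_⟩
    · simp only [List.mem_append, List.mem_cons] at h1 ⊢
      tauto
    · intro w hw
      rw [(old z hzA).2.2.2.2.2.2]
      rcases (hEA w).1 hw with rfl | hw
      · rw [Pq]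
        exact fun h => (hp z hzA h.symm).elim
      · rw [(old w hw).2.2.2.2.2.2]
        exact h2 w hw
  · intro z hz hzS
    rw [Finset.mem_insert, not_or] at hzS
    rcases (hEA z).1 hz with rfl | hz
    · exact (hzS.1 rfl).elim
    · rw [(old z hz).2.2.1]
      exact h.plain z hz hzS.2

lemma exists_fresh (A : Finset ℕ) (f : ℕ → ℕ) : ∃ p, ∀ z ∈ A, f z ≠ p := by
  obtain ⟨p, hp⟩ := Infinite.exists_notMem_finset (A.image f)
  exact ⟨p, fun z hz e => hp (Finset.mem_image.2 ⟨z, hz, e⟩)⟩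

/-- A path and its inverse can be inserted into the free face. -/
lemma Pre.hair (l : List (V × ℤ)) {D : Diagram Γ} {L₁ L₂ : List ℕ} {y : ℕ}
    (h : Pre b n D (L₁ ++ y :: L₂) S) :
    ∃ (D' : Diagram Γ) (X X' : List ℕ), Pre b n D' (L₁ ++ y :: (X ++ X' ++ L₂)) S ∧ Extends D D' ∧
      (∀ z ∈ D.A, D'.P z = D.P z) ∧ D'.syl X = l ∧ lval (D'.syl X') = (lval l)⁻¹ ∧
      (∀ z ∈ X, z ∉ D.A) ∧ (l ≠ [] → ∃ u ∈ X, ∃ v ∈ X', D'.P u = D'.P v) := by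
  induction l generalizing D L₁ L₂ y with
  | nil => exact ⟨D, [], [], h, Extends.refl D, fun _ _ => rfl, rfl, by simp [syl, lval], by simp, by simp⟩
  | cons a l ih =>
    obtain ⟨v, m⟩ := a
    obtain ⟨x, hx⟩ := Infinite.exists_notMem_finset D.A
    obtain ⟨x', hx'⟩ := Infinite.exists_notMem_finset (insert x D.A)
    rw [Finset.mem_insert, not_or] at hx'
    obtain ⟨p, hp⟩ := exists_fresh D.A D.P
    obtain ⟨p', hp'⟩ := exists_fresh (insert x D.A) (Function.update D.P x p)
    have hpp : p ≠ p' := by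
      have := hp' x (Finset.mem_insert_self _ _)
      rwa [Function.update_self] at this
    have hp'1 : ∀ z ∈ D.A, D.P z ≠ p' := fun z hz => by
      have h1 := hp' z (Finset.mem_insert_of_mem hz)
      have h2 : z ≠ x := fun e => hx (e ▸ hz)
      rwa [Function.update_of_ne h2] at h1
    obtain ⟨h1, h2, h3, h4⟩ := h.insPair v m hx hx'.2 (Ne.symm hx'.1) hp hp'1 hpp
    have cx : (D.insPair y x x' p p' v m).c x = v := by
      simp [Diagram.insPair, Ne.symm hx'.1]
    have cx' : (D.insPair y x x' p p' v m).c x' = v := by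
      simp [Diagram.insPair]
    have kx : (D.insPair y x x' p p' v m).k x = m := by
      simp [Diagram.insPair, Ne.symm hx'.1]
    have kx' : (D.insPair y x x' p p' v m).k x' = -m := by
      simp [Diagram.insPair]
    set E := D.insPair y x x' p p' v m
    have hxE : x ∈ E.A := h1.ring.mem x (by simp)
    have hxE' : x' ∈ E.A := h1.ring.mem x' (by simp)
    rw [show L₁ ++ y :: x :: x' :: L₂ = (L₁ ++ [y]) ++ x :: x' :: L₂ by simp] at h1
    obtain ⟨D', X, X', g1, g2, g3, g4, g5, g6, -⟩ := ih h1
    refine ⟨D', x :: X, X' ++ [x'], ?_, h2.trans g2, ?_, ?_, ?_, ?_, fun _ => ?_⟩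
    · convert g1 using 1
      simp
    · intro z hz
      rw [g3 z (h2.sub hz), h4 z hz]
    · rw [syl_cons, g4, g2.c_eq x hxE, g2.k_eq x hxE, cx, kx]
    · rw [syl_append, lval_append, g5, lval_cons, mul_inv_rev, syl_cons, lval_cons,
        g2.c_eq x' hxE', g2.k_eq x' hxE', cx', kx']
      simp [syl, lval]
    · intro z hz
      rcases List.mem_cons.1 hz with rfl | hz
      · exact hx
      · exact fun hzA => g6 z hz (h2.sub hzA)
    · exact ⟨x, by simp, x', by simp, by rw [g3 x hxE, g3 x' hxE', h3]⟩

lemma Pre.step_plain {L : List ℕ} (h : Pre b n D L S) {x : ℕ} (hx : x ∈ D.A) (hS : x ∉ S) :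
    D.dev (D.φ x) = D.dev x * artinGen Γ (D.c x) ^ D.k x := by
  rw [h.step x hx, h.plain x hx hS]
  simp

lemma Pre.dev_chain {L : List ℕ} (h : Pre b n D L S) {X : List ℕ} {y : ℕ}
    (hX : (y :: X).IsChain (fun x y => D.φ x = y)) (hA : ∀ z ∈ X, z ∈ D.A ∧ z ∉ S) :
    D.dev (D.φ ((y :: X).getLast (by simp))) =
      D.dev (D.φ y) * PresentedGroup.mk Γ.artinRels (lval (D.syl X)) := by
  induction X generalizing y with
  | nil => simp [syl, lval]
  | cons x X ih =>
    rw [List.isChain_cons_cons] at hX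
    have hx := hA x (by simp)
    rw [List.getLast_cons (by simp), ih hX.2 fun z hz => hA z (by simp [hz]), hX.1, syl_cons, lval_cons,
      h.step_plain hx.1 hx.2, map_mul, map_zpow, mul_assoc]
    rfl

lemma Pre.dev_chain_mem {L : List ℕ} (h : Pre b n D L S) {X : List ℕ} {y : ℕ}
    (hX : (y :: X).IsChain (fun x y => D.φ x = y)) (hA : ∀ z ∈ X, z ∈ D.A ∧ z ∉ S) {e : Sym2 V}
    (he : ∀ z ∈ X, D.c z ∈ e) {z : ℕ} (hz : z ∈ X) : ∃ u ∈ edgeSub Γ e, D.dev z = D.dev (D.φ y) * u := by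
  induction X generalizing y with
  | nil => simp at hz
  | cons x X ih =>
    rw [List.isChain_cons_cons] at hX
    rcases List.mem_cons.1 hz with rfl | hz
    · exact ⟨1, one_mem _, by rw [hX.1, mul_one]⟩
    · obtain ⟨u, hu, h1⟩ := ih hX.2 (fun z hz => hA z (by simp [hz])) (fun z hz => he z (by simp [hz])) hz
      have hx := hA x (by simp)
      refine ⟨artinGen Γ (D.c x) ^ D.k x * u,
        mul_mem (zpow_mem (gen_mem_edgeSub Γ (he x (by simp))) _) hu, ?_⟩
      rw [h1, hX.1, h.step_plain hx.1 hx.2, mul_assoc]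

/-- Cut off a face reading a relation. -/
noncomputable def pinch (D : Diagram Γ) (y w : ℕ) (X : List ℕ) (f : ℕ) (e : Sym2 V) : Diagram Γ :=
  { D with
    toHMap := D.toHMap.pinch y w fun z => if z ∈ X then f else D.F z
    ty := fun z => if z ∈ X then some e else D.ty z }

lemma Pre.pinch {L₁ X L₂ : List ℕ} {y w : ℕ} (h : Pre b n D (L₁ ++ y :: (X ++ w :: L₂)) S) {e : Sym2 V}
    (he : e ∈ Γ.graph.edgeSet) (hce : ∀ z ∈ X ++ [w], D.c z ∈ e) (hS : ∀ z ∈ X ++ [w], z ∉ S)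
    (hval : PresentedGroup.mk Γ.artinRels (lval (D.syl (X ++ [w]))) = 1)
    (hmate : ∃ u ∈ X ++ [w], ∃ v ∈ L₂, D.P u = D.P v) :
    ∃ D', Pre b n D' (L₁ ++ y :: L₂) S ∧ Extends D D' := by
  obtain ⟨f, hf⟩ := exists_fresh D.A D.F
  have r := h.ring.pinch hf hmate
  have hc := h.ring.chain
  have c0 : (y :: (X ++ [w])).IsChain (fun x y => D.φ x = y) := by
    rw [show L₁ ++ y :: (X ++ w :: L₂) ++ [0] = L₁ ++ y :: ((X ++ [w]) ++ (L₂ ++ [0])) by simp,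
      List.isChain_split, ← List.cons_append] at hc
    exact hc.2.left_of_append
  have hnd := h.ring.nodup
  have hyX : y ∉ X ++ [w] := by
    simp only [List.nodup_append, List.nodup_cons, List.mem_append, List.mem_cons] at hnd ⊢
    grind
  have hXL : ∀ z ∈ X ++ [w], z ∈ L₁ ++ y :: (X ++ w :: L₂) := fun z hz => by
    simp only [List.mem_append, List.mem_cons] at hz ⊢
    tauto
  have hnot : ∀ z ∈ L₁ ++ y :: L₂, z ∉ X ++ [w] := by
    simp only [List.nodup_append, List.nodup_cons, List.mem_append, List.mem_cons] at hnd ⊢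
    grind
  have hXA := fun z hz => h.ring.mem z (hXL z hz)
  have hy : y ∈ D.A := h.ring.mem y (by simp)
  have hyw : y ≠ w := fun e => hyX (by simp [e])
  have hdev : D.dev (D.φ w) = D.dev (D.φ y) := by
    have := h.dev_chain c0 fun z hz => ⟨hXA z hz, hS z hz⟩
    rwa [hval, mul_one, List.getLast_cons (by simp), List.getLast_append_singleton] at this
  have hmem : ∀ z ∈ X ++ [w], ∃ u ∈ edgeSub Γ e, D.dev z = D.dev (D.φ y) * u := fun z hz =>
    h.dev_chain_mem c0 (fun z hz => ⟨hXA z hz, hS z hz⟩) hce hz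
  have hφ : ∀ z, D.dev ((D.φ * swap y w) z) = D.dev (D.φ z) := by
    intro z
    rw [Perm.mul_apply]
    by_cases h1 : z = y
    · rw [h1, swap_apply_left, hdev]
    by_cases h2 : z = w
    · rw [h2, swap_apply_right, hdev]
    · rw [swap_apply_of_ne_of_ne h1 h2]
  refine ⟨D.pinch y w (X ++ [w]) f e, ⟨r, ?_, ?_, h.vert, ?_, ?_, ?_, ?_, h.plain⟩, ⟨fun _ h => h, fun _ _ => rfl,
    fun _ _ => rfl, fun _ _ => rfl, fun _ _ => rfl⟩⟩
  · exact fun z hz => (hφ z).trans (h.step z hz)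
  · exact fun z hz => (hφ (D.π z)).trans (h.corner z hz)
  · intro z hz w' hw'
    change (if z ∈ X ++ [w] then f else D.F z) = (if w' ∈ X ++ [w] then f else D.F w') →
      (if z ∈ X ++ [w] then some e else D.ty z) = (if w' ∈ X ++ [w] then some e else D.ty w') ∧
      ∀ e', (if z ∈ X ++ [w] then some e else D.ty z) = some e' → ∃ u ∈ edgeSub Γ e', D.dev w' = D.dev z * u
    by_cases h1 : z ∈ X ++ [w] <;> by_cases h2 : w' ∈ X ++ [w]
    · rw [if_pos h1, if_pos h1, if_pos h2, if_pos h2]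
      intro _
      refine ⟨rfl, fun e' he' => ?_⟩
      cases he'
      obtain ⟨u, hu, hzu⟩ := hmem z h1
      obtain ⟨u', hu', hwu⟩ := hmem w' h2
      exact ⟨u⁻¹ * u', mul_mem (inv_mem hu) hu', by rw [hzu, hwu]; group⟩
    · rw [if_pos h1, if_neg h2]
      exact fun h => (hf w' hw' h.symm).elim
    · rw [if_neg h1, if_pos h2]
      exact fun h => (hf z hz h).elim
    · rw [if_neg h1, if_neg h1, if_neg h2, if_neg h2]
      exact h.face z hz w' hw'
  · intro z hz e'
    change (if z ∈ X ++ [w] then some e else D.ty z) = some e' → _ ∧ D.c z ∈ e'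
    split_ifs with h1
    · intro h2
      cases h2
      exact ⟨he, hce z h1⟩
    · exact h.edge z hz e'
  · intro z hz
    change (if z ∈ X ++ [w] then some e else D.ty z) = none ↔ _
    split_ifs with h1
    · exact ⟨fun h2 => h2.elim, fun h2 => (hnot z h2 h1).elim⟩
    · rw [h.outer z hz]
      simp only [List.mem_append, List.mem_cons, List.not_mem_nil] at h1 ⊢
      tauto
  · intro z hz
    obtain ⟨h1, h2⟩ := h.special z hz
    refine ⟨?_, h2⟩
    have h3 : z ∉ X ++ [w] := fun h4 => hS z h4 hz
    simp only [List.mem_append, List.mem_cons, List.not_mem_nil] at h1 h3 ⊢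
    tauto

end Diagram

section Spelling

variable {V : Type*}

lemma exists_lval_inv {T : Set V} (l : List (V × ℤ)) (hl : ∀ p ∈ l, p.1 ∈ T) :
    ∃ l' : List (V × ℤ), (∀ p ∈ l', p.1 ∈ T) ∧ lval l' = (lval l)⁻¹ := by
  induction l with
  | nil => exact ⟨[], by simp, by simp [lval]⟩
  | cons a l ih =>
    obtain ⟨l', h1, h2⟩ := ih fun p hp => hl p (by simp [hp])
    refine ⟨l' ++ [(a.1, -a.2)], fun p hp => ?_, ?_⟩
    · rcases List.mem_append.1 hp with hp | hp
      · exact h1 p hp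
      · rw [List.mem_singleton.1 hp]
        exact hl a (by simp)
    · rw [lval_append, lval_cons, lval_cons, h2, lval_nil, zpow_neg, mul_one, mul_inv_rev]

lemma exists_spelling {T : Set V} {g : FreeGroup V} (hg : g ∈ Subgroup.closure (FreeGroup.of '' T)) :
    ∃ l : List (V × ℤ), (∀ p ∈ l, p.1 ∈ T) ∧ lval l = g := by
  induction hg using Subgroup.closure_induction with
  | mem x hx =>
    obtain ⟨v, hv, rfl⟩ := hx
    exact ⟨[(v, 1)], by simpa using hv, by simp [lval]⟩
  | one => exact ⟨[], by simp, rfl⟩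
  | mul x y _ _ hx hy =>
    obtain ⟨l, h1, rfl⟩ := hx
    obtain ⟨l', h1', rfl⟩ := hy
    refine ⟨l ++ l', fun p hp => ?_, lval_append l l'⟩
    rcases List.mem_append.1 hp with hp | hp
    · exact h1 p hp
    · exact h1' p hp
  | inv x _ hx =>
    obtain ⟨l, h1, rfl⟩ := hx
    exact exists_lval_inv l h1

lemma exists_lval_eq (g : FreeGroup V) : ∃ l : List (V × ℤ), lval l = g := by
  obtain ⟨l, -, h⟩ := exists_spelling (T := Set.univ) (g := g) (by
    rw [Set.image_univ, FreeGroup.closure_range_of]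
    trivial)
  exact ⟨l, h⟩

lemma altProd_mem {G : Type*} [Group G] {H : Subgroup G} (m : ℕ) {x y : G} (hx : x ∈ H) (hy : y ∈ H) :
    altProd m x y ∈ H := by
  induction m generalizing x y with
  | zero => exact one_mem H
  | succ m ih => exact mul_mem hx (ih hy hx)

variable (Γ : LabeledGraph V)

lemma artinRels_inv {r : FreeGroup V} (hr : r ∈ Γ.artinRels) : r⁻¹ ∈ Γ.artinRels := by
  obtain ⟨a, b, hab, rfl⟩ := hr
  refine ⟨b, a, hab.symm, ?_⟩
  rw [mul_inv_rev, inv_inv, Γ.label_symm b a]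

lemma artinRels_spelling {r : FreeGroup V} (hr : r ∈ Γ.artinRels) :
    ∃ e ∈ Γ.graph.edgeSet, ∃ l : List (V × ℤ), l ≠ [] ∧ (∀ p ∈ l, p.1 ∈ e) ∧ lval l = r := by
  obtain ⟨a, b, hab, rfl⟩ := hr
  have ha : FreeGroup.of a ∈ Subgroup.closure (FreeGroup.of '' {v | v ∈ s(a, b)}) :=
    Subgroup.subset_closure ⟨a, by simp, rfl⟩
  have hb : FreeGroup.of b ∈ Subgroup.closure (FreeGroup.of '' {v | v ∈ s(a, b)}) :=
    Subgroup.subset_closure ⟨b, by simp, rfl⟩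
  obtain ⟨l, h1, h2⟩ := exists_spelling
    (mul_mem (altProd_mem (Γ.label a b) ha hb) (inv_mem (altProd_mem (Γ.label a b) hb ha)))
  refine ⟨s(a, b), hab, (a, 0) :: l, by simp, fun p hp => ?_, ?_⟩
  · rcases List.mem_cons.1 hp with rfl | hp
    · simp
    · exact h1 p hp
  · rw [lval_cons, h2, zpow_zero, one_mul]

end Spelling

namespace Diagram

variable {V : Type*} {Γ : LabeledGraph V} {b : V} {n : ℤ} {D : Diagram Γ} {S : Finset ℕ}

lemma Pre.mem_of_special {L : List ℕ} (h : Pre b n D L S) {x : ℕ} (hx : x ∈ S) : x ∈ D.A :=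
  h.ring.mem x (h.special x hx).1

/-- The word read along the free face can be multiplied by a conjugate of a relator. -/
lemma Pre.mul_relator {L : List ℕ} (h : Pre b n D L S) (g : FreeGroup V) {r : FreeGroup V}
    (hr : r ∈ Γ.artinRels) :
    ∃ D' L', Pre b n D' L' S ∧ Extends D D' ∧ lval (D'.syl L') = lval (D.syl L) * (g * r * g⁻¹) := by
  obtain ⟨l, rfl⟩ := exists_lval_eq g
  obtain ⟨e, he, lr, hlr, hle, hlv⟩ := artinRels_spelling Γ (artinRels_inv Γ hr)
  obtain ⟨L₀, y, rfl⟩ : ∃ L₀ y, L = L₀ ++ [y] := by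
    rcases List.eq_nil_or_concat' L with rfl | h1
    · have := h.ring.head
      simp at this
    · exact h1
  obtain ⟨D₁, H, H', h1, e1, -, s1, v1, -, -⟩ := h.hair l
  obtain ⟨H₀, y', hy'⟩ : ∃ H₀ y', y :: H = H₀ ++ [y'] := by
    rcases List.eq_nil_or_concat' (y :: H) with h2 | h2
    · simp at h2
    · exact h2
  have hL : L₀ ++ y :: (H ++ H' ++ []) = (L₀ ++ H₀) ++ y' :: H' := by
    rw [List.append_nil, ← List.cons_append, hy']
    simp
  rw [hL] at h1
  obtain ⟨D₂, R, R', h2, e2, -, s2, v2, hR, hm⟩ := h1.hair lr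
  obtain ⟨u, hu, v, hv, huv⟩ := hm hlr
  obtain ⟨R₀, w, rfl⟩ : ∃ R₀ w, R = R₀ ++ [w] := by
    rcases List.eq_nil_or_concat' R with rfl | h1
    · simp at hu
    · exact h1
  rw [show (L₀ ++ H₀) ++ y' :: (R₀ ++ [w] ++ R' ++ H') = (L₀ ++ H₀) ++ y' :: (R₀ ++ w :: (R' ++ H')) by simp] at h2
  have hc : ∀ z ∈ R₀ ++ [w], D₂.c z ∈ e := by
    intro z hz
    have : (D₂.c z, D₂.k z) ∈ D₂.syl (R₀ ++ [w]) := List.mem_map.2 ⟨z, hz, rfl⟩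
    rw [s2] at this
    exact hle _ this
  obtain ⟨D₃, h3, e3⟩ := h2.pinch he hc (fun z hz hzS => hR z hz (h1.mem_of_special hzS)) (by
    rw [s2, hlv]
    exact PresentedGroup.mk_eq_one_iff.2 (Subgroup.subset_normalClosure (artinRels_inv Γ hr)))
    ⟨u, hu, v, by simp [hv], huv⟩
  refine ⟨D₃, _, h3, (e1.trans e2).trans e3, ?_⟩
  have hL' : ∀ z ∈ (L₀ ++ H₀) ++ y' :: (R' ++ H'), z ∈ D₂.A := by
    intro z hz
    refine h2.ring.mem z ?_
    simp only [List.mem_append, List.mem_cons] at hz ⊢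
    tauto
  rw [e3.syl_eq hL', show (L₀ ++ H₀) ++ y' :: (R' ++ H') = (L₀ ++ [y] ++ H) ++ (R' ++ H') by
    rw [List.append_assoc L₀ [y] H, List.singleton_append, hy']
    simp only [List.append_assoc, List.singleton_append]]
  have m1 : ∀ z ∈ L₀ ++ [y] ++ H, z ∈ D₁.A := by
    intro z hz
    refine h1.ring.mem z ?_
    rw [← hL]
    simp only [List.mem_append, List.mem_cons] at hz ⊢
    tauto
  have m2 : ∀ z ∈ H', z ∈ D₁.A := fun z hz => h1.ring.mem z (by simp [hz])
  rw [syl_append, e2.syl_eq m1, syl_append, e1.syl_eq h.ring.mem, syl_append _ R' H', e2.syl_eq m2,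
    lval_append, lval_append, lval_append, v2, v1, s1, hlv]
  group

lemma Pre.mul_normalClosure {g : FreeGroup V} (hg : g ∈ Subgroup.normalClosure Γ.artinRels) :
    ∀ {D : Diagram Γ} {L : List ℕ}, Pre b n D L S →
      ∃ D' L', Pre b n D' L' S ∧ Extends D D' ∧ lval (D'.syl L') = lval (D.syl L) * g := by
  have key : ∀ x ∈ Group.conjugatesOfSet Γ.artinRels, ∀ {D : Diagram Γ} {L : List ℕ}, Pre b n D L S →
      ∃ D' L', Pre b n D' L' S ∧ Extends D D' ∧ lval (D'.syl L') = lval (D.syl L) * x := by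
    intro x hx D L h
    obtain ⟨r, hr, hrx⟩ := Group.mem_conjugatesOfSet_iff.1 hx
    obtain ⟨c, rfl⟩ := isConj_iff.1 hrx
    exact h.mul_relator c hr
  unfold Subgroup.normalClosure at hg
  induction hg using Subgroup.closure_induction'' with
  | mem x hx => exact key x hx
  | inv_mem x hx =>
    obtain ⟨r, hr, hrx⟩ := Group.mem_conjugatesOfSet_iff.1 hx
    obtain ⟨c, rfl⟩ := isConj_iff.1 hrx
    intro D L
    refine key _ (Group.mem_conjugatesOfSet_iff.2 ⟨r⁻¹, artinRels_inv Γ hr, isConj_iff.2 ⟨c, ?_⟩⟩)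
    group
  | one => exact fun {D L} h => ⟨D, L, h, Extends.refl D, by simp⟩
  | mul x y _ _ hx hy =>
    intro D L h
    obtain ⟨D₁, L₁, h1, e1, v1⟩ := hx h
    obtain ⟨D₂, L₂, h2, e2, v2⟩ := hy h1
    exact ⟨D₂, L₂, h2, e1.trans e2, by rw [v2, v1, mul_assoc]⟩

end Diagram

lemma HMap.Ring.sameCycle {M : HMap} {L : List ℕ} (h : M.Ring L) {z : ℕ} (hz : z ∈ L) : SameCycle M.φ z 0 := by
  obtain ⟨L₁, L₂, rfl⟩ := List.append_of_mem hz
  have hc := h.chain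
  rw [List.append_assoc, List.cons_append] at hc
  exact HMap.sameCycle_of_chain hc.right_of_append

lemma hol_eq_of_isolated {A : Finset ℕ} {j : ℕ → ℤ} {f : ℕ → ℕ} {x : ℕ} (hx : x ∈ A)
    (h : ∀ z ∈ A, f z = f x → z = x) : hol A j f x = j x := by
  classical
  unfold hol
  refine (Finset.sum_eq_single x ?_ ?_)
  · intro z hz hzx
    rw [Finset.mem_filter] at hz
    exact (hzx (h z hz.1 hz.2)).elim
  · exact fun h1 => (h1 (Finset.mem_filter.2 ⟨hx, rfl⟩)).elim

lemma hol_eq_zero {A : Finset ℕ} {j : ℕ → ℤ} {f : ℕ → ℕ} {x : ℕ}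
    (h : ∀ z ∈ A, f z = f x → j z = 0) : hol A j f x = 0 := by
  unfold hol
  refine Finset.sum_eq_zero fun z hz => ?_
  rw [Finset.mem_filter] at hz
  exact h z hz.1 hz.2

namespace Diagram

variable {V : Type*} {Γ : LabeledGraph V} {b : V} {n : ℤ} {D : Diagram Γ}

lemma Pre.pot {L : List ℕ} {S : Finset ℕ} (h : Pre b n D L S) (hv : lval (D.syl L) = 1) :
    ∃ pot : ℕ → FreeGroup V, ∀ x ∈ L, pot (D.φ x) = pot x * FreeGroup.of (D.c x) ^ D.k x := by
  refine ⟨fun z => lval (D.syl (L.takeWhile (· ≠ z))), fun x hx => ?_⟩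
  have take : ∀ (A B : List ℕ) (z : ℕ), L = A ++ z :: B → L.takeWhile (· ≠ z) = A := by
    rintro A B z rfl
    have hnd := h.ring.nodup
    rw [List.takeWhile_append_of_pos]
    · simp
    · intro a ha
      simp only [List.nodup_append, List.nodup_cons, List.mem_cons] at hnd
      simpa using hnd.2.2 a ha z (.inl rfl)
  obtain ⟨A, B, hL⟩ := List.append_of_mem hx
  have hc := h.ring.chain
  rw [hL, List.append_assoc, List.cons_append] at hc
  have hc := hc.right_of_append
  change lval (D.syl (L.takeWhile _)) = lval (D.syl (L.takeWhile _)) * _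
  rw [take A B x hL]
  cases B with
  | nil =>
    rw [List.nil_append, List.isChain_cons_cons] at hc
    have hh := h.ring.head
    obtain ⟨M, hM⟩ : ∃ M, L = [] ++ 0 :: M := by
      cases hL' : L with
      | nil => simp [hL'] at hx
      | cons a M =>
        rw [hL'] at hh
        exact ⟨M, by simpa using hh⟩
    rw [hc.1, take [] M 0 hM]
    rw [hL, syl_append, lval_append, syl_cons, lval_cons] at hv
    rw [show D.syl ([] : List ℕ) = [] from rfl, lval_nil, mul_one] at hv
    exact hv.symm
  | cons x' B =>
    rw [List.cons_append, List.isChain_cons_cons] at hc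
    rw [hc.1, take (A ++ [x]) B x' (by simp [hL]), syl_append, lval_append, syl_cons, lval_cons]
    simp [syl, lval]

lemma Pre.valid {L : List ℕ} {q : ℕ} (h : Pre b n D L {q, 0}) (h0 : D.j 0 = 1) (hq : D.j q = -1)
    (g0 : D.Good b true 0) (gq : ¬ D.Good b true q) (hv : lval (D.syl L) = 1) :
    ∃ D' : Diagram Γ, D'.Valid b n := by
  classical
  obtain ⟨pot, hpot⟩ := h.pot hv
  have hq0 : q ≠ 0 := fun e => by
    rw [e, h0] at hq
    norm_num at hq
  have m0 := h.special 0 (by simp)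
  have mq := h.special q (by simp)
  have A0 := h.ring.mem 0 m0.1
  have Aq := h.ring.mem q mq.1
  have hnone : ∀ z ∈ D.A, D.ty z = none → ∀ w ∈ L, D.F w = D.F z := fun z hz h1 w hw =>
    (h.ring.face_eq hw).trans (h.ring.face_eq ((h.outer z hz).1 h1)).symm
  have hF : ∀ x ∈ D.A, hol D.A D.j D.F x = 0 := by
    intro x hx
    by_cases hty : D.ty x = none
    · unfold hol
      have hsub : ({q, 0} : Finset ℕ) ⊆ D.A.filter fun z => D.F z = D.F x := by
        intro z hz
        rw [Finset.mem_filter]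
        exact ⟨h.mem_of_special hz, hnone x hx hty z (h.special z hz).1⟩
      have := Finset.sum_subset (f := D.j) hsub fun z hz hzS => h.plain z (Finset.mem_filter.1 hz).1 hzS
      rw [Finset.sum_pair hq0, h0, hq] at this
      norm_num at this
      convert this.symm
    · refine hol_eq_zero fun z hz hzx => h.plain z hz fun hzS => hty ?_
      rw [← (h.face z hz x hx hzx).1, h.outer z hz]
      exact (h.special z hzS).1
  have hP : ∀ x ∈ D.A, hol D.A D.j D.P x ≠ 0 → x = q ∨ x = 0 := by
    intro x hx
    contrapose!
    rintro ⟨h1, h2⟩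
    refine hol_eq_zero fun z hz hzx => h.plain z hz fun hzS => ?_
    obtain rfl := (h.special z hzS).2 x hx hzx.symm
    simp [h1, h2] at hzS
  have good_conj : ∀ (d : ArtinGroup Γ) (v : V) (m : ℤ),
      d * artinGen Γ v ^ m * artinGen Γ v * (d * artinGen Γ v ^ m)⁻¹ = d * artinGen Γ v * d⁻¹ := by
    intro d v m
    group
  have good : ∀ s, ∀ z ∈ D.A, ∀ w ∈ D.A, D.cell s z = D.cell s w → D.Good b s z → D.Good b s w := by
    intro s z hz w hw hzw
    cases s
    · rintro ⟨e, he, u, hu, t, ht, h1⟩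
      obtain ⟨f1, f2⟩ := h.face z hz w hw hzw
      obtain ⟨u', hu', hwz⟩ := f2 e he
      refine ⟨e, f1 ▸ he, u'⁻¹ * u, mul_mem (inv_mem hu') hu, t, ht, ?_⟩
      rwa [hwz, mul_assoc (D.dev z), mul_inv_cancel_left]
    · intro h1
      obtain ⟨v1, m, v2⟩ := h.vert z hz w hw hzw
      change D.dev w * artinGen Γ (D.c w) * (D.dev w)⁻¹ = _
      rw [v2, ← v1, good_conj]
      exact h1
  refine ⟨{ D with pot := pot }, h.ring.wf, h.ring.planar, h.step, h.corner,
    fun z hz w hw hzw => (h.vert z hz w hw hzw).1, fun z hz w hw hzw => (h.face z hz w hw hzw).1, h.edge,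
    fun s z hz w hw hzw => ⟨good s z hz w hw hzw, good s w hw z hz hzw.symm⟩, ⟨⟨true, 0, A0, ?_⟩, ?_⟩, ?_,
    fun x hx _ => hF x hx, fun x hx h1 => hpot x ((h.outer x hx).1 h1)⟩
  · change hol D.A D.j D.P 0 ≠ 0
    rw [hol_eq_of_isolated A0 m0.2, h0]
    norm_num
  · intro s s' x hx y hy h1 h2 hg
    cases s
    · exact (h1 (hF x hx)).elim
    cases s'
    · exact (h2 (hF y hy)).elim
    change D.Good b true x ↔ D.Good b true y at hg
    refine ⟨rfl, ?_⟩
    rcases hP x hx h1 with rfl | rfl <;> rcases hP y hy h2 with rfl | rfl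
    · rfl
    · exact (gq (hg.2 g0)).elim
    · exact (gq (hg.1 g0)).elim
    · rfl
  · exact fun z hz w hw h1 h2 => (h.ring.sameCycle ((h.outer z hz).1 h1)).trans
      (h.ring.sameCycle ((h.outer w hw).1 h2)).symm

/-- The diagram with a single dart. -/
def single (Γ : LabeledGraph V) (b : V) (n : ℤ) : Diagram Γ where
  A := {0}
  φ := 1
  π := 1
  F := fun _ => 0
  P := fun _ => 0
  c := fun _ => b
  k := fun _ => -n
  j := fun _ => 1
  dev := fun _ => 1
  ty := fun _ => none
  pot := fun _ => 1

lemma pre_single (Γ : LabeledGraph V) (b : V) (n : ℤ) : Pre b n (single Γ b n) [0] {0} := by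
  refine ⟨⟨⟨fun _ _ => rfl, fun _ _ => rfl, fun _ => rfl, fun _ => rfl⟩, ?_, by simp, ?_, rfl, ?_⟩,
    ?_, fun _ _ => rfl, ?_, ?_, ?_, ?_, ?_, ?_⟩
  · intro l _
    have hcyc : ∀ g : Perm ℕ, cyc {0} g = 1 := fun g => by
      let := Classical.decEq (Quotient (SameCycle.setoid g))
      exact (congrArg Finset.card (Finset.image_singleton _ _)).trans (Finset.card_singleton _)
    simp [HMap.chi, single, nval, hcyc]
  · simp [single]
  · simp [single]
  · intro x _
    simp [single]
  · exact fun z _ w _ _ => ⟨rfl, 0, by simp [single]⟩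
  · exact fun z _ w _ _ => ⟨rfl, fun e he => by simp [single] at he⟩
  · exact fun z _ e he => by simp [single] at he
  · intro z hz
    simpa [single] using hz
  · intro x hx
    rw [Finset.mem_singleton.1 hx]
    exact ⟨by simp, fun z hz _ => Finset.mem_singleton.1 hz⟩
  · exact fun x hx h => (h hx).elim

end Diagram

/-- In a `2`-dimensional Artin group, conjugate generators with a common power are equal. -/
lemma conj_gen_eq {V : Type*} {Γ : LabeledGraph V} (h2d : Γ.TwoDimensional) {a b : V}
    {g : ArtinGroup Γ} {n : ℤ} (hn : n ≠ 0) (h : g * artinGen Γ a ^ n * g⁻¹ = artinGen Γ b ^ n) :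
    g * artinGen Γ a * g⁻¹ = artinGen Γ b := by
  by_contra hne
  obtain ⟨g, rfl⟩ := PresentedGroup.mk_surjective _ g
  obtain ⟨l, rfl⟩ := exists_lval_eq g
  set D₀ := Diagram.single Γ b n with hD₀
  have h0 : Diagram.Pre b n D₀ ([] ++ 0 :: []) {0} := Diagram.pre_single Γ b n
  have z0 : 0 ∈ D₀.A := by simp [hD₀, Diagram.single]
  obtain ⟨D₁, X, X', h1, e1, -, s1, v1, hX, -⟩ := h0.hair l
  rw [List.nil_append, List.append_nil] at h1
  have hc : (0 :: X).IsChain (fun x y => D₁.φ x = y) := by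
    have := h1.ring.chain
    rw [show 0 :: (X ++ X') ++ [0] = (0 :: X) ++ (X' ++ [0]) by simp] at this
    exact this.left_of_append
  have hdev := h1.dev_chain hc fun z hz => ⟨h1.ring.mem z (by simp [hz]), fun h2 => by
    rw [Finset.mem_singleton.1 h2] at hz
    exact hX 0 hz z0⟩
  have hdev0 : D₁.dev (D₁.φ 0) = 1 := by
    rw [h1.step 0 (e1.sub z0), e1.j_eq 0 z0, e1.dev_eq 0 z0, e1.c_eq 0 z0, e1.k_eq 0 z0]
    simp [hD₀, Diagram.single]
  obtain ⟨H, y, hy⟩ : ∃ H y, 0 :: X = H ++ [y] := by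
    rcases List.eq_nil_or_concat' (0 :: X) with h2 | h2
    · simp at h2
    · exact h2
  have hlast : (0 :: X).getLast (by simp) = y := by
    simp only [hy, List.getLast_append_singleton]
  rw [hdev0, one_mul, s1, hlast] at hdev
  rw [← List.cons_append, hy, List.append_assoc, List.singleton_append] at h1
  obtain ⟨q, hq⟩ := Infinite.exists_notMem_finset D₁.A
  obtain ⟨p, hp⟩ := Diagram.exists_fresh D₁.A D₁.P
  obtain ⟨h2, e2⟩ := h1.insLoop (v := a) (m := n) (i := -1) hq hp (by
    rw [hdev, mul_assoc, mul_inv_eq_iff_eq_mul.1 h, show n * -1 = -n by ring, zpow_neg, inv_mul_cancel_left])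
  have cq : (D₁.insLoop y q p a n (-1)).c q = a := by simp [Diagram.insLoop]
  have kq : (D₁.insLoop y q p a n (-1)).k q = n := by simp [Diagram.insLoop]
  have jq : (D₁.insLoop y q p a n (-1)).j q = -1 := by simp [Diagram.insLoop]
  have dq : (D₁.insLoop y q p a n (-1)).dev q = D₁.dev (D₁.φ y) := by simp [Diagram.insLoop]
  set D₂ := D₁.insLoop y q p a n (-1)
  have q2 : q ∈ D₂.A := h2.ring.mem q (by simp)
  have m1 : ∀ z ∈ 0 :: X, z ∈ D₁.A := fun z hz => by
    rw [hy] at hz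
    refine h1.ring.mem z ?_
    simp only [List.mem_append, List.mem_cons] at hz ⊢
    tauto
  have m2 : ∀ z ∈ X', z ∈ D₁.A := fun z hz => h1.ring.mem z (by simp [hz])
  have hval : lval (D₂.syl (H ++ y :: q :: X')) =
      (FreeGroup.of b) ^ (-n) * (lval l * FreeGroup.of a ^ n * (lval l)⁻¹) := by
    rw [show H ++ y :: q :: X' = (0 :: X) ++ ([q] ++ X') by rw [hy]; simp, Diagram.syl_append,
      Diagram.syl_append, lval_append, lval_append, e2.syl_eq m1, e2.syl_eq m2, Diagram.syl_cons, lval_cons,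
      s1, v1, e1.c_eq 0 z0, e1.k_eq 0 z0, Diagram.syl_cons, lval_cons, cq, kq]
    simp [Diagram.syl, lval, hD₀, Diagram.single, mul_assoc]
  have hker : (lval (D₂.syl (H ++ y :: q :: X')))⁻¹ ∈ Subgroup.normalClosure Γ.artinRels := by
    refine inv_mem (PresentedGroup.mk_eq_one_iff.1 ?_)
    rw [hval]
    simp only [map_mul, map_zpow, map_inv]
    change artinGen Γ b ^ (-n) * (_ * artinGen Γ a ^ n * _) = 1
    rw [h, zpow_neg, inv_mul_cancel]
  obtain ⟨D₃, L, h3, e3, v3⟩ := Diagram.Pre.mul_normalClosure hker h2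
  rw [mul_inv_cancel] at v3
  have z1 := e1.sub z0
  have z2 := e2.sub z1
  have j0 : D₃.j 0 = 1 := by
    rw [e3.j_eq 0 z2, e2.j_eq 0 z1, e1.j_eq 0 z0]
    rfl
  have jq' : D₃.j q = -1 := by rw [e3.j_eq q q2, jq]
  have g0 : D₃.Good b true 0 := by
    change D₃.dev 0 * artinGen Γ (D₃.c 0) * (D₃.dev 0)⁻¹ = _
    rw [e3.dev_eq 0 z2, e2.dev_eq 0 z1, e1.dev_eq 0 z0, e3.c_eq 0 z2, e2.c_eq 0 z1, e1.c_eq 0 z0]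
    simp [hD₀, Diagram.single]
  have gq : ¬ D₃.Good b true q := by
    change ¬ D₃.dev q * artinGen Γ (D₃.c q) * (D₃.dev q)⁻¹ = _
    rw [e3.dev_eq q q2, e3.c_eq q q2, dq, cq, hdev]
    exact hne
  obtain ⟨D, hD⟩ := h3.valid j0 jq' g0 gq v3
  exact hD.false hn h2d

lemma finite_words {G : Type*} (T : Set G) (hT : T.Finite) (N : ℕ) :
    {l : List G | l.length ≤ N ∧ ∀ x ∈ l, x ∈ T}.Finite := by
  have := hT.to_subtype
  have h := List.finite_length_le T N
  refine (h.image (List.map Subtype.val)).subset ?_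
  rintro l ⟨h1, h2⟩
  refine ⟨l.pmap Subtype.mk h2, ?_, ?_⟩
  · simpa using h1
  · simp [List.map_pmap]

lemma finite_ball {G : Type*} [Group G] {S : Set G} (hS : S.Finite) (hgen : Subgroup.closure S = ⊤)
    (D : ℝ) : {f : G | (wordLength S f : ℝ) < D}.Finite := by
  have hT : {x : G | x ∈ S ∨ x⁻¹ ∈ S}.Finite :=
    (hS.union hS.inv).subset fun x hx => hx
  refine ((finite_words _ hT ⌈D⌉₊).image List.prod).subset ?_
  intro f hf
  have hne : {n | ∃ l : List G, l.length = n ∧ (∀ x ∈ l, x ∈ S ∨ x⁻¹ ∈ S) ∧ l.prod = f}.Nonempty := by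
    have hf' : f ∈ (Subgroup.closure S).toSubmonoid := by simp [hgen]
    rw [Subgroup.closure_toSubmonoid] at hf'
    obtain ⟨l, h1, h2⟩ := Submonoid.exists_list_of_mem_closure hf'
    exact ⟨_, l, rfl, h1, h2⟩
  obtain ⟨l, h1, h2, h3⟩ := Nat.sInf_mem hne
  refine ⟨l, ⟨?_, h2⟩, h3⟩
  rw [h1]
  exact Nat.cast_le.1 ((le_of_lt hf).trans (Nat.le_ceil D))

variable {V : Type*} {Γ : LabeledGraph V}

lemma zpowers_conj_eq [Finite V] (h2d : Γ.TwoDimensional) {a₁ a₂ : V} {g₁ g₂ : ArtinGroup Γ}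
    (hpar : CoarseParallel (artinDist Γ)
        (leftCosetSet g₁ (Subgroup.zpowers (artinGen Γ a₁)))
        (leftCosetSet g₂ (Subgroup.zpowers (artinGen Γ a₂)))) :
    Subgroup.map (MulAut.conj g₁).toMonoidHom (Subgroup.zpowers (artinGen Γ a₁)) =
      Subgroup.map (MulAut.conj g₂).toMonoidHom (Subgroup.zpowers (artinGen Γ a₂)) := by
  obtain ⟨D, hD, -⟩ := hpar
  have hfin := finite_ball (Set.finite_range (artinGen Γ))
    (PresentedGroup.closure_range_of Γ.artinRels) D
  have key : ∀ k : ℤ, ∃ m : ℤ, (g₁ * artinGen Γ a₁ ^ k)⁻¹ * (g₂ * artinGen Γ a₂ ^ m) ∈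
      {f | (wordLength (Set.range (artinGen Γ)) f : ℝ) < D} := by
    intro k
    obtain ⟨_, ⟨_, ⟨m, rfl⟩, rfl⟩, h⟩ := hD _ ⟨artinGen Γ a₁ ^ k, ⟨k, rfl⟩, rfl⟩
    exact ⟨m, h⟩
  choose m hm using key
  obtain ⟨k, -, k', -, hk, h⟩ := Set.infinite_univ.exists_ne_map_eq_of_mapsTo (fun k _ => hm k) hfin
  have h1 : (g₂⁻¹ * g₁) * artinGen Γ a₁ ^ (k' - k) * (g₂⁻¹ * g₁)⁻¹ = artinGen Γ a₂ ^ (m k' - m k) := by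
    calc _ = g₂⁻¹ * g₁ * artinGen Γ a₁ ^ k' *
          ((g₁ * artinGen Γ a₁ ^ k)⁻¹ * (g₂ * artinGen Γ a₂ ^ m k)) * (artinGen Γ a₂ ^ m k)⁻¹ := by group
      _ = _ := by
        rw [h]
        group
  have hdeg := congrArg (deg Γ) h1
  rw [map_mul, map_mul, map_inv, mul_inv_cancel_comm, deg_gen_zpow, deg_gen_zpow] at hdeg
  rw [← Multiplicative.ofAdd.injective hdeg] at h1
  have h3 := conj_gen_eq h2d (sub_ne_zero.2 hk.symm) h1
  have h4 : g₂ * artinGen Γ a₂ * g₂⁻¹ = g₁ * artinGen Γ a₁ * g₁⁻¹ := by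
    rw [← h3]
    group
  rw [MonoidHom.map_zpowers, MonoidHom.map_zpowers]
  change Subgroup.zpowers (g₁ * artinGen Γ a₁ * g₁⁻¹) = Subgroup.zpowers (g₂ * artinGen Γ a₂ * g₂⁻¹)
  rw [h4]

lemma image_leftCosetSet {G : Type*} [Group G] {g h : G} {H : Subgroup G}
    (hh : h ∈ Subgroup.map (MulAut.conj g).toMonoidHom H) :
    (fun x => h * x) '' leftCosetSet g H = leftCosetSet g H := by
  obtain ⟨u, hu, rfl⟩ := hh
  ext x
  constructor
  · rintro ⟨_, ⟨v, hv, rfl⟩, rfl⟩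
    exact ⟨u * v, mul_mem hu hv, by simp [mul_assoc]⟩
  · rintro ⟨v, hv, rfl⟩
    exact ⟨_, ⟨u⁻¹ * v, mul_mem (inv_mem hu) hv, rfl⟩, by simp [mul_assoc]⟩

end ArtinDiagram

/-- In a `2`-dimensional Artin group, if two cosets `g₁⟨a₁⟩` and
`g₂⟨a₂⟩` of vertex cyclic subgroups are at finite Hausdorff distance then the
conjugate cyclic subgroups `g₁⟨a₁⟩g₁⁻¹` and `g₂⟨a₂⟩g₂⁻¹` coincide; in particular
`g₁⟨a₁⟩g₁⁻¹` stabilizes, by left multiplication, every coset `g⟨a⟩` at finite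
Hausdorff distance from `g₁⟨a₁⟩`. -/
theorem parallel_vertex_cosets_conjugate_subgroups_eq {V : Type*} [Finite V]
    (Γ : LabeledGraph V) (h2d : Γ.TwoDimensional)
    (a₁ a₂ : V) (g₁ g₂ : ArtinGroup Γ)
    (hpar : CoarseParallel (artinDist Γ)
        (leftCosetSet g₁ (Subgroup.zpowers (artinGen Γ a₁)))
        (leftCosetSet g₂ (Subgroup.zpowers (artinGen Γ a₂)))) :
    Subgroup.map (MulAut.conj g₁).toMonoidHom (Subgroup.zpowers (artinGen Γ a₁)) =
      Subgroup.map (MulAut.conj g₂).toMonoidHom (Subgroup.zpowers (artinGen Γ a₂)) ∧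
    ∀ (a : V) (g : ArtinGroup Γ),
      CoarseParallel (artinDist Γ)
          (leftCosetSet g (Subgroup.zpowers (artinGen Γ a)))
          (leftCosetSet g₁ (Subgroup.zpowers (artinGen Γ a₁))) →
        ∀ h ∈ Subgroup.map (MulAut.conj g₁).toMonoidHom
            (Subgroup.zpowers (artinGen Γ a₁)),
          (fun x => h * x) '' leftCosetSet g (Subgroup.zpowers (artinGen Γ a)) =
            leftCosetSet g (Subgroup.zpowers (artinGen Γ a)) := by
  refine ⟨ArtinDiagram.zpowers_conj_eq h2d hpar, fun a g hg h hh => ArtinDiagram.image_leftCosetSet ?_⟩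
  rwa [ArtinDiagram.zpowers_conj_eq h2d hg]
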